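/- arXiv:1503.07603 — 9 statements merged into one kernel-verified Lean document; each statement's English description precedes it below -/
import Mathlib

section
/- Let k be a field with a fixed algebraic closure k̄, and let r ≥ 1 be an integer. Let f(X) ∈ k[X] be a polynomial of degree r whose coefficient of X^r equals (−1)^{(r−1)r/2}. Then there exist symmetric r×r matrices M_0, M_1 with entries in k such that det(X·M_0 + M_1) = f(X) in k[X], and for every a ∈ k̄ the matrix a·M_0 + M_1 (entries viewed in k̄) has rank at least r − 1. -/
open Polynomial Matrix

theorem antitri_det {R : Type*} [CommRing R] (u : R) : ∀ (n : ℕ) (A : Matrix (Fin n) (Fin n) R)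
    (_ : ∀ i j : Fin n, n ≤ (i : ℕ) + j → A i j = 0)
    (_ : ∀ i j : Fin n, (i : ℕ) + j + 1 = n → A i j = u),
    A.det = (-1) ^ (n * (n - 1) / 2) * u ^ n := by
  intro n
  induction n with
  | zero => intro A _ _; simp
  | succ n ih =>
    intro A h0 h1
    rw [det_succ_row A (Fin.last n), Finset.sum_eq_single 0]
    · rw [h1 _ _ (by simp), ih]
      · have : (n + 1) * (n + 1 - 1) / 2 = n * (n - 1) / 2 + n := by
          have := Nat.triangle_succ n
          simpa using this
        rw [this, pow_add, pow_succ u]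
        simp
        ring
      · intro i j hij
        apply h0
        simp
        omega
      · intro i j hij
        apply h1
        simp
        omega
    · intro j _ hj
      rw [h0 _ _ (by
        have : (j : ℕ) ≠ 0 := fun h => hj (Fin.ext h)
        simp; omega)]
      simp
    · simp

/-- The pencil. -/
def pencil {R : Type*} [CommRing R] (h : ℕ → R) (x : R) (n : ℕ) :
    Matrix (Fin (n+1)) (Fin (n+1)) R := of fun i j =>
  x * h (i + j + 1) + (if (i : ℕ) = 0 then (if (j : ℕ) = 0 then h 0 else 0)
    else if (j : ℕ) = 0 then 0 else - h (i + j))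

theorem pencil_sub_det {R : Type*} [CommRing R] (h : ℕ → R) (x : R) (n : ℕ)
    (h1 : h (n + 1) = 1) (h0 : ∀ m, n + 1 < m → h m = 0) :
    ((pencil h x n).submatrix Fin.succ Fin.succ).det = (-1) ^ (n * (n + 1) / 2) := by
  rw [antitri_det (-1) n]
  · rw [← pow_add]
    congr 1
    have := Nat.triangle_succ n
    simp at this
    rw [mul_comm n (n+1)]
    omega
  · intro i j hij
    simp [pencil]
    rw [h0 _ (by omega), h0 _ (by omega)]; simp
  · intro i j hij
    simp [pencil]
    rw [h0 _ (by omega), show (i : ℕ) + 1 + (j + 1) = n + 1 by omega, h1]; simp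

theorem pencil_det {R : Type*} [CommRing R] (h : ℕ → R) (x : R) (n : ℕ)
    (h1 : h (n + 1) = 1) (h0 : ∀ m, n + 1 < m → h m = 0) :
    (pencil h x n).det = (∑ i ∈ Finset.range (n + 2), h i * x ^ i) * (-1) ^ (n * (n + 1) / 2) := by
  have key := det_updateRow_sum (pencil h x n) 0 (fun i => x ^ (i : ℕ))
  simp only [Fin.val_zero, pow_zero, one_smul] at key
  rw [← key, det_succ_row_zero, Finset.sum_eq_single 0]
  · have e : ((pencil h x n).updateRow 0 (∑ i : Fin (n+1), x ^ (i : ℕ) • pencil h x n i)).submatrix Fin.succ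
        (Fin.succAbove 0) = (pencil h x n).submatrix Fin.succ Fin.succ := by
      ext i j; simp [updateRow_apply]
    rw [e, pencil_sub_det h x n h1 h0]
    congr 1
    simp [pencil]
    rw [Fin.sum_univ_succ]
    simp [Finset.sum_range_succ' _ (n + 1)]
    rw [Finset.sum_range_succ', ← Fin.sum_univ_eq_sum_range (fun i => h (i+1+1) * x ^ (i+1+1))]
    simp [pow_succ]
    have : ∀ i : Fin n, x ^ (i : ℕ) * x * (x * h (i + 1 + 1)) = h (i+1+1) * (x ^ (i : ℕ) * x * x) := by
      intro i; ring
    simp [this]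
    ring
  · intro j _ hj
    have hj' : (j : ℕ) ≠ 0 := fun h => hj (Fin.ext h)
    suffices H : (∑ i : Fin (n+1), x ^ (i : ℕ) • pencil h x n i) j = 0 by rw [updateRow_self, H]; simp
    simp only [pencil, Finset.sum_apply, Pi.smul_apply, of_apply, smul_eq_mul, hj', if_false, ite_self]
    have T : ∀ m, ∑ i ∈ Finset.range (m+1), x ^ i * (x * h (i + j + 1) +
        if i = 0 then 0 else - h (i + j)) = x ^ (m+1) * h (m + j + 1) := by
      intro m
      induction m with
      | zero => simp
      | succ m ih =>
        rw [Finset.sum_range_succ, ih]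
        simp
        rw [show m + 1 + (j : ℕ) = m + j + 1 by omega]
        ring
    rw [Fin.sum_univ_eq_sum_range (fun i => x ^ i * (x * h (i + j + 1) +
        if i = 0 then 0 else - h (i + j))), T, h0 _ (by omega), mul_zero]
  · simp

theorem pair_symmetric_matrices_with_given_det_and_rank
    (k : Type*) [Field k] (r : ℕ) (hr : 1 ≤ r)
    (f : k[X]) (hdeg : f.degree = (r : ℕ))
    (hlead : f.coeff r = (-1 : k) ^ ((r - 1) * r / 2)) :
    ∃ M₀ M₁ : Matrix (Fin r) (Fin r) k,
      M₀.IsSymm ∧ M₁.IsSymm ∧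
      ((Polynomial.X : k[X]) • M₀.map (Polynomial.C : k → k[X])
        + M₁.map (Polynomial.C : k → k[X])).det = f ∧
      ∀ a : AlgebraicClosure k,
        r - 1 ≤ (a • M₀.map (algebraMap k (AlgebraicClosure k))
          + M₁.map (algebraMap k (AlgebraicClosure k))).rank := by
  obtain ⟨n, rfl⟩ : ∃ n, r = n + 1 := ⟨r - 1, by omega⟩
  simp only [Nat.add_sub_cancel] at hlead ⊢
  set c : k := (-1 : k) ^ (n * (n + 1) / 2) with hc
  have hcc : c * c = 1 := by
    rw [hc, ← mul_pow]; simp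
  let g : ℕ → k := fun m => c * f.coeff m
  have g1 : g (n + 1) = 1 := by simp only [g, hlead, hcc]
  have g0 : ∀ m, n + 1 < m → g m = 0 := by
    intro m hm
    simp only [g]
    rw [coeff_eq_zero_of_degree_lt (by rw [hdeg]; exact_mod_cast hm), mul_zero]
  let M₀ : Matrix (Fin (n+1)) (Fin (n+1)) k := of fun i j => g (i + j + 1)
  let M₁ : Matrix (Fin (n+1)) (Fin (n+1)) k := of fun i j =>
    (if (i : ℕ) = 0 then (if (j : ℕ) = 0 then g 0 else 0)
      else if (j : ℕ) = 0 then 0 else - g (i + j))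
  have hP : ∀ {S : Type _} [CommRing S] (φ : k →+* S) (x : S),
      x • M₀.map φ + M₁.map φ = pencil (fun m => φ (g m)) x n := by
    intro S _ φ x
    ext i j
    simp only [pencil, M₀, M₁, Matrix.add_apply, Matrix.smul_apply, Matrix.map_apply, of_apply,
      smul_eq_mul]
    split_ifs <;> simp
  refine ⟨M₀, M₁, ?_, ?_, ?_, ?_⟩
  · ext i j; simp [M₀, add_comm (i : ℕ)]
  · ext i j
    simp only [M₁, transpose_apply, of_apply, add_comm (i : ℕ)]
    split_ifs <;> rfl
  · rw [hP (C : k →+* k[X]), pencil_det _ _ _ (by simp [g1]) (fun m hm => by simp [g0 m hm])]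
    have hnd : f.natDegree = n + 1 := natDegree_eq_of_degree_eq_some hdeg
    have hc' : ((-1 : k[X]) ^ (n * (n + 1) / 2)) = C c := by simp [hc]
    rw [hc']
    conv_rhs => rw [f.as_sum_range_C_mul_X_pow, hnd]
    rw [Finset.sum_mul]
    refine Finset.sum_congr rfl fun i _ => ?_
    have : C (f.coeff i) = C (c * c * f.coeff i) := by rw [hcc, one_mul]
    rw [this]
    simp only [g, C_mul]
    ring
  · intro a
    rw [hP (algebraMap k (AlgebraicClosure k))]
    have hd := pencil_sub_det (fun m => algebraMap k (AlgebraicClosure k) (g m)) a n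
      (by simp [g1]) (fun m hm => by simp [g0 m hm])
    refine le_trans ?_ (rank_submatrix_le _ Fin.succ Fin.succ)
    rw [rank_of_isUnit]
    · simp
    · rw [isUnit_iff_isUnit_det, hd]
      exact (isUnit_one.neg).pow _
end

section
/- Let k be a field with a fixed algebraic closure k̄, and let r ≥ 1. Let f(X_0,X_1) = Σ_{i=0}^{r} c_i X_0^i X_1^{r−i} ∈ k[X_0,X_1] be a homogeneous polynomial of degree r, and let s ≥ 0 be an integer such that c_i = 0 for all i > r−s and c_{r−s} = (−1)^{(r−1)r/2} (i.e. f(X_0,X_1) = X_1^s · g(X_0,X_1) where the coefficient of X_0^{r−s} in g equals (−1)^{(r−1)r/2}). Then there exist symmetric r×r matrices M_0, M_1 with entries in k such that det(X_0 M_0 + X_1 M_1) = f(X_0,X_1), and rank(a M_0 + b M_1) ≥ r − 1 for every (a,b) ∈ k̄² with (a,b) ≠ (0,0). -/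
open Matrix MvPolynomial

namespace SymPair

universe u

/-- the pencil -/
def Pen {k R : Type*} [Field k] [CommRing R] [Algebra k R] {n : Type*}
    (M₀ M₁ : Matrix n n k) (x y : R) : Matrix n n R :=
  x • M₀.map (algebraMap k R) + y • M₁.map (algebraMap k R)

/-- homogeneous form -/
def hom {k R : Type*} [Field k] [CommRing R] [Algebra k R] (r : ℕ) (c : ℕ → k) (x y : R) : R :=
  ∑ i ∈ Finset.range (r + 1), algebraMap k R (c i) * x ^ i * y ^ (r - i)

/-- kernel at most one dimensional -/
def Rk {K : Type*} [Field K] {n : Type*} [Fintype n] (A : Matrix n n K) : Prop :=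
  ∃ w : n → K, ∀ v : n → K, A *ᵥ v = 0 → w ⬝ᵥ v = 0 → v = 0

def Good {k : Type u} [Field k] (r : ℕ) (c : ℕ → k) : Prop :=
  ∃ M₀ M₁ : Matrix (Fin r) (Fin r) k, M₀.IsSymm ∧ M₁.IsSymm ∧
    (∀ (R : Type u) [CommRing R] [Algebra k R] (x y : R), (Pen M₀ M₁ x y).det = hom r c x y) ∧
    ∀ a b : AlgebraicClosure k, (a, b) ≠ (0, 0) → Rk (Pen M₀ M₁ a b)

def ext {R : Type*} [CommRing R] {n : ℕ} (A : Matrix (Fin (n+1)) (Fin (n+1)) R) (d x y : R) :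
    Matrix (Fin (n+3)) (Fin (n+3)) R :=
  Matrix.of (Fin.cons (Fin.cons d (Fin.cons x (fun _ => 0)))
    (Fin.cons (Fin.cons x (Fin.cons 0 (Fin.cons y (fun _ => 0))))
      (fun i => Fin.cons 0 (Fin.cons (Fin.cons (α := fun _ => R) y (fun _ => 0) i) (A i)))))

theorem minor_ext {R : Type*} [CommRing R] {n : ℕ} (A : Matrix (Fin (n+1)) (Fin (n+1)) R)
    (d x y : R) :
    ((ext A d x y).submatrix Fin.succ Fin.succ).det
      = - y ^ 2 * (A.submatrix Fin.succ Fin.succ).det := by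
  rw [det_succ_row_zero, Fin.sum_univ_succ, Fin.sum_univ_succ]
  rw [det_succ_column_zero (n := n) , Fin.sum_univ_succ]
  rw [det_succ_column_zero (n := n) , Fin.sum_univ_succ]
  have : ((ext A d x y).submatrix Fin.succ Fin.succ) 0 0 = 0 := by simp [ext]
  rw [this]
  have h2 : ((((ext A d x y).submatrix Fin.succ Fin.succ).submatrix Fin.succ
    (Fin.succ (0 : Fin (n+1))).succAbove).submatrix (Fin.succAbove 0) Fin.succ)
     = (A.submatrix Fin.succ Fin.succ) := by
    ext i j
    simp [ext]
  rw [h2]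
  simp [ext]
  change y * (y * _) = _
  ring

theorem det_ext {R : Type*} [CommRing R] {n : ℕ} (A : Matrix (Fin (n+1)) (Fin (n+1)) R)
    (d x y : R) :
    (ext A d x y).det
      = - x ^ 2 * A.det - d * y ^ 2 * (A.submatrix Fin.succ Fin.succ).det := by
  rw [det_succ_row_zero, Fin.sum_univ_succ, Fin.sum_univ_succ]
  have h1 : (ext A d x y).submatrix Fin.succ (Fin.succAbove 0)
     = (ext A d x y).submatrix Fin.succ Fin.succ := by
    ext i j; simp
  rw [h1, minor_ext]
  have h3 : ((ext A d x y).submatrix Fin.succ (Fin.succ (0 : Fin (n+2))).succAbove).det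
    = x * A.det := by
    rw [det_succ_column_zero, Fin.sum_univ_succ]
    have h2 : ((ext A d x y).submatrix Fin.succ (Fin.succ (0 : Fin (n+2))).succAbove).submatrix
       (Fin.succAbove 0) Fin.succ = A := by
      ext i j
      simp [ext]
    rw [h2]
    simp [ext]
  rw [h3]
  simp [ext]
  ring

theorem ext_symm {R : Type*} [CommRing R] {n : ℕ} (A : Matrix (Fin (n+1)) (Fin (n+1)) R)
    (hA : A.IsSymm) (d x y : R) : (ext A d x y).IsSymm := by
  ext i j
  simp only [Matrix.transpose_apply]
  refine Fin.cases ?_ (fun i => Fin.cases ?_ (fun i => ?_) i) i <;>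
  refine Fin.cases ?_ (fun j => Fin.cases ?_ (fun j => ?_) j) j <;> simp [ext]
  · exact hA.apply i j

theorem pen_ext {k R : Type*} [Field k] [CommRing R] [Algebra k R] {n : ℕ}
    (M₀ M₁ : Matrix (Fin (n+1)) (Fin (n+1)) k) (d₀ d₁ : k) (x y : R) :
    Pen (ext M₀ d₀ 1 0) (ext M₁ d₁ 0 1) x y
      = ext (Pen M₀ M₁ x y) (x * algebraMap k R d₀ + y * algebraMap k R d₁) x y := by
  ext i j
  refine Fin.cases ?_ (fun i => Fin.cases ?_ (fun i => ?_) i) i <;>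
  refine Fin.cases ?_ (fun j => Fin.cases ?_ (fun j => ?_) j) j <;> simp [ext, Pen]
  · refine Fin.cases ?_ (fun j => ?_) j <;> simp
  · refine Fin.cases ?_ (fun j => ?_) i <;> simp

theorem rk_of_minor {K : Type*} [Field K] {n : ℕ} (A : Matrix (Fin (n+1)) (Fin (n+1)) K)
    (h : (A.submatrix Fin.succ Fin.succ).det ≠ 0) : Rk A := by
  refine ⟨Pi.single 0 1, fun v hv hw => ?_⟩
  have h0 : v 0 = 0 := by simpa using hw
  have : (A.submatrix Fin.succ Fin.succ) *ᵥ (fun i => v i.succ) = 0 := by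
    ext i
    have := congrFun hv i.succ
    simp only [Matrix.mulVec, dotProduct, Fin.sum_univ_succ, h0] at this
    simpa [Matrix.mulVec, dotProduct] using this
  have h1 := Matrix.eq_zero_of_mulVec_eq_zero h this
  ext i
  refine Fin.cases h0 (fun i => congrFun h1 i) i

theorem rk_of_det {K : Type*} [Field K] {n : Type*} [Fintype n] [DecidableEq n] (A : Matrix n n K)
    (h : A.det ≠ 0) : Rk A :=
  ⟨0, fun _ hv _ => Matrix.eq_zero_of_mulVec_eq_zero h hv⟩

theorem rk_ext_zero {K : Type*} [Field K] {n : ℕ} (A : Matrix (Fin (n+1)) (Fin (n+1)) K)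
    (d a : K) (ha : a ≠ 0) (h : Rk A) : Rk (ext A d a 0) := by
  obtain ⟨w, hw⟩ := h
  refine ⟨Fin.cons 0 (Fin.cons 0 w), fun v hv hv' => ?_⟩
  have e1 := congrFun hv 1
  have e0 := congrFun hv 0
  have h0 : v 0 = 0 := by
    have : (1 : Fin (n+3)) = Fin.succ 0 := rfl
    rw [this] at e1
    simp only [Matrix.mulVec, dotProduct, Fin.sum_univ_succ (n := n+2),
      Fin.sum_univ_succ (n := n+1), Fin.sum_univ_succ (n := n)] at e1
    simp [ext] at e1
    change a * v 0 + 0 * v 2 = 0 at e1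
    simpa [ha] using e1
  have h1 : v (Fin.succ 0) = 0 := by
    simp only [Matrix.mulVec, dotProduct, Fin.sum_univ_succ (n := n+2),
      Fin.sum_univ_succ (n := n+1)] at e0
    simpa [ext, ha, h0] using e0
  have h2 : (fun i : Fin (n+1) => v i.succ.succ) = 0 := by
    apply hw
    · ext i
      have := congrFun hv i.succ.succ
      simp only [Matrix.mulVec, dotProduct, Fin.sum_univ_succ (n := n+2),
        Fin.sum_univ_succ (n := n+1), h0, h1] at this
      simpa [ext, Matrix.mulVec, dotProduct] using this
    · simp only [dotProduct, Fin.sum_univ_succ (n := n+2),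
        Fin.sum_univ_succ (n := n+1), h0, h1] at hv'
      simpa [dotProduct] using hv'
  ext i
  refine Fin.cases h0 (fun i => Fin.cases h1 (fun i => congrFun h2 i) i) i

/-- strengthened invariant -/
def Good' {k : Type u} [Field k] (n : ℕ) (c : ℕ → k) : Prop :=
  ∃ (M₀ M₁ : Matrix (Fin (n+1)) (Fin (n+1)) k) (ε : k), ε * ε = 1 ∧ M₀.IsSymm ∧ M₁.IsSymm ∧
    (∀ (R : Type u) [CommRing R] [Algebra k R] (x y : R),
      (Pen M₀ M₁ x y).det = hom (n+1) c x y) ∧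
    (∀ (R : Type u) [CommRing R] [Algebra k R] (x y : R),
      ((Pen M₀ M₁ x y).submatrix Fin.succ Fin.succ).det = algebraMap k R ε * y ^ n) ∧
    ∀ a b : AlgebraicClosure k, (a, b) ≠ (0, 0) → Rk (Pen M₀ M₁ a b)

theorem Good'.good {k : Type u} [Field k] {n : ℕ} {c : ℕ → k} (h : Good' n c) : Good (n+1) c := by
  obtain ⟨M₀, M₁, ε, -, h0, h1, h2, -, h3⟩ := h
  exact ⟨M₀, M₁, h0, h1, h2, h3⟩

theorem good'_step {k : Type u} [Field k] (n : ℕ) (c : ℕ → k)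
    (h : Good' n (fun i => - c (i+2))) : Good' (n+2) c := by
  obtain ⟨M₀, M₁, ε, hε, h0, h1, h2, h3, h4⟩ := h
  have hm : ∀ (R : Type u) [CommRing R] [Algebra k R] (x y : R),
      ((Pen (ext M₀ (-ε * c 1) 1 0) (ext M₁ (-ε * c 0) 0 1) x y).submatrix
        Fin.succ Fin.succ).det = algebraMap k R (-ε) * y ^ (n+2) := by
    intro R _ _ x y
    rw [pen_ext, minor_ext, h3]
    simp only [map_neg]; ring
  refine ⟨ext M₀ (-ε * c 1) 1 0, ext M₁ (-ε * c 0) 0 1, -ε, by simpa using hε,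
    ext_symm _ h0 _ _ _, ext_symm _ h1 _ _ _, ?_, hm, ?_⟩
  · intro R _ _ x y
    rw [pen_ext, det_ext, h2, h3]
    have hε' : algebraMap k R ε * algebraMap k R ε = 1 := by rw [← map_mul, hε, map_one]
    unfold hom
    rw [Finset.sum_range_succ' _ (n+2+1), Finset.sum_range_succ' _ (n+2), Finset.mul_sum]
    have : ∀ i ∈ Finset.range (n+1+1), -x^2 * (algebraMap k R (- c (i+2)) * x ^ i * y ^ (n+1-i))
       = algebraMap k R (c (i+1+1)) * x ^ (i+1+1) * y ^ (n+2+1-(i+1+1)) := by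
      intro i _
      have : n+2+1-(i+1+1) = n+1-i := by omega
      rw [this, map_neg]; ring
    rw [Finset.sum_congr rfl this]
    have e : n + 2 + 1 - (0+1) = n + 2 := by omega
    rw [e]
    simp only [map_mul, map_neg, zero_add, pow_zero, Nat.sub_zero, pow_one]
    linear_combination (x * algebraMap k R (c 1) + y * algebraMap k R (c 0)) * y ^ (n+2) * hε'
  · intro a b hab
    by_cases hb : b = 0
    · subst hb
      have ha : a ≠ 0 := by rintro rfl; exact hab rfl
      rw [pen_ext]
      exact rk_ext_zero _ _ _ ha (h4 a 0 hab)
    · apply rk_of_minor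
      rw [hm]
      have : ε ≠ 0 := by rintro rfl; simp at hε
      simp [this, hb]

theorem good'_odd {k : Type u} [Field k] (m : ℕ) : ∀ c : ℕ → k, Good' (2*m) c := by
  induction m with
  | zero =>
    intro c
    refine ⟨!![c 1], !![c 0], 1, by simp, ?_, ?_, ?_, ?_, ?_⟩
    · ext i j; fin_cases i; fin_cases j; rfl
    · ext i j; fin_cases i; fin_cases j; rfl
    · intro R _ _ x y
      simp [Pen, hom, Finset.sum_range_succ]; ring
    · intro R _ _ x y
      simp
    · intro a b _
      apply rk_of_minor
      simp
  | succ m ih =>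
    intro c
    exact good'_step (2*m) c (ih _)

theorem good'_even {k : Type u} [Field k] (m : ℕ) :
    ∀ c : ℕ → k, c (2*(m+1)) = (-1)^(m+1) → Good' (2*m+1) c := by
  induction m with
  | zero =>
    intro c hc
    have hc : c 2 = -1 := by simpa using hc
    have hm : ∀ (R : Type u) [CommRing R] [Algebra k R] (x y : R),
      ((Pen !![c 1, 1; 1, 0] !![c 0, 0; 0, 1] x y).submatrix
        Fin.succ Fin.succ).det = algebraMap k R 1 * y ^ (2*0+1) := by
      intro R _ _ x y
      simp [Pen]
    refine ⟨!![c 1, 1; 1, 0], !![c 0, 0; 0, 1], 1, by simp, ?_, ?_, ?_, hm, ?_⟩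
    · ext i j; fin_cases i <;> fin_cases j <;> rfl
    · ext i j; fin_cases i <;> fin_cases j <;> rfl
    · intro R _ _ x y
      simp [Pen, hom, Finset.sum_range_succ, det_fin_two, hc]; ring
    · intro a b hab
      by_cases hb : b = 0
      · subst hb
        have ha : a ≠ 0 := by rintro rfl; exact hab rfl
        apply rk_of_det
        simp [Pen, det_fin_two, ha]
      · apply rk_of_minor
        rw [hm]
        simp [hb]
  | succ m ih =>
    intro c hc
    refine good'_step (2*m+1) c (ih _ ?_)
    have : 2*(m+1)+2 = 2*(m+1+1) := by ring
    simp only [this, hc]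
    ring

theorem good_odd {k : Type u} [Field k] (m : ℕ) (c : ℕ → k) : Good (2*m+1) c :=
  (good'_odd m c).good

theorem good_even {k : Type u} [Field k] (m : ℕ) (c : ℕ → k) (hc : c (2*m) = (-1)^m) :
    Good (2*m) c := by
  cases m with
  | zero =>
    refine ⟨0, 0, by ext i; exact i.elim0, by ext i; exact i.elim0, ?_, ?_⟩
    · intro R _ _ x y
      have : c 0 = 1 := by simpa using hc
      simp [hom, this]
    · intro a b _
      exact ⟨0, fun v _ _ => by ext i; exact i.elim0⟩
  | succ m => exact (good'_even m c hc).good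

theorem good_swap {k : Type u} [Field k] {r : ℕ} {c : ℕ → k} (h : Good r c) :
    Good r (fun i => c (r - i)) := by
  obtain ⟨M₀, M₁, h0, h1, h2, h3⟩ := h
  have hp : ∀ (R : Type u) [CommRing R] [Algebra k R] (x y : R),
      Pen M₁ M₀ x y = Pen M₀ M₁ y x := by
    intro R _ _ x y
    simp [Pen, add_comm]
  refine ⟨M₁, M₀, h1, h0, ?_, ?_⟩
  · intro R _ _ x y
    rw [hp, h2]
    unfold hom
    rw [← Finset.sum_range_reflect]
    apply Finset.sum_congr rfl
    intro i hi
    have hi : i ≤ r := by simpa [Nat.lt_succ_iff] using hi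
    have e : r + 1 - 1 - i = r - i := by omega
    have e' : r - (r - i) = i := by omega
    rw [e, e']; ring
  · intro a b hab
    rw [hp]
    apply h3
    intro h; apply hab
    simp only [Prod.mk.injEq] at h ⊢
    exact h.symm

theorem good_block {k : Type u} [Field k] {p q : ℕ} {c₁ c₂ c : ℕ → k}
    (H1 : Good p c₁) (H2 : Good q c₂)
    (hmul : ∀ (R : Type u) [CommRing R] [Algebra k R] (x y : R),
      hom p c₁ x y * hom q c₂ x y = hom (p+q) c x y)
    (hz : ∀ a b : AlgebraicClosure k, (a, b) ≠ (0, 0) → hom p c₁ a b ≠ 0 ∨ hom q c₂ a b ≠ 0) :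
    Good (p+q) c := by
  obtain ⟨M₀, M₁, h0, h1, h2, h3⟩ := H1
  obtain ⟨N₀, N₁, g0, g1, g2, g3⟩ := H2
  let e := (finSumFinEquiv (m := p) (n := q)).symm
  have hp : ∀ (R : Type u) [CommRing R] [Algebra k R] (x y : R),
      Pen ((fromBlocks M₀ 0 0 N₀).submatrix e e) ((fromBlocks M₁ 0 0 N₁).submatrix e e) x y
       = (fromBlocks (Pen M₀ M₁ x y) 0 0 (Pen N₀ N₁ x y)).submatrix e e := by
    intro R _ _ x y
    ext i j
    simp only [Pen, Matrix.add_apply, Matrix.smul_apply, Matrix.map_apply, Matrix.submatrix_apply]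
    rcases e i with i | i <;> rcases e j with j | j <;> simp
  refine ⟨(fromBlocks M₀ 0 0 N₀).submatrix e e, (fromBlocks M₁ 0 0 N₁).submatrix e e,
    ?_, ?_, ?_, ?_⟩
  · exact (Matrix.IsSymm.fromBlocks h0 (by simp) g0).submatrix e
  · exact (Matrix.IsSymm.fromBlocks h1 (by simp) g1).submatrix e
  · intro R _ _ x y
    rw [hp, det_submatrix_equiv_self, det_fromBlocks_zero₂₁, h2, g2, hmul]
  · intro a b hab
    rw [hp]
    have key : Rk (fromBlocks (Pen M₀ M₁ a b) 0 0 (Pen N₀ N₁ a b)) := by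
      rcases hz a b hab with h | h
      · rw [← h2] at h
        obtain ⟨w, hw⟩ := g3 a b hab
        refine ⟨Sum.elim 0 w, fun v hv hv' => ?_⟩
        rw [← Sum.elim_comp_inl_inr v] at hv hv' ⊢
        rw [fromBlocks_mulVec] at hv
        have hl := fun i => congrFun hv (Sum.inl i)
        have hr := fun i => congrFun hv (Sum.inr i)
        rw [sumElim_dotProduct_sumElim] at hv'
        simp at hl hr hv'
        have a1 := Matrix.eq_zero_of_mulVec_eq_zero h (funext hl)
        have a2 := hw _ (funext hr) hv'
        rw [a1, a2]; simp
      · rw [← g2] at h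
        obtain ⟨w, hw⟩ := h3 a b hab
        refine ⟨Sum.elim w 0, fun v hv hv' => ?_⟩
        rw [← Sum.elim_comp_inl_inr v] at hv hv' ⊢
        rw [fromBlocks_mulVec] at hv
        have hl := fun i => congrFun hv (Sum.inl i)
        have hr := fun i => congrFun hv (Sum.inr i)
        rw [sumElim_dotProduct_sumElim] at hv'
        simp at hl hr hv'
        have a1 := Matrix.eq_zero_of_mulVec_eq_zero h (funext hr)
        have a2 := hw _ (funext hl) hv'
        rw [a1, a2]; simp
    obtain ⟨w, hw⟩ := key
    refine ⟨w ∘ e, fun v hv hv' => ?_⟩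
    have := hw (v ∘ e.symm) (by
      rw [submatrix_mulVec_equiv] at hv
      ext i
      have := congrFun hv (e.symm i)
      simpa using this) (by
      rw [← hv']
      simp only [dotProduct]
      rw [← e.sum_comp]; simp)
    ext i
    simpa using congrFun this (e i)

theorem rank_of_rk {K : Type*} [Field K] {r : ℕ} (A : Matrix (Fin r) (Fin r) K) (h : Rk A) :
    r - 1 ≤ A.rank := by
  obtain ⟨w, hw⟩ := h
  have h1 := LinearMap.finrank_range_add_finrank_ker A.mulVecLin
  rw [Module.finrank_fintype_fun_eq_card, Fintype.card_fin] at h1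
  let φ : LinearMap.ker A.mulVecLin →ₗ[K] K :=
    (dotProductBilin K K w).comp (LinearMap.ker A.mulVecLin).subtype
  have hφ : Function.Injective φ := by
    rw [injective_iff_map_eq_zero]
    rintro ⟨v, hv⟩ h
    have : v = 0 := hw v (by simpa using hv) (by simpa [φ] using h)
    simpa using this
  have h2 := LinearMap.finrank_le_finrank_of_injective hφ
  rw [Module.finrank_self] at h2
  unfold Matrix.rank
  omega

theorem good_main {k : Type u} [Field k] (r s : ℕ) (hs : s ≤ r) (c : ℕ → k)
    (hvan : ∀ i : ℕ, r - s < i → c i = 0)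
    (hcoef : c (r - s) = (-1 : k) ^ ((r - 1) * r / 2)) : Good r c := by
  obtain ⟨q, rfl⟩ := Nat.exists_eq_add_of_le hs
  have eq : s + q - s = q := by omega
  rw [eq] at hvan hcoef
  have main : ∀ ε : k, ε * ε = 1 → Good s (fun i => if i = 0 then ε else 0) →
      Good q (fun i => ε * c i) → Good (s+q) c := by
    intro ε hε H1 H2
    have hε0 : ε ≠ 0 := by rintro rfl; simp at hε
    have e1 : ∀ (R : Type u) [CommRing R] [Algebra k R] (x y : R),
        hom s (fun i => if i = 0 then ε else 0) x y = algebraMap k R ε * y ^ s := by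
      intro R _ _ x y
      unfold hom
      rw [Finset.sum_eq_single 0]
      · simp
      · intro i _ hi; simp [hi]
      · simp
    refine good_block H1 H2 ?_ ?_
    · intro R _ _ x y
      have hε' : algebraMap k R ε * algebraMap k R ε = 1 := by rw [← map_mul, hε, map_one]
      rw [e1]
      unfold hom
      have hsub : Finset.range (q+1) ⊆ Finset.range (s+q+1) := by
        intro i; simp only [Finset.mem_range]; omega
      rw [← Finset.sum_subset hsub, Finset.mul_sum]
      · apply Finset.sum_congr rfl
        intro i hi
        have hi : i < q + 1 := by simpa using hi
        have : s + q - i = s + (q - i) := by omega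
        rw [this, pow_add, map_mul]
        linear_combination (algebraMap k R (c i) * x ^ i * y ^ s * y ^ (q-i)) * hε'
      · intro i _ hi
        rw [hvan i (by simp at hi; omega)]; simp
    · intro a b hab
      by_cases hb : b = 0
      · right
        subst hb
        have ha : a ≠ 0 := by rintro rfl; exact hab rfl
        unfold hom
        rw [Finset.sum_eq_single q]
        · simp [hcoef, ha, hε0]
        · intro i hi hi'
          have hi : i < q + 1 := by simpa using hi
          have : q - i ≠ 0 := by omega
          simp [this]
        · simp
      · left
        rw [e1]
        simp [hε0, hb]
  rcases Nat.even_or_odd' (s+q) with ⟨m, hm | hm⟩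
  · rcases Nat.even_or_odd' s with ⟨t, ht | ht⟩
    · obtain ⟨l, rfl⟩ : ∃ l, q = 2 * l := ⟨m - t, by omega⟩
      subst ht
      have hml : m = t + l := by omega
      refine main ((-1)^t) (by rw [← pow_add]; exact Even.neg_one_pow ⟨t, rfl⟩) ?_ ?_
      · have := good_swap (good_even (k := k) t (fun i => if i = 2*t then (-1)^t else 0) (by simp))
        obtain ⟨M₀, M₁, h0, h1, h2, h3⟩ := this
        refine ⟨M₀, M₁, h0, h1, ?_, h3⟩
        intro R _ _ x y
        rw [h2]
        unfold hom
        apply Finset.sum_congr rfl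
        intro i hi
        have hi : i < 2*t + 1 := by simpa using hi
        have : (2*t - i = 2*t) ↔ i = 0 := by omega
        simp [this]
      · apply good_even
        rw [hcoef, hm]
        have : (2*m-1) * (2*m) / 2 = (2*m-1)*m := by
          rw [show (2*m-1) * (2*m) = ((2*m-1)*m) * 2 by ring]; simp
        rw [this, pow_mul]
        rcases Nat.eq_zero_or_pos m with h | h
        · have : t = 0 := by omega
          have : l = 0 := by omega
          subst_vars; simp
        · have : Odd (2*m-1) := ⟨m-1, by omega⟩
          rw [this.neg_one_pow, hml, pow_add, ← mul_assoc, ← pow_add,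
            Even.neg_one_pow ⟨t, rfl⟩, one_mul]
    · obtain ⟨l, rfl⟩ : ∃ l, q = 2 * l + 1 := ⟨m - t - 1, by omega⟩
      subst ht
      exact main 1 (by simp) (good_odd _ _) (good_odd _ _)
  · rw [hm]; exact good_odd _ _

end SymPair


theorem pair_symmetric_matrices_with_given_homogeneous_det_and_rank
    (k : Type*) [Field k] (r s : ℕ) (hr : 1 ≤ r) (hs : s ≤ r)
    (c : ℕ → k) (f : MvPolynomial (Fin 2) k)
    (hf : f = ∑ i ∈ Finset.range (r + 1),
      MvPolynomial.C (c i) * MvPolynomial.X 0 ^ i * MvPolynomial.X 1 ^ (r - i))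
    (hvan : ∀ i : ℕ, r - s < i → c i = 0)
    (hcoef : c (r - s) = (-1 : k) ^ ((r - 1) * r / 2)) :
    ∃ M₀ M₁ : Matrix (Fin r) (Fin r) k,
      M₀.IsSymm ∧ M₁.IsSymm ∧
      ((MvPolynomial.X 0 : MvPolynomial (Fin 2) k) •
          M₀.map (MvPolynomial.C : k → MvPolynomial (Fin 2) k)
        + (MvPolynomial.X 1 : MvPolynomial (Fin 2) k) •
          M₁.map (MvPolynomial.C : k → MvPolynomial (Fin 2) k)).det = f ∧
      ∀ a b : AlgebraicClosure k, (a, b) ≠ (0, 0) →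
        r - 1 ≤ (a • M₀.map (algebraMap k (AlgebraicClosure k))
          + b • M₁.map (algebraMap k (AlgebraicClosure k))).rank := by

  obtain ⟨M₀, M₁, h0, h1, h2, h3⟩ := SymPair.good_main r s hs c hvan hcoef
  refine ⟨M₀, M₁, h0, h1, ?_, ?_⟩
  · rw [hf]
    exact h2 (MvPolynomial (Fin 2) k) (MvPolynomial.X 0) (MvPolynomial.X 1)
  · intro a b hab
    exact SymPair.rank_of_rk _ (h3 a b hab)
end

section
/- Let k be a field, r ≥ 1, and f(X) = Σ_{i=0}^{r} c_i X^i ∈ k[X] with c_r = (−1)^{(r−1)r/2}. Let L := k[X]/(f), let α ∈ L be the image of X, so (1, α, …, α^{r−1}) is a k-basis of L, and let θ: L → k be the k-linear functional extracting the coefficient of α^{r−1} with respect to this basis. Define r×r matrices over k (indices 0 ≤ i,j ≤ r−1) by (M_0)_{ij} := θ(α^{i+j}) and (M_1)_{ij} := −θ(α^{i+j+1}). Then: M_0 and M_1 are symmetric; det M_0 = (−1)^{(r−1)r/2} (in particular M_0 is invertible); the matrix −M_0^{−1}M_1 equals the companion matrix of the monic polynomial (−1)^{(r−1)r/2} f(X);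 and det(X·M_0 + M_1) = f(X) in k[X]. -/
open Polynomial Matrix

/-- The companion matrix of a polynomial `g` (of degree `r`): `1`'s on the subdiagonal,
last column `(-g.coeff 0, …, -g.coeff (r-1))ᵀ`, and `0`'s elsewhere. -/
def companionMatrix (k : Type*) [Field k] (r : ℕ) (g : Polynomial k) :
    Matrix (Fin r) (Fin r) k :=
  Matrix.of fun i j =>
    if (i : ℕ) = (j : ℕ) + 1 then 1
    else if (j : ℕ) = r - 1 then -g.coeff (i : ℕ) else 0

theorem antitri_det_s2 (k : Type*) [Field k] (n : ℕ) (M : Matrix (Fin n) (Fin n) k)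
    (h0 : ∀ i j : Fin n, (i : ℕ) + j + 1 < n → M i j = 0)
    (h1 : ∀ i j : Fin n, (i : ℕ) + j + 1 = n → M i j = 1) :
    M.det = (-1 : k) ^ ((n - 1) * n / 2) := by
  induction n with
  | zero => simp
  | succ n ih =>
    rw [Matrix.det_succ_row_zero, Finset.sum_eq_single (Fin.last n)]
    · rw [ih, h1 _ _ (by simp)]
      · have : (n + 1 - 1) * (n + 1) / 2 = n + (n - 1) * n / 2 := by
          rw [add_comm n (_ / 2), ← Nat.add_mul_div_left _ _ (by norm_num : 0 < 2)]
          congr 1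
          cases n with
          | zero => rfl
          | succ m => simp; ring
        rw [this, pow_add]; simp
      · intro i j hij
        apply h0
        simp; omega
      · intro i j hij
        apply h1
        simp; omega
    · intro j _ hj
      rw [h0]
      · simp
      · have : (j : ℕ) ≠ n := fun h => hj (Fin.ext h)
        simp; omega
    · simp

theorem symmetric_companion_construction
    (k : Type*) [Field k] (r : ℕ) (hr : 1 ≤ r)
    (f : k[X]) (hdeg : f.natDegree = r)
    (hlead : f.coeff r = (-1 : k) ^ ((r - 1) * r / 2))
    (θ : AdjoinRoot f →ₗ[k] k)
    (hθ : ∀ i : ℕ, i < r →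
      θ (AdjoinRoot.root f ^ i) = if i = r - 1 then 1 else 0)
    (M₀ M₁ : Matrix (Fin r) (Fin r) k)
    (hM₀ : ∀ i j : Fin r, M₀ i j = θ (AdjoinRoot.root f ^ ((i : ℕ) + (j : ℕ))))
    (hM₁ : ∀ i j : Fin r, M₁ i j = - θ (AdjoinRoot.root f ^ ((i : ℕ) + (j : ℕ) + 1))) :
    M₀.IsSymm ∧ M₁.IsSymm ∧
    M₀.det = (-1 : k) ^ ((r - 1) * r / 2) ∧
    IsUnit M₀ ∧
    - (M₀⁻¹ * M₁) = companionMatrix k r (Polynomial.C ((-1 : k) ^ ((r - 1) * r / 2)) * f) ∧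
    ((Polynomial.X : k[X]) • M₀.map (Polynomial.C : k → k[X])
      + M₁.map (Polynomial.C : k → k[X])).det = f := by
  have hdet : M₀.det = (-1 : k) ^ ((r - 1) * r / 2) := by
    apply antitri_det_s2
    · intro i j h
      rw [hM₀, hθ _ (by omega), if_neg (by omega)]
    · intro i j h
      rw [hM₀, hθ _ (by omega), if_pos (by omega)]
  set e : k := (-1 : k) ^ ((r - 1) * r / 2) with he
  have hee : e * e = 1 := by
    rw [he, ← mul_pow]; simp
  have he0 : e ≠ 0 := fun h => by simp [h] at hee
  have hdu : IsUnit M₀.det := by rw [hdet]; exact he0.isUnit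
  have hf0 : f ≠ 0 := by
    rintro rfl
    simp at hdeg; omega
  have hlc : f.leadingCoeff = e := by rw [leadingCoeff, hdeg, hlead]
  have heinv : e⁻¹ = e := inv_eq_of_mul_eq_one_left hee
  have hmul : M₀ * companionMatrix k r (C e * f) = - M₁ := by
    have hroot : ∑ l ∈ Finset.range (r + 1), f.coeff l • AdjoinRoot.root f ^ l = 0 := by
      have := AdjoinRoot.aeval_eq (f := f) f
      rw [AdjoinRoot.mk_self, aeval_eq_sum_range, hdeg] at this
      exact this
    ext i j
    rw [Matrix.mul_apply, Matrix.neg_apply, hM₁, neg_neg]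
    simp only [companionMatrix, Matrix.of_apply, hM₀]
    by_cases hj : (j : ℕ) = r - 1
    · have h1 : (i : ℕ) + j + 1 = i + r := by omega
      rw [h1]
      have h2 : AdjoinRoot.root f ^ ((i : ℕ) + r) =
          ∑ l ∈ Finset.range r, (- (e * f.coeff l)) • AdjoinRoot.root f ^ ((i : ℕ) + l) := by
        rw [Finset.sum_range_succ, hlead] at hroot
        have h3 : AdjoinRoot.root f ^ r =
            - e • ∑ l ∈ Finset.range r, f.coeff l • AdjoinRoot.root f ^ l := by
          rw [eq_neg_of_add_eq_zero_left hroot, neg_smul, smul_neg, neg_neg, smul_smul, hee,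
            one_smul]
        rw [pow_add, h3, Finset.smul_sum, Finset.mul_sum]
        refine Finset.sum_congr rfl fun l _ => ?_
        rw [smul_smul, mul_smul_comm, pow_add, neg_mul]
      rw [h2, map_sum, Finset.sum_range]
      refine Finset.sum_congr rfl fun l _ => ?_
      rw [if_neg (by omega), if_pos hj, map_smul, coeff_C_mul, smul_eq_mul, mul_comm]
    · rw [Finset.sum_eq_single (⟨j + 1, by omega⟩ : Fin r)]
      · simp [add_assoc]
      · intro b _ hb
        rw [if_neg (fun h => hb (Fin.ext h)), if_neg hj, mul_zero]
      · simp
  have hM1 : M₁ = - (M₀ * companionMatrix k r (C e * f)) := by rw [hmul, neg_neg]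
  refine ⟨?_, ?_, hdet, (Matrix.isUnit_iff_isUnit_det _).2 hdu, ?_, ?_⟩
  · ext i j
    simp [hM₀, add_comm]
  · ext i j
    simp [hM₁, add_comm]
  · rw [hM1, Matrix.mul_neg, neg_neg, Matrix.nonsing_inv_mul_cancel_left _ _ hdu]
  · have hcp : (companionMatrix k r (C e * f)).charpoly = C e * f := by
      have hmp : minpoly k (AdjoinRoot.powerBasis hf0).gen = C e * f := by
        rw [AdjoinRoot.minpoly_powerBasis_gen, hlc, heinv, mul_comm]
      have := charpoly_leftMulMatrix (AdjoinRoot.powerBasis hf0)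
      rw [hmp] at this
      subst hdeg
      rw [PowerBasis.leftMulMatrix, PowerBasis.minpolyGen_eq, hmp] at this
      refine Eq.trans ?_ this
      refine congrArg (Matrix.charpoly (n := Fin f.natDegree)) ?_
      refine Matrix.ext fun i j => ?_
      have hi := i.2
      have hj := j.2
      change (if (i : ℕ) = (j : ℕ) + 1 then (1 : k)
          else if (j : ℕ) = f.natDegree - 1 then -(C e * f).coeff (i : ℕ) else 0) =
        if (j : ℕ) + 1 = f.natDegree then -(C e * f).coeff (i : ℕ)
          else if (i : ℕ) = (j : ℕ) + 1 then 1 else 0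
      by_cases h : (j : ℕ) = f.natDegree - 1
      · rw [if_neg (by omega), if_pos h, if_pos (by omega)]
      · rw [if_neg h, if_neg (c := (j : ℕ) + 1 = f.natDegree) (by omega)]
    have hP : (X : k[X]) • M₀.map (C : k → k[X]) + M₁.map (C : k → k[X])
        = M₀.map C * (companionMatrix k r (C e * f)).charmatrix := by
      rw [charmatrix, Matrix.mul_sub, hM1]
      rw [sub_eq_add_neg]
      congr 1
      · ext1 i j; simp [Matrix.scalar_apply, Matrix.mul_diagonal, X_mul_C]
      · rw [RingHom.mapMatrix_apply]
        ext1 i j; simp [Matrix.mul_apply]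
    rw [hP, Matrix.det_mul]
    change (C.mapMatrix M₀).det * (companionMatrix k r (C e * f)).charpoly = f
    rw [hcp, ← RingHom.map_det, hdet, ← mul_assoc, ← C_mul, hee, C_1, one_mul]
end

section
/- Let k be a field and n ≥ 1. For every nonzero homogeneous polynomial f(X_0,X_1) ∈ k[X_0,X_1] of degree n+1 there exist λ ∈ k^× and symmetric (n+1)×(n+1) matrices M_0, M_1 over k such that det(X_0 M_0 + X_1 M_1) = λ·f(X_0,X_1). -/
open Matrix MvPolynomial

/-- Symmetric border of a matrix by one row and column. -/
def symBorder {R : Type*} [Zero R] {p : ℕ} (d t : R) (A : Matrix (Fin (p+1)) (Fin (p+1)) R) :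
    Matrix (Fin (p+2)) (Fin (p+2)) R :=
  Matrix.of fun i j => Fin.cases (motive := fun _ => R)
    (Fin.cases (motive := fun _ => R) d (fun j => if j = 0 then t else 0) j)
    (fun i => Fin.cases (motive := fun _ => R) (if i = 0 then t else 0) (fun j => A i j) j) i

theorem symBorder_succ {R : Type*} [Zero R] {p : ℕ} (d t : R)
    (A : Matrix (Fin (p+1)) (Fin (p+1)) R) :
    (symBorder d t A).submatrix Fin.succ Fin.succ = A := by
  ext i j; simp [symBorder]

theorem symBorder_det {R : Type*} [CommRing R] {p : ℕ} (d t : R)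
    (A : Matrix (Fin (p+1)) (Fin (p+1)) R) :
    (symBorder d t A).det = d * A.det - t^2 * (A.submatrix Fin.succ Fin.succ).det := by
  rw [Matrix.det_succ_row_zero, Fin.sum_univ_succ, Fin.sum_univ_succ]
  have h0 : (symBorder d t A) 0 0 = d := by simp [symBorder]
  have h1 : (symBorder d t A) 0 (Fin.succ 0) = t := rfl
  have h2 : ∀ j : Fin p, (symBorder d t A) 0 (Fin.succ (Fin.succ j)) = 0 := by
    intro j; simp [symBorder]
  have h3 : ((symBorder d t A).submatrix Fin.succ (Fin.succAbove (Fin.succ 0))).det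
      = t * (A.submatrix Fin.succ Fin.succ).det := by
    rw [Matrix.det_succ_column_zero, Fin.sum_univ_succ]
    have e0 : ∀ i : Fin (p+1), ((symBorder d t A).submatrix Fin.succ (Fin.succAbove (Fin.succ 0))) i 0
      = if i = 0 then t else 0 := by
      intro i; simp [symBorder]
    have e1 : ((symBorder d t A).submatrix Fin.succ (Fin.succAbove (Fin.succ 0))).submatrix
        (Fin.succAbove 0) Fin.succ = A.submatrix Fin.succ Fin.succ := by
      ext i j
      simp [symBorder]
    simp only [e0, e1]
    simp
  have h4 : (symBorder d t A).submatrix Fin.succ (Fin.succAbove 0) = A := by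
    ext i j; simp [symBorder]
  simp only [h0, h1, h2, h3, h4]
  simp
  ring

/-- Symmetric matrix of linear forms. -/
def IsPencil {k : Type*} [Field k] {p : ℕ} (A : Matrix (Fin p) (Fin p) (MvPolynomial (Fin 2) k)) :
    Prop :=
  A.IsSymm ∧ ∀ i j, ∃ a b : k, A i j = X 0 * C a + X 1 * C b

theorem IsPencil.border {k : Type*} [Field k] {p : ℕ}
    {A : Matrix (Fin (p+1)) (Fin (p+1)) (MvPolynomial (Fin 2) k)} (hA : IsPencil A)
    (a b a' b' : k) :
    IsPencil (symBorder (X 0 * C a + X 1 * C b) (X 0 * C a' + X 1 * C b') A) := by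
  constructor
  · ext1 i j
    refine Fin.cases ?_ (fun i => ?_) i <;> refine Fin.cases ?_ (fun j => ?_) j <;>
      simp [symBorder]
    exact hA.1.apply i j
  · intro i j
    refine Fin.cases ?_ (fun i => ?_) i <;> refine Fin.cases ?_ (fun j => ?_) j
    · exact ⟨a, b, by simp [symBorder]⟩
    · by_cases h : j = 0
      · exact ⟨a', b', by subst h; rfl⟩
      · exact ⟨0, 0, by simp [symBorder, h]⟩
    · by_cases h : i = 0
      · exact ⟨a', b', by subst h; rfl⟩
      · exact ⟨0, 0, by simp [symBorder, h]⟩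
    · simpa [symBorder] using hA.2 i j

theorem IsPencil.extract {k : Type*} [Field k] {p : ℕ}
    {A : Matrix (Fin p) (Fin p) (MvPolynomial (Fin 2) k)} (hA : IsPencil A) :
    ∃ M₀ M₁ : Matrix (Fin p) (Fin p) k, M₀.IsSymm ∧ M₁.IsSymm ∧
      ((MvPolynomial.X 0 : MvPolynomial (Fin 2) k) •
          M₀.map (MvPolynomial.C : k → MvPolynomial (Fin 2) k)
        + (MvPolynomial.X 1 : MvPolynomial (Fin 2) k) •
          M₁.map (MvPolynomial.C : k → MvPolynomial (Fin 2) k)) = A := by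
  refine ⟨A.map (coeff (Finsupp.single 0 1)), A.map (coeff (Finsupp.single 1 1)), ?_, ?_, ?_⟩
  · exact hA.1.map _
  · exact hA.1.map _
  · ext1 i j
    obtain ⟨a, b, h⟩ := hA.2 i j
    have e0 : coeff (Finsupp.single 0 1) (A i j) = a := by
      rw [h, mul_comm, mul_comm (X 1)]; simp [coeff_C_mul, coeff_X, Finsupp.single_left_inj]
    have e1 : coeff (Finsupp.single 1 1) (A i j) = b := by
      rw [h, mul_comm, mul_comm (X 1)]; simp [coeff_C_mul, coeff_X, Finsupp.single_left_inj]
    simp only [Matrix.add_apply, Matrix.smul_apply, Matrix.map_apply, e0, e1, smul_eq_mul]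
    exact h.symm

theorem homog_split {k : Type*} [Field k] (N : ℕ) (f : MvPolynomial (Fin 2) k)
    (hf : f.IsHomogeneous (N+1)) :
    ∃ (c : k) (g : MvPolynomial (Fin 2) k), g.IsHomogeneous N ∧
      f = C c * X 0 ^ (N+1) + X 1 * g := by
  rw [f.as_sum]
  refine Finset.sum_induction _ (fun f => ∃ (c : k) (g : MvPolynomial (Fin 2) k),
    g.IsHomogeneous N ∧ f = C c * X 0 ^ (N+1) + X 1 * g) ?_ ?_ ?_
  · rintro _ _ ⟨c, g, hg, rfl⟩ ⟨c', g', hg', rfl⟩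
    exact ⟨c + c', g + g', hg.add hg', by rw [C_add]; ring⟩
  · exact ⟨0, 0, isHomogeneous_zero _ _ _, by simp⟩
  · intro s hs
    have hd : s 0 + s 1 = N + 1 := by
      have := hf (mem_support_iff.mp hs)
      simpa [Finsupp.weight_apply, Finsupp.sum_fintype] using this
    rcases Nat.eq_zero_or_pos (s 1) with h | h
    · refine ⟨coeff s f, 0, isHomogeneous_zero _ _ _, ?_⟩
      have : s = Finsupp.single 0 (N+1) := by
        ext i; fin_cases i
        · simp; omega
        · simp [h]
      rw [mul_zero, add_zero, C_mul_X_pow_eq_monomial, ← this]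
    · refine ⟨0, monomial (s - Finsupp.single 1 1) (coeff s f), ?_, ?_⟩
      · apply isHomogeneous_monomial
        rw [Finsupp.degree_eq_sum]
        simp
        omega
      · rw [C_0, zero_mul, zero_add, X, monomial_mul, one_mul]
        have : s = Finsupp.single 1 1 + (s - Finsupp.single 1 1) := by
          ext i; fin_cases i
          · simp
          · simp; omega
        rw [← this]

theorem odd_case {k : Type*} [Field k] (m : ℕ) : ∀ (f : MvPolynomial (Fin 2) k),
    f.IsHomogeneous (2*m+1) →
    ∃ (A : Matrix (Fin (2*m+1)) (Fin (2*m+1)) (MvPolynomial (Fin 2) k)) (s : k),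
      IsPencil A ∧ s ^ 2 = 1 ∧ A.det = f ∧
      (A.submatrix Fin.succ Fin.succ).det = C s * X 0 ^ (2*m) := by
  induction m with
  | zero =>
    intro f hf
    obtain ⟨c, g, hg, rfl⟩ := homog_split _ f hf
    obtain ⟨b, rfl⟩ : ∃ b, g = C b :=
      ⟨_, (totalDegree_eq_zero_iff_eq_C).mp (Nat.le_zero.mp hg.totalDegree_le)⟩
    refine ⟨Matrix.of fun _ _ => X 0 * C c + X 1 * C b, 1, ⟨?_, ?_⟩, by simp, ?_, ?_⟩
    · ext1 i j; rfl
    · intro i j; exact ⟨c, b, rfl⟩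
    · simp; ring
    · simp
  | succ m ih =>
    intro f hf
    obtain ⟨a, g, hg, rfl⟩ := homog_split (2*m+2) f hf
    obtain ⟨b, h, hh, rfl⟩ := homog_split (2*m+1) g hg
    obtain ⟨A, s, hA, hs, hdet, hmin⟩ := ih (-h) hh.neg
    have hs' : (C s : MvPolynomial (Fin 2) k)^2 = 1 := by rw [← C_pow, hs, C_1]
    refine ⟨symBorder (X 0 * C (-s*a) + X 1 * C (-s*b)) (X 0 * C 0 + X 1 * C 1)
      (symBorder (X 0 * C 0 + X 1 * C 0) (X 0 * C 1 + X 1 * C 0) A), -s,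
      (hA.border _ _ _ _).border _ _ _ _, by simpa using hs, ?_, ?_⟩
    · rw [symBorder_det, symBorder_det, symBorder_succ, hdet, hmin]
      simp only [C_0, C_1, C_mul, C_neg]
      linear_combination ((C a * X 0 + C b * X 1) * X 0 ^ (2*m+2)) * hs'
    · rw [symBorder_succ, symBorder_det, hmin]
      simp only [C_0, C_1, C_neg]
      ring

theorem exists_symmetric_pair_with_det_scalar_multiple
    (k : Type*) [Field k] (n : ℕ) (hn : 1 ≤ n)
    (f : MvPolynomial (Fin 2) k) (hf0 : f ≠ 0) (hfh : f.IsHomogeneous (n + 1)) :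
    ∃ (lam : kˣ) (M₀ M₁ : Matrix (Fin (n + 1)) (Fin (n + 1)) k),
      M₀.IsSymm ∧ M₁.IsSymm ∧
      ((MvPolynomial.X 0 : MvPolynomial (Fin 2) k) •
          M₀.map (MvPolynomial.C : k → MvPolynomial (Fin 2) k)
        + (MvPolynomial.X 1 : MvPolynomial (Fin 2) k) •
          M₁.map (MvPolynomial.C : k → MvPolynomial (Fin 2) k)).det
        = MvPolynomial.C (lam : k) * f := by
  suffices H : ∃ (lam : kˣ) (A : Matrix (Fin (n + 1)) (Fin (n + 1)) (MvPolynomial (Fin 2) k)),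
      IsPencil A ∧ A.det = C (lam : k) * f by
    obtain ⟨lam, A, hA, hd⟩ := H
    obtain ⟨M₀, M₁, h0, h1, h⟩ := hA.extract
    exact ⟨lam, M₀, M₁, h0, h1, by rw [h, hd]⟩
  obtain ⟨m, rfl | rfl⟩ := n.even_or_odd'
  · obtain ⟨A, s, hA, hs, hdet, hmin⟩ := odd_case m f hfh
    exact ⟨1, A, hA, by simp [hdet]⟩
  · obtain ⟨c, g, hg, rfl⟩ := homog_split (2*m+1) f hfh
    by_cases hc : c = 0
    · obtain ⟨A, s, hA, hs, hdet, hmin⟩ := odd_case m g hg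
      refine ⟨1, _, hA.border 0 1 0 0, ?_⟩
      rw [symBorder_det, hdet, hc]
      simp
    · -- the scalar is `-1 / c`, and a sign is absorbed in the corner entry
      obtain ⟨A, s, hA, hs, hdet, hmin⟩ := odd_case m g hg
      have hs0 : s ≠ 0 := by rintro rfl; simp at hs
      have hs' : (C s : MvPolynomial (Fin 2) k)^2 = 1 := by rw [← C_pow, hs, C_1]
      have hcc : (C c⁻¹ : MvPolynomial (Fin 2) k) * C c = 1 := by
        rw [← C_mul, inv_mul_cancel₀ hc, C_1]
      refine ⟨Units.mk0 (-s * c⁻¹) (by simp [hs0, hc]), _, hA.border 0 (-s * c⁻¹) 1 0, ?_⟩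
      rw [symBorder_det, hdet, hmin]
      simp only [C_0, C_1, C_mul, C_neg, Units.val_mk0]
      linear_combination (C s * X 0 ^ (2*m+2)) * hcc
end

section
/- Let K be a field, m ≥ 1 an integer, A := K[T]/(T^m), and M a finitely generated A-module. Then there exists an A-linear bijection λ: M → Hom_A(M, A) that is symmetric, i.e. (λ(x))(y) = (λ(y))(x) for all x, y ∈ M. -/
open Polynomial

/-- The local Artinian ring `K[T]/(T^m)`. -/
abbrev TruncatedPolyRing (K : Type*) [Field K] (m : ℕ) : Type _ :=
  AdjoinRoot ((Polynomial.X : Polynomial K) ^ m)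

theorem core_aux {R A : Type*} [CommRing R] [AddCommGroup A] [Module R A] {d : ℕ}
    (I : Fin d → Ideal R) (φ : ∀ j, (R ⧸ I j) →ₗ[R] A) (hi : ∀ j, Function.Injective (φ j))
    (hs : ∀ j a, (∀ r ∈ I j, r • a = 0) → ∃ q, φ j q = a) :
    ∃ B : (∀ j, R ⧸ I j) →ₗ[R] (∀ j, R ⧸ I j) →ₗ[R] A,
      Function.Bijective B ∧ ∀ x y, B x y = B y x := by
  classical
  let B : (∀ j, R ⧸ I j) →ₗ[R] (∀ j, R ⧸ I j) →ₗ[R] A :=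
    LinearMap.mk₂ R (fun x y => ∑ j, φ j (x j * y j))
      (by intros; simp [add_mul, Finset.sum_add_distrib])
      (by intros; simp [Finset.smul_sum])
      (by intros; simp [mul_add, Finset.sum_add_distrib])
      (by intros; simp [Finset.smul_sum])
  have hB : ∀ x y, B x y = ∑ j, φ j (x j * y j) := fun x y => rfl
  have hB1 : ∀ x j q, B x (Pi.single j q) = φ j (x j * q) := by
    intro x j q
    rw [hB, Finset.sum_eq_single j]
    · simp
    · intro b _ hb
      simp [Pi.single_eq_of_ne hb]
    · simp
  refine ⟨B, ⟨?_, ?_⟩, ?_⟩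
  · rw [injective_iff_map_eq_zero]
    intro x hx
    funext j
    apply hi j
    have := hB1 x j 1
    rw [hx] at this
    simpa using this.symm
  · intro f
    have : ∀ j, ∃ q, φ j q = f (Pi.single j 1) := by
      intro j
      apply hs
      intro r hr
      rw [← map_smul, ← Pi.single_smul]
      have : r • (1 : R ⧸ I j) = 0 := by
        rw [Algebra.smul_def, mul_one]
        exact Ideal.Quotient.eq_zero_iff_mem.2 hr
      rw [this]; simp
    choose x hx using this
    refine ⟨x, ?_⟩
    apply LinearMap.pi_ext
    intro j q
    rw [hB1]
    obtain ⟨r, rfl⟩ := Ideal.Quotient.mk_surjective q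
    have h1 : (Ideal.Quotient.mk (I j) r) = r • (1 : R ⧸ I j) := by
      rw [Algebra.smul_def, mul_one]; rfl
    rw [h1, Pi.single_smul, map_smul, ← hx, mul_smul_comm, mul_one, map_smul]
  · intro x y
    simp [hB, mul_comm]

theorem phi_aux (K : Type*) [Field K] (m k : ℕ) (hk : k ≤ m) :
    ∃ φ : (K[X] ⧸ Ideal.span {(X : K[X]) ^ k}) →ₗ[K[X]] (K[X] ⧸ Ideal.span {(X : K[X]) ^ m}),
      Function.Injective φ ∧
      ∀ a, (∀ r ∈ Ideal.span {(X : K[X]) ^ k}, r • a = 0) → ∃ q, φ q = a := by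
  obtain ⟨n, rfl⟩ := Nat.exists_eq_add_of_le hk
  let φ : (K[X] ⧸ Ideal.span {(X : K[X]) ^ k}) →ₗ[K[X]]
      (K[X] ⧸ Ideal.span {(X : K[X]) ^ (k + n)}) :=
    Submodule.mapQ _ _ (LinearMap.mulRight K[X] ((X : K[X]) ^ n)) (by
      intro r hr
      rw [Ideal.mem_span_singleton] at hr
      rw [Submodule.mem_comap, LinearMap.mulRight_apply, Ideal.mem_span_singleton, pow_add]
      exact mul_dvd_mul_right hr _)
  have hφ : ∀ r : K[X], φ (Ideal.Quotient.mk _ r) = Ideal.Quotient.mk _ (r * X ^ n) :=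
    fun r => rfl
  have hX : ∀ j, (X : K[X]) ^ j ≠ 0 := fun j => pow_ne_zero _ X_ne_zero
  refine ⟨φ, ?_, ?_⟩
  · rw [injective_iff_map_eq_zero]
    intro q hq
    obtain ⟨r, rfl⟩ := Ideal.Quotient.mk_surjective q
    rw [hφ, Ideal.Quotient.eq_zero_iff_mem, Ideal.mem_span_singleton, pow_add,
      mul_dvd_mul_iff_right (hX n)] at hq
    rwa [Ideal.Quotient.eq_zero_iff_mem, Ideal.mem_span_singleton]
  · intro a ha
    obtain ⟨r, rfl⟩ := Ideal.Quotient.mk_surjective a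
    have h := ha _ (Ideal.mem_span_singleton_self _)
    have h2 : (X : K[X]) ^ k • (Ideal.Quotient.mk (Ideal.span {(X : K[X]) ^ (k + n)}) r)
      = Ideal.Quotient.mk _ (X ^ k * r) := rfl
    rw [h2, Ideal.Quotient.eq_zero_iff_mem, Ideal.mem_span_singleton, pow_add,
      mul_dvd_mul_iff_left (hX k)] at h
    obtain ⟨s, rfl⟩ := h
    exact ⟨Ideal.Quotient.mk _ s, by rw [hφ, mul_comm]⟩

theorem exists_aux (K : Type*) [Field K] (m : ℕ)
    (M : Type*) [AddCommGroup M] [Module K[X] M] [Module.Finite K[X] M]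
    (hM : ∀ x : M, (X : K[X]) ^ m • x = 0) :
    ∃ B : M →ₗ[K[X]] (M →ₗ[K[X]] (K[X] ⧸ Ideal.span {(X : K[X]) ^ m})),
      Function.Bijective B ∧ ∀ x y : M, B x y = B y x := by
  classical
  obtain ⟨d, k, ⟨e0⟩⟩ := Module.torsion_by_prime_power_decomposition (R := K[X]) (M := M)
    (p := X) irreducible_X
    ((Submodule.isTorsion'_powers_iff _).2 fun x => ⟨m, hM x⟩)
  let e : M ≃ₗ[K[X]] (∀ j, K[X] ⧸ Ideal.span {(X : K[X]) ^ k j}) :=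
    e0.trans (DirectSum.linearEquivFunOnFintype K[X] (Fin d) _)
  have hk : ∀ j, k j ≤ m := by
    intro j
    have h := hM (e.symm (Pi.single j (Ideal.Quotient.mk _ 1)))
    rw [← map_smul, e.symm.map_eq_zero_iff] at h
    have h := congrFun h j
    rw [Pi.smul_apply, Pi.single_eq_same] at h
    have h : Ideal.Quotient.mk (Ideal.span {(X : K[X]) ^ k j}) (X ^ m * 1) = 0 := h
    rw [Ideal.Quotient.eq_zero_iff_mem, Ideal.mem_span_singleton, mul_one] at h
    exact (pow_dvd_pow_iff X_ne_zero not_isUnit_X).1 h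
  choose φ hi hs using fun j => phi_aux K m (k j) (hk j)
  obtain ⟨B, hB, hsym⟩ := core_aux _ φ hi hs
  let g : ((∀ j, K[X] ⧸ Ideal.span {(X : K[X]) ^ k j}) →ₗ[K[X]]
      (K[X] ⧸ Ideal.span {(X : K[X]) ^ m})) ≃ₗ[K[X]]
      (M →ₗ[K[X]] (K[X] ⧸ Ideal.span {(X : K[X]) ^ m})) :=
    LinearEquiv.congrLeft _ K[X] e.symm
  refine ⟨g.toLinearMap ∘ₗ B ∘ₗ e.toLinearMap, ?_, ?_⟩
  · exact g.bijective.comp (hB.comp e.bijective)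
  · intro x y
    exact hsym _ _

theorem exists_symmetric_selfdual_isomorphism
    (K : Type*) [Field K] (m : ℕ) (hm : 1 ≤ m)
    (M : Type*) [AddCommGroup M] [Module (TruncatedPolyRing K m) M]
    [Module.Finite (TruncatedPolyRing K m) M] :
    ∃ lam : M →ₗ[TruncatedPolyRing K m]
        (M →ₗ[TruncatedPolyRing K m] TruncatedPolyRing K m),
      Function.Bijective lam ∧ ∀ x y : M, lam x y = lam y x := by
  let π : K[X] →+* TruncatedPolyRing K m := AdjoinRoot.mk _
  have hπ : Function.Surjective π := AdjoinRoot.mk_surjective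
  letI : Module K[X] M := Module.compHom M π
  have hsm : ∀ (r : K[X]) (x : M), r • x = π r • x := fun r x => rfl
  have hfin : Module.Finite K[X] M := by
    obtain ⟨s, hs⟩ := (inferInstance : Module.Finite (TruncatedPolyRing K m) M)
    refine ⟨s, ?_⟩
    rw [eq_top_iff]
    rintro x -
    have hx : x ∈ Submodule.span (TruncatedPolyRing K m) (s : Set M) := hs ▸ Submodule.mem_top
    induction hx using Submodule.span_induction with
    | mem x h => exact Submodule.subset_span h
    | zero => exact zero_mem _
    | add x y _ _ h1 h2 => exact add_mem h1 h2
    | smul a x _ h =>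
      obtain ⟨r, rfl⟩ := hπ a
      exact Submodule.smul_mem _ r h
  obtain ⟨B, hB, hsym⟩ := exists_aux K m M (fun x => by
    rw [hsm, show π (X ^ m) = 0 from AdjoinRoot.mk_self, zero_smul])
  have hA : ∀ (r : K[X]) (q : K[X] ⧸ Ideal.span {(X : K[X]) ^ m}),
      r • q = Ideal.Quotient.mk _ r * q := by
    intro r q
    obtain ⟨s, rfl⟩ := Ideal.Quotient.mk_surjective q
    rfl
  let ext : (M →ₗ[K[X]] (K[X] ⧸ Ideal.span {(X : K[X]) ^ m})) →
      (M →ₗ[TruncatedPolyRing K m] TruncatedPolyRing K m) := fun f =>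
    { toFun := fun x => f x
      map_add' := fun x y => f.map_add x y
      map_smul' := fun a x => by
        obtain ⟨r, rfl⟩ := hπ a
        exact (f.map_smul r x).trans (hA r _) }
  refine ⟨{ toFun := fun x => ext (B x), map_add' := ?_, map_smul' := ?_ }, ⟨?_, ?_⟩, ?_⟩
  · intro x y
    ext z
    exact LinearMap.congr_fun (B.map_add x y) z
  · intro a x
    ext z
    obtain ⟨r, rfl⟩ := hπ a
    exact (LinearMap.congr_fun (B.map_smul r x) z).trans (hA r _)
  · intro x y h
    apply hB.1
    ext z
    exact LinearMap.congr_fun h z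
  · intro f
    obtain ⟨x, hx⟩ := hB.2
      { toFun := fun x => f x
        map_add' := fun x y => f.map_add x y
        map_smul' := fun r x => by
          exact (f.map_smul (π r) x).trans (hA r (f x)).symm }
    refine ⟨x, ?_⟩
    ext z
    exact LinearMap.congr_fun hx z
  · intro x y
    exact hsym x y
end

section
/- Let K be a field of characteristic different from 2, m ≥ 1, A := K[T]/(T^m), M a finitely generated A-module, and λ: M → Hom_A(M, A) a symmetric A-linear bijection (i.e. (λ(x))(y) = (λ(y))(x) for all x, y ∈ M). Then there exist finitely many A-submodules M_0, …, M_r of M, each generated by a single element, such that: M is the internal direct sum of M_0, …, M_r; (λ(x))(y) = 0 whenever x ∈ M_i and y ∈ M_j with i ≠ j; and for each i the map M_i → Hom_A(M_i, A) sending x to the restriction of λ(x) to M_i is an A-linear bijection. -/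
open Polynomial

namespace OrthDecomp

structure UnifData {A : Type*} [CommRing A] (t : A) (m : ℕ) : Prop where
  pow_eq : t ^ m = 0
  le_of : ∀ k, t ^ k = 0 → m ≤ k
  form : ∀ a : A, a ≠ 0 → ∃ (u : Aˣ) (k : ℕ), a = u * t ^ k

variable {A : Type*} [CommRing A] {t : A} {m : ℕ}

lemma UnifData.le_of_unit (h : UnifData t m) (u : Aˣ) (k : ℕ) (hk : (u : A) * t ^ k = 0) :
    m ≤ k := h.le_of k (by simpa using hk)

lemma UnifData.zero_of (h : UnifData t m) (k : ℕ) (hk : m ≤ k) : t ^ k = 0 :=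
  pow_eq_zero_of_le hk h.pow_eq

lemma UnifData.dvd (h : UnifData t m) {e : ℕ} {a b : A} (ha : t ^ e * a ≠ 0)
    (hb : t ^ (e + 1) * b = 0) : ∃ c, b = c * a := by
  have ha0 : a ≠ 0 := by rintro rfl; simp at ha
  by_cases hb0 : b = 0
  · exact ⟨0, by simp [hb0]⟩
  obtain ⟨u, k, rfl⟩ := h.form a ha0
  obtain ⟨v, l, rfl⟩ := h.form b hb0
  have h1 : k + e < m := by
    by_contra hlt
    apply ha
    have := h.zero_of (k + e) (by omega)
    calc t ^ e * (u * t ^ k) = u * t ^ (k + e) := by ring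
      _ = 0 := by rw [this]; simp
  have h2 : m ≤ l + e + 1 := h.le_of_unit v _ (by rw [← hb]; ring)
  obtain ⟨d, rfl⟩ := Nat.exists_eq_add_of_le (show k ≤ l by omega)
  refine ⟨v * (u⁻¹ : Aˣ) * t ^ d, ?_⟩
  calc (v : A) * t ^ (k + d) = v * t ^ d * t ^ k * 1 := by ring
    _ = v * t ^ d * t ^ k * ((u⁻¹ : Aˣ) * u) := by simp
    _ = _ := by ring

lemma UnifData.dvd' (h : UnifData t m) {e : ℕ} {a c : A} (ha : t ^ e * a ≠ 0)
    (hc : c * a = 0) : ∃ d, c = d * t ^ (e + 1) := by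
  have ha0 : a ≠ 0 := by rintro rfl; simp at ha
  by_cases hc0 : c = 0
  · exact ⟨0, by simp [hc0]⟩
  obtain ⟨u, k, rfl⟩ := h.form a ha0
  obtain ⟨v, l, rfl⟩ := h.form c hc0
  have h1 : k + e < m := by
    by_contra hlt
    apply ha
    have := h.zero_of (k + e) (by omega)
    calc t ^ e * (u * t ^ k) = u * t ^ (k + e) := by ring
      _ = 0 := by rw [this]; simp
  have h2 : m ≤ l + k := h.le_of_unit (v * u) _ (by rw [← hc]; push_cast; ring)
  obtain ⟨d, rfl⟩ := Nat.exists_eq_add_of_le (show e + 1 ≤ l by omega)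
  exact ⟨v * t ^ d, by ring⟩

lemma exists_vec (h : UnifData t m) (h2 : ∀ a : A, 2 * a = 0 → a = 0)
    {M : Type*} [AddCommGroup M] [Module A M] (lam : M →ₗ[A] M →ₗ[A] A)
    (hsymm : ∀ x y, lam x y = lam y x) (P : Submodule A M)
    (hP : ∀ x ∈ P, (∀ y ∈ P, lam x y = 0) → x = 0) (hne : P ≠ ⊥) :
    ∃ x ∈ P, lam x x ≠ 0 ∧ (∀ y ∈ P, ∃ c, lam y x = c * lam x x) ∧
      ∀ c : A, c * lam x x = 0 → c • x = 0 := by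
  classical
  have hex : ∃ n, ∀ x ∈ P, t ^ n • x = 0 := ⟨m, fun x _ => by simp [h.pow_eq]⟩
  have hs := Nat.find_spec hex
  have hmin := fun k => Nat.find_min hex (m := k)
  generalize Nat.find hex = n at hs hmin
  obtain _ | e := n
  · exact absurd ((Submodule.eq_bot_iff P).2 fun x hx => by simpa using hs x hx) hne
  have hmin := hmin e (by omega)
  have : ∃ x ∈ P, t ^ e * lam x x ≠ 0 := by
    by_contra! hcon
    apply hmin
    intro x hx
    apply hP _ (P.smul_mem _ hx)
    intro y hy
    apply h2
    have hxy := hcon _ (P.add_mem hx hy)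
    simp only [map_add, LinearMap.add_apply, mul_add, hcon x hx, hcon y hy, hsymm y x] at hxy
    simp only [map_smul, LinearMap.smul_apply, smul_eq_mul]
    linear_combination hxy
  obtain ⟨x, hx, hxx⟩ := this
  refine ⟨x, hx, fun h0 => hxx (by simp [h0]), fun y hy => h.dvd hxx ?_, fun c hc => ?_⟩
  · have : lam (t ^ (e + 1) • y) x = 0 := by rw [hs y hy]; simp
    simpa using this
  · obtain ⟨d, rfl⟩ := h.dvd' hxx hc
    rw [mul_smul, hs x hx, smul_zero]

lemma exists_finset (h : UnifData t m) (h2 : ∀ a : A, 2 * a = 0 → a = 0)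
    {M : Type*} [AddCommGroup M] [Module A M] [IsArtinian A M] (lam : M →ₗ[A] M →ₗ[A] A)
    (hsymm : ∀ x y, lam x y = lam y x) (P : Submodule A M) :
    (∀ x ∈ P, (∀ y ∈ P, lam x y = 0) → x = 0) →
    ∃ s : Finset M, Submodule.span A (s : Set M) = P ∧
      (∀ x ∈ s, ∀ y ∈ s, x ≠ y → lam x y = 0) ∧
      ∀ x ∈ s, ∀ c : A, c * lam x x = 0 → c • x = 0 := by
  classical
  induction P using WellFoundedLT.induction with
  | ind P ih =>
  intro hP
  by_cases hne : P = ⊥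
  · exact ⟨∅, by simp [hne]⟩
  obtain ⟨x, hx, hxx, hd, hc⟩ := exists_vec h h2 lam hsymm P hP hne
  have key : ∀ y ∈ P, ∃ c : A, y - c • x ∈ P ⊓ LinearMap.ker (lam x) := by
    intro y hy
    obtain ⟨c, hc⟩ := hd y hy
    refine ⟨c, P.sub_mem hy (P.smul_mem _ hx), ?_⟩
    simp [hsymm x y, hc]
  obtain ⟨s, hs, ho, hcs⟩ := ih (P ⊓ LinearMap.ker (lam x))
    (lt_of_le_of_ne inf_le_left fun he => hxx (by
      have : x ∈ P ⊓ LinearMap.ker (lam x) := by rw [he]; exact hx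
      exact this.2)) (by
      intro z hz hz0
      apply hP z hz.1
      intro y hy
      obtain ⟨c, hc⟩ := key y hy
      have h1 := hz0 _ hc
      have h3 : lam z x = 0 := by rw [hsymm]; exact hz.2
      simpa [h3] using h1)
  have hso : ∀ y ∈ s, lam x y = 0 := fun y hy => by
    have : y ∈ P ⊓ LinearMap.ker (lam x) := hs ▸ Submodule.subset_span hy
    exact this.2
  refine ⟨insert x s, ?_, ?_, ?_⟩
  · rw [Finset.coe_insert, Submodule.span_insert, hs]
    apply le_antisymm
    · exact sup_le ((Submodule.span_singleton_le_iff_mem _ _).2 hx) inf_le_left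
    · intro y hy
      obtain ⟨c, hc⟩ := key y hy
      exact Submodule.mem_sup.2 ⟨c • x, Submodule.mem_span_singleton.2 ⟨c, rfl⟩, _, hc, by abel⟩
  · intro y hy z hz hyz
    rw [Finset.mem_insert] at hy hz
    obtain rfl | hy := hy
    · obtain rfl | hz := hz
      · exact absurd rfl hyz
      · exact hso z hz
    · obtain rfl | hz := hz
      · rw [hsymm]; exact hso y hy
      · exact ho y hy z hz hyz
  · intro y hy
    rw [Finset.mem_insert] at hy
    obtain rfl | hy := hy
    · exact hc
    · exact hcs y hy

lemma main (h : UnifData t m) (h2 : ∀ a : A, 2 * a = 0 → a = 0)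
    {M : Type*} [AddCommGroup M] [Module A M] [IsArtinian A M] (lam : M →ₗ[A] M →ₗ[A] A)
    (hbij : Function.Bijective lam)
    (hsymm : ∀ x y, lam x y = lam y x) :
    ∃ (r : ℕ) (Mi : Fin (r + 1) → Submodule A M),
      (∀ i, ∃ x : M, Mi i = Submodule.span A {x}) ∧
      DirectSum.IsInternal Mi ∧
      (∀ i j, i ≠ j → ∀ x ∈ Mi i, ∀ y ∈ Mi j, lam x y = 0) ∧
      (∀ i, Function.Bijective
        (fun x : Mi i => (lam (x : M)).domRestrict (Mi i))) := by
  classical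
  obtain ⟨s, hs, ho, hc⟩ := exists_finset h h2 lam hsymm ⊤ (fun x _ hx =>
    hbij.1 (by ext y; simpa using hx y trivial))
  obtain ⟨r, v, hv, ho, hc⟩ : ∃ (r : ℕ) (v : Fin (r + 1) → M),
      Submodule.span A (Set.range v) = ⊤ ∧ (∀ i j, i ≠ j → lam (v i) (v j) = 0) ∧
      ∀ i, ∀ c : A, c * lam (v i) (v i) = 0 → c • v i = 0 := by
    let e := s.equivFin.symm
    refine ⟨s.card, Fin.cons 0 (fun i => (e i : M)), ?_, ?_, ?_⟩
    · rw [Fin.range_cons, Submodule.span_insert_zero, ← hs]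
      congr 1
      ext x
      constructor
      · rintro ⟨i, rfl⟩; exact (e i).2
      · intro hx; exact ⟨e.symm ⟨x, hx⟩, by simp⟩
    · intro i j hij
      induction i using Fin.cases with
      | zero => simp
      | succ i =>
        induction j using Fin.cases with
        | zero => simp
        | succ j =>
          simp only [Fin.cons_succ]
          apply ho _ (e i).2 _ (e j).2
          intro h
          exact hij (by rw [e.injective (Subtype.ext h)])
    · intro i c
      induction i using Fin.cases with
      | zero => simp
      | succ i => exact hc _ (e i).2 c
  have horth : ∀ i j, i ≠ j → ∀ x ∈ Submodule.span A {v i}, ∀ y ∈ Submodule.span A {v j},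
      lam x y = 0 := by
    intro i j hij x hx y hy
    obtain ⟨a, rfl⟩ := Submodule.mem_span_singleton.1 hx
    obtain ⟨b, rfl⟩ := Submodule.mem_span_singleton.1 hy
    simp [ho i j hij]
  have htop : ⨆ i, Submodule.span A {v i} = ⊤ := by
    rw [← hv, Submodule.span_range_eq_iSup]
  have hsupo : ∀ i, ∀ x ∈ Submodule.span A {v i}, ∀ y ∈ ⨆ j, ⨆ (_ : j ≠ i), Submodule.span A {v j},
      lam x y = 0 := by
    intro i x hx y hy
    have : (⨆ j, ⨆ (_ : j ≠ i), Submodule.span A {v j}) ≤ LinearMap.ker (lam x) :=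
      iSup_le fun j => iSup_le fun hj z hz => horth i j hj.symm x hx z hz
    exact this hy
  have hself : ∀ i, ∀ x ∈ Submodule.span A {v i}, lam x (v i) = 0 → x = 0 := by
    intro i x hx h0
    obtain ⟨a, rfl⟩ := Submodule.mem_span_singleton.1 hx
    exact hc i a (by simpa using h0)
  have hmem : ∀ i, v i ∈ Submodule.span A {v i} := fun i => Submodule.mem_span_singleton_self _
  have hind : iSupIndep fun i => Submodule.span A {v i} := by
    intro i
    rw [Submodule.disjoint_def]
    intro x hx hx'
    apply hself i x hx
    rw [hsymm]
    exact hsupo i _ (hmem i) x hx'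
  refine ⟨r, fun i => Submodule.span A {v i}, fun i => ⟨_, rfl⟩,
    DirectSum.isInternal_submodule_of_iSupIndep_of_iSup_eq_top hind htop, horth, fun i => ⟨?_, ?_⟩⟩
  · intro x y hxy
    have h1 := LinearMap.congr_fun hxy ⟨v i, hmem i⟩
    simp only [LinearMap.domRestrict_apply] at h1
    have := hself i (x - y : M) (Submodule.sub_mem _ x.2 y.2) (by simp [h1])
    exact Subtype.ext (sub_eq_zero.1 this)
  · intro f
    have hcompl : IsCompl (Submodule.span A {v i}) (⨆ j, ⨆ (_ : j ≠ i), Submodule.span A {v j}) := by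
      refine ⟨hind i, codisjoint_iff.2 ?_⟩
      rw [eq_top_iff, ← htop]
      refine iSup_le fun j => ?_
      by_cases hj : j = i
      · subst hj; exact le_sup_left
      · exact le_sup_of_le_right (le_iSup₂_of_le j hj le_rfl)
    obtain ⟨z, hz⟩ := hbij.2 (f ∘ₗ Submodule.projectionOnto _ _ hcompl)
    have hzt : z ∈ (Submodule.span A {v i}) ⊔ (⨆ j, ⨆ (_ : j ≠ i), Submodule.span A {v j}) := by
      rw [hcompl.sup_eq_top]; trivial
    obtain ⟨z1, h1, z2, h2, rfl⟩ := Submodule.mem_sup.1 hzt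
    refine ⟨⟨z1, h1⟩, ?_⟩
    ext y
    have := LinearMap.congr_fun hz y
    rw [map_add, LinearMap.add_apply, hsymm z2, hsupo i _ y.2 z2 h2, add_zero, LinearMap.comp_apply,
      Submodule.projectionOnto_apply_left] at this
    exact this

lemma unifData (K : Type*) [Field K] (m : ℕ) :
    UnifData (AdjoinRoot.root ((X : K[X]) ^ m)) m where
  pow_eq := by
    rw [← AdjoinRoot.mk_X, ← map_pow, AdjoinRoot.mk_self]
  le_of k hk := by
    rw [← AdjoinRoot.mk_X, ← map_pow, AdjoinRoot.mk_eq_zero] at hk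
    exact (pow_dvd_pow_iff X_ne_zero Polynomial.not_isUnit_X).1 hk
  form a ha := by
    obtain ⟨p, rfl⟩ := AdjoinRoot.mk_surjective a
    have hp : p ≠ 0 := by rintro rfl; simp at ha
    obtain ⟨q, hq, hnd⟩ := (FiniteMultiplicity.of_not_isUnit
      (Polynomial.not_isUnit_X (R := K)) hp).exists_eq_pow_mul_and_not_dvd
    have hcop : IsCoprime (X ^ m) q :=
      ((Polynomial.irreducible_X.coprime_iff_not_dvd).2 hnd).pow_left
    obtain ⟨a, b, hab⟩ := hcop
    have hu : AdjoinRoot.mk ((X : K[X]) ^ m) q * AdjoinRoot.mk ((X : K[X]) ^ m) b = 1 := by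
      have := congrArg (AdjoinRoot.mk ((X : K[X]) ^ m)) hab
      rw [map_add, map_mul, map_mul, AdjoinRoot.mk_self, mul_zero, zero_add, map_one] at this
      rw [mul_comm]; exact this
    refine ⟨Units.mkOfMulEqOne _ _ hu, multiplicity X p, ?_⟩
    rw [Units.val_mkOfMulEqOne]
    conv_lhs => rw [hq]
    rw [map_mul, map_pow, AdjoinRoot.mk_X, mul_comm]

end OrthDecomp

theorem orthogonal_decomposition_into_cyclic_submodules
    (K : Type*) [Field K] (hchar : ringChar K ≠ 2) (m : ℕ) (hm : 1 ≤ m)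
    (M : Type*) [AddCommGroup M] [Module (TruncatedPolyRing K m) M]
    [Module.Finite (TruncatedPolyRing K m) M]
    (lam : M →ₗ[TruncatedPolyRing K m]
      (M →ₗ[TruncatedPolyRing K m] TruncatedPolyRing K m))
    (hbij : Function.Bijective lam)
    (hsymm : ∀ x y : M, lam x y = lam y x) :
    ∃ (r : ℕ) (Mi : Fin (r + 1) → Submodule (TruncatedPolyRing K m) M),
      (∀ i, ∃ x : M, Mi i = Submodule.span (TruncatedPolyRing K m) {x}) ∧
      DirectSum.IsInternal Mi ∧
      (∀ i j, i ≠ j → ∀ x ∈ Mi i, ∀ y ∈ Mi j, lam x y = 0) ∧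
      (∀ i, Function.Bijective
        (fun x : Mi i => (lam (x : M)).domRestrict (Mi i))) := by
  have h2 : (2 : K) ≠ 0 := Ring.two_ne_zero hchar
  have hfin : Module.Finite K (TruncatedPolyRing K m) :=
    (Polynomial.monic_X_pow m).finite_adjoinRoot
  have hart : IsArtinianRing (TruncatedPolyRing K m) := IsArtinianRing.of_finite K _
  refine OrthDecomp.main (OrthDecomp.unifData K m) ?_ lam hbij hsymm
  intro a ha
  have h3 : algebraMap K (TruncatedPolyRing K m) 2⁻¹ * 2 = 1 := by
    rw [← map_ofNat (algebraMap K (TruncatedPolyRing K m)) 2, ← map_mul, inv_mul_cancel₀ h2, map_one]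
  calc a = algebraMap K (TruncatedPolyRing K m) 2⁻¹ * 2 * a := by rw [h3, one_mul]
    _ = 0 := by rw [mul_assoc, ha, mul_zero]
end

section
/- Let K be an algebraically closed field of characteristic different from 2, m ≥ 1, A := K[T]/(T^m), and M a finitely generated A-module. If λ, λ': M → Hom_A(M, A) are both symmetric A-linear bijections (i.e. (λ(x))(y) = (λ(y))(x) and (λ'(x))(y) = (λ'(y))(x) for all x, y ∈ M), then there exists an A-linear automorphism ρ: M → M such that (λ(x))(y) = (λ'(ρ(x)))(ρ(y)) for all x, y ∈ M. -/
open Polynomial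

theorem sqrtX_mod {K : Type*} [Field K] [IsAlgClosed K] (h2 : (2 : K) ≠ 0)
    (p : K[X]) (hp : p ≠ 0) (h0 : p.eval 0 ≠ 0) : ∃ q : K[X], p ∣ q ^ 2 - X := by
  classical
  choose s hs using fun a : K => IsAlgClosed.exists_pow_nat_eq a (n := 2) (by norm_num)
  obtain ⟨q, hq⟩ : ∃ q : K[X], ∀ a ∈ p.roots.toFinset, q.eval a = s a :=
    ⟨Lagrange.interpolate p.roots.toFinset id s, fun a ha =>
      Lagrange.eval_interpolate_at_node (v := id) s (Function.injective_id.injOn) ha⟩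
  have hdvd : p ∣ (q ^ 2 - X) ^ (Multiset.card p.roots) := by
    have hsp := (IsAlgClosed.splits p).eq_prod_roots
    have key : ∀ t : Multiset K, (∀ a ∈ t, a ∈ p.roots) →
        (t.map (fun a => X - C a)).prod ∣ (q ^ 2 - X) ^ (Multiset.card t) := by
      intro t
      induction t using Multiset.induction_on with
      | empty => simp
      | cons a t ih =>
        intro h
        rw [Multiset.map_cons, Multiset.prod_cons, Multiset.card_cons, pow_succ']
        refine mul_dvd_mul ?_ (ih fun b hb => h b (Multiset.mem_cons_of_mem hb))
        rw [dvd_iff_isRoot]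
        have := hq a (by simpa using h a (Multiset.mem_cons_self a t))
        simp [this, hs]
    have hu : IsUnit (C p.leadingCoeff) := isUnit_C.2 (by simpa using hp)
    have := key p.roots (fun _ h => h)
    conv_lhs => rw [hsp]
    exact (hu.mul_left_dvd).2 this
  let x : AdjoinRoot p := AdjoinRoot.root p
  have hX : IsUnit x := by
    have hc : IsCoprime X p := by
      rw [(irreducible_X).coprime_iff_not_dvd, X_dvd_iff, coeff_zero_eq_eval_zero]
      exact h0
    obtain ⟨a, b, hab⟩ := hc
    have := congrArg (AdjoinRoot.mk p) hab
    simp at this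
    exact IsUnit.of_mul_eq_one_right _ this
  have hnil : IsNilpotent ((AdjoinRoot.mk p q) ^ 2 - x) :=
    ⟨Multiset.card p.roots, by
      have := AdjoinRoot.mk_eq_zero.2 hdvd
      simpa using this⟩
  have hqu : IsUnit (AdjoinRoot.mk p q) := by
    have : IsUnit ((AdjoinRoot.mk p q) ^ 2) := by
      have := hnil.isUnit_add_left_of_commute hX (Commute.all _ _)
      simpa using this
    exact (isUnit_pow_iff (by norm_num)).1 this
  have h2u : IsUnit (2 : AdjoinRoot p) := by
    have := (IsUnit.mk0 _ h2).map (algebraMap K (AdjoinRoot p))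
    rwa [map_ofNat] at this
  obtain ⟨r, ⟨-, hr⟩, -⟩ := Polynomial.existsUnique_nilpotent_sub_and_aeval_eq_zero
    (P := (X ^ 2 - C x : (AdjoinRoot p)[X])) (x := AdjoinRoot.mk p q)
    (by simpa using hnil) (by simpa [one_add_one_eq_two] using h2u.mul hqu)
  obtain ⟨q', rfl⟩ := AdjoinRoot.mk_surjective r
  refine ⟨q', AdjoinRoot.mk_eq_zero.1 ?_⟩
  simpa using hr

theorem exists_sqrt {K E : Type*} [Field K] [IsAlgClosed K] (h2 : (2 : K) ≠ 0)
    [Ring E] [Algebra K E] (g : E) (hg : IsUnit g) (hi : IsIntegral K g) :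
    ∃ q : K[X], (aeval g q) ^ 2 = g := by
  obtain ⟨f, hf, hfg⟩ := hi
  obtain ⟨p, hp, hnd⟩ := exists_eq_pow_rootMultiplicity_mul_and_not_dvd f hf.ne_zero 0
  have hpg : aeval g p = 0 := by
    have h : aeval g f = 0 := hfg
    rw [hp] at h
    simp only [map_zero, sub_zero, map_mul, map_pow, aeval_X] at h
    exact ((hg.pow _).mul_right_eq_zero).1 h
  have h0 : p.eval 0 ≠ 0 := by
    rwa [dvd_iff_isRoot] at hnd
  obtain ⟨q, c, hc⟩ := sqrtX_mod h2 p (by rintro rfl; simp at h0) h0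
  refine ⟨q, ?_⟩
  have := congrArg (aeval g) hc
  simpa [hpg, sub_eq_zero] using this

theorem symmetric_selfdual_isomorphisms_are_congruent
    (K : Type*) [Field K] [IsAlgClosed K] (hchar : ringChar K ≠ 2)
    (m : ℕ) (hm : 1 ≤ m)
    (M : Type*) [AddCommGroup M] [Module (TruncatedPolyRing K m) M]
    [Module.Finite (TruncatedPolyRing K m) M]
    (lam lam' : M →ₗ[TruncatedPolyRing K m]
      (M →ₗ[TruncatedPolyRing K m] TruncatedPolyRing K m))
    (hbij : Function.Bijective lam) (hbij' : Function.Bijective lam')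
    (hsymm : ∀ x y : M, lam x y = lam y x)
    (hsymm' : ∀ x y : M, lam' x y = lam' y x) :
    ∃ ρ : M ≃ₗ[TruncatedPolyRing K m] M,
      ∀ x y : M, lam x y = lam' (ρ x) (ρ y) := by
  have h2 : (2 : K) ≠ 0 := Ring.two_ne_zero hchar
  let _ : Module K M := Module.compHom M (algebraMap K (TruncatedPolyRing K m))
  have : IsScalarTower K (TruncatedPolyRing K m) M :=
    IsScalarTower.of_algebraMap_smul fun _ _ => rfl
  have : Module.Finite K (TruncatedPolyRing K m) := (monic_X_pow m).finite_adjoinRoot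
  have : Module.Finite K M := Module.Finite.trans (TruncatedPolyRing K m) M
  let e := (LinearEquiv.ofBijective lam hbij).trans (LinearEquiv.ofBijective lam' hbij').symm
  let g : Module.End (TruncatedPolyRing K m) M := e.toLinearMap
  have hg : ∀ x, lam' (g x) = lam x := fun x =>
    (LinearEquiv.ofBijective lam' hbij').apply_symm_apply (lam x)
  have hgu : IsUnit g := (Module.End.isUnit_iff g).2 e.bijective
  have : Module.Finite K (Module.End (TruncatedPolyRing K m) M) :=
    Module.Finite.of_injective (LinearMap.restrictScalarsₗ K (TruncatedPolyRing K m) M M K)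
      (LinearMap.restrictScalars_injective K)
  obtain ⟨q, hq⟩ := exists_sqrt h2 g hgu (IsIntegral.of_finite K g)
  have hadj : ∀ x y, lam' (g x) y = lam' x (g y) := fun x y => by
    rw [hg, hsymm, ← hg, hsymm']
  have hadjq : ∀ q : K[X], ∀ x y, lam' (aeval g q x) y = lam' x (aeval g q y) := by
    intro q
    induction q using Polynomial.induction_on' with
    | add a b ha hb => intro x y; simp [ha, hb]
    | monomial n a =>
      have hpow : ∀ n x y, lam' ((g ^ n) x) y = lam' x ((g ^ n) y) := by
        intro n
        induction n with
        | zero => simp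
        | succ n ih =>
          intro x y
          rw [pow_succ, Module.End.mul_apply, ih, hadj, ← Module.End.mul_apply, ← pow_succ',
            pow_succ, Module.End.mul_apply]
      intro x y
      have hs : ∀ z : M, aeval g (monomial n a) z
          = algebraMap K (TruncatedPolyRing K m) a • (g ^ n) z := by
        intro z
        rw [aeval_monomial]
        rfl
      rw [hs, hs, map_smul, map_smul, LinearMap.smul_apply, hpow]
  have hu : IsUnit (aeval g q) := (isUnit_pow_iff (n := 2) (by norm_num)).1 (by rw [hq]; exact hgu)
  refine ⟨LinearEquiv.ofBijective (aeval g q) ((Module.End.isUnit_iff _).1 hu), fun x y => ?_⟩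
  rw [LinearEquiv.ofBijective_apply, LinearEquiv.ofBijective_apply, ← hadjq,
    ← Module.End.mul_apply, ← pow_two, hq, hg]
end

section
/- Let k be an algebraically closed field of characteristic different from 2 and n ≥ 1. Let A, B be symmetric (n+1)×(n+1) matrices over k that are linearly independent over k and satisfy det(X_0 A + X_1 B) ≠ 0 as a polynomial in k[X_0,X_1]. Then there exist an integer r ≥ 0, pairwise non-proportional pairs (u_0,v_0), …, (u_r,v_r) ∈ k² ∖ {(0,0)}, integers h_i ≥ 1 and e_{i,0} ≥ e_{i,1} ≥ ⋯ ≥ e_{i,h_i−1} ≥ 1 (for 0 ≤ i ≤ r) with Σ_{i=0}^{r} Σ_{j=0}^{h_i−1} e_{i,j} = n+1, a matrix P ∈ GL_{n+1}(k), and an invertible 2×2 matrix Q = (q_{ab}) ∈ GL_2(k), such that q_{00}·PᵀAP + q_{10}·PᵀBP = M_0 and q_{01}·PᵀAP + q_{11}·PᵀBP = M_1, where M_0 is the block diagonal matrix with blocks v_i·Δ_{e_{i,j}} + Λ_{e_{i,j}} and M_1 is the block diagonal matrix with blocks (−u_i)·Δ_{e_{i,j}} (blocks indexed by 0 ≤ i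 ≤ r, 0 ≤ j ≤ h_i−1, in the same order). -/
open Matrix MvPolynomial


/-- The `e × e` symmetric matrix `Δ_e` with `1`'s on the antidiagonal `a + b = e - 1`. -/
def DeltaM (k : Type*) [Zero k] [One k] (e : ℕ) : Matrix (Fin e) (Fin e) k :=
  Matrix.of fun a b => if (a : ℕ) + (b : ℕ) = e - 1 then 1 else 0

/-- The `e × e` symmetric matrix `Λ_e` with `1`'s on the antidiagonal `a + b = e`. -/
def LambdaM (k : Type*) [Zero k] [One k] (e : ℕ) : Matrix (Fin e) (Fin e) k :=
  Matrix.of fun a b => if (a : ℕ) + (b : ℕ) = e then 1 else 0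

/-- The block diagonal matrix with blocks `v_i • Δ_{e_{i,j}} + Λ_{e_{i,j}}`. -/
def SegreBlock0 (k : Type*) [Field k] (r : ℕ) (v : Fin (r + 1) → k)
    (h : Fin (r + 1) → ℕ) (e : (i : Fin (r + 1)) → Fin (h i) → ℕ) :
    Matrix (Σ p : (Σ i : Fin (r + 1), Fin (h i)), Fin (e p.1 p.2))
           (Σ p : (Σ i : Fin (r + 1), Fin (h i)), Fin (e p.1 p.2)) k :=
  Matrix.blockDiagonal' fun p => v p.1 • DeltaM k (e p.1 p.2) + LambdaM k (e p.1 p.2)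

/-- The block diagonal matrix with blocks `(-u_i) • Δ_{e_{i,j}}`. -/
def SegreBlock1 (k : Type*) [Field k] (r : ℕ) (u : Fin (r + 1) → k)
    (h : Fin (r + 1) → ℕ) (e : (i : Fin (r + 1)) → Fin (h i) → ℕ) :
    Matrix (Σ p : (Σ i : Fin (r + 1), Fin (h i)), Fin (e p.1 p.2))
           (Σ p : (Σ i : Fin (r + 1), Fin (h i)), Fin (e p.1 p.2)) k :=
  Matrix.blockDiagonal' fun p => (-u p.1) • DeltaM k (e p.1 p.2)


universe u
section
variable {k : Type*} [Field k]

theorem seg_adj_aeval {V : Type*} [AddCommGroup V] [Module k V]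
    (b : V →ₗ[k] V →ₗ[k] k) (T : Module.End k V)
    (hT : ∀ x y, b (T x) y = b x (T y)) (p : Polynomial k) (x y : V) :
    b (Polynomial.aeval T p x) y = b x (Polynomial.aeval T p y) := by
  induction p using Polynomial.induction_on' generalizing x y with
  | add p q hp hq => simp [hp, hq]
  | monomial n a =>
    have h : ∀ n : ℕ, ∀ x y, b ((T ^ n) x) y = b x ((T ^ n) y) := by
      intro n
      induction n with
      | zero => simp
      | succ n ih =>
        intro x y
        rw [pow_succ, Module.End.mul_apply, ih, hT, ← Module.End.mul_apply, ← pow_succ',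
          ← pow_succ]
    simp [Polynomial.aeval_monomial, h]

theorem seg_adj_pow {V : Type*} [AddCommGroup V] [Module k V]
    (b : V →ₗ[k] V →ₗ[k] k) (N : Module.End k V)
    (hN : ∀ x y, b (N x) y = b x (N y)) (n : ℕ) (x y : V) :
    b ((N ^ n) x) y = b x ((N ^ n) y) := by
  have := seg_adj_aeval b N hN (Polynomial.X ^ n) x y
  simpa using this

theorem seg_adj_sub {V : Type*} [AddCommGroup V] [Module k V]
    (b : V →ₗ[k] V →ₗ[k] k) (T : Module.End k V)
    (hT : ∀ x y, b (T x) y = b x (T y)) (c : k) (x y : V) :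
    b ((T - algebraMap k (Module.End k V) c) x) y
      = b x ((T - algebraMap k (Module.End k V) c) y) := by
  simp [hT, Module.algebraMap_end_apply]

/-- normalize the generator -/
theorem seg_normalize [IsAlgClosed k] (h2 : (2 : k) ≠ 0) {V : Type*} [AddCommGroup V] [Module k V]
    (b : V →ₗ[k] V →ₗ[k] k) (N : Module.End k V)
    (hN : ∀ x y, b (N x) y = b x (N y)) (f : ℕ) (x : V) (hx : (N ^ (f + 1)) x = 0)
    (hb : b ((N ^ f) x) x ≠ 0) (i : ℕ) :
    ∃ x : V, (N ^ (f + 1)) x = 0 ∧ b ((N ^ f) x) x = 1 ∧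
      ∀ j, j < f → f ≤ j + i → b ((N ^ j) x) x = 0 := by
  induction i with
  | zero =>
    obtain ⟨c, hc⟩ := IsAlgClosed.exists_pow_nat_eq (b ((N ^ f) x) x)⁻¹ (n := 2) (by norm_num)
    refine ⟨c • x, by simp [hx], ?_, fun j h1 h2 => by omega⟩
    simp only [map_smul, LinearMap.smul_apply, smul_eq_mul]
    rw [← mul_assoc, ← sq, hc, inv_mul_cancel₀ hb]
  | succ i ih =>
    obtain ⟨x, hx, h1, h0⟩ := ih
    have hz : ∀ j, f < j → (N ^ j) x = 0 := by
      intro j hj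
      obtain ⟨d, rfl⟩ := Nat.exists_eq_add_of_lt hj
      rw [show f + d + 1 = d + (f + 1) by ring, pow_add, Module.End.mul_apply, hx, map_zero]
    by_cases hfi : f < i + 1
    · exact ⟨x, hx, h1, fun j hj _ => h0 j hj (by omega)⟩
    set c : k := - (b ((N ^ (f - (i + 1))) x) x) / 2 with hc
    have key : ∀ j, b ((N ^ j) (x + c • (N ^ (i + 1)) x)) (x + c • (N ^ (i + 1)) x)
        = b ((N ^ j) x) x + 2 * c * b ((N ^ (j + (i + 1))) x) x
          + c ^ 2 * b ((N ^ (j + 2 * (i + 1))) x) x := by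
      intro j
      have e1 : b ((N ^ j) x) ((N ^ (i + 1)) x) = b ((N ^ (j + (i + 1))) x) x := by
        rw [← seg_adj_pow b N hN, ← Module.End.mul_apply, ← pow_add, add_comm]
      have e2 : b ((N ^ j) ((N ^ (i + 1)) x)) x = b ((N ^ (j + (i + 1))) x) x := by
        rw [← Module.End.mul_apply, ← pow_add]
      have e3 : b ((N ^ j) ((N ^ (i + 1)) x)) ((N ^ (i + 1)) x)
          = b ((N ^ (j + 2 * (i + 1))) x) x := by
        rw [← seg_adj_pow b N hN, ← Module.End.mul_apply, ← Module.End.mul_apply, ← pow_add,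
          ← pow_add]
        rw [show i + 1 + j + (i + 1) = j + 2 * (i + 1) by ring]
      simp only [map_add, map_smul, LinearMap.add_apply, LinearMap.smul_apply, smul_eq_mul, e1,
        e2, e3]
      ring
    refine ⟨x + c • (N ^ (i + 1)) x, ?_, ?_, ?_⟩
    · rw [map_add, map_smul, ← Module.End.mul_apply, ← pow_add, hx, hz _ (by omega)]; simp
    · rw [key, h1, hz _ (by omega), hz _ (by omega)]; simp
    · intro j hj hji
      rw [key, hz (j + 2 * (i + 1)) (by omega)]
      by_cases hj' : f ≤ j + i
      · rw [h0 j hj hj', hz _ (by omega)]; simp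
      · have : j = f - (i + 1) := by omega
        rw [show j + (i + 1) = f by omega, h1, this, hc]
        field_simp
        simp

theorem seg_exists_gen [IsAlgClosed k] (h2 : (2 : k) ≠ 0) {V : Type*} [AddCommGroup V] [Module k V]
    [FiniteDimensional k V] [Nontrivial V]
    (b : V →ₗ[k] V →ₗ[k] k) (hs : ∀ x y, b x y = b y x)
    (hnd : ∀ x, (∀ y, b x y = 0) → x = 0) (T : Module.End k V)
    (hT : ∀ x y, b (T x) y = b x (T y)) :
    ∃ (c : k) (f : ℕ) (x : V),
      ((T - algebraMap k (Module.End k V) c) ^ (f + 1)) x = 0 ∧ ∀ j,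
      b (((T - algebraMap k (Module.End k V) c) ^ j) x) x = if j = f then 1 else 0 := by
  obtain ⟨c, hc⟩ := Module.End.exists_eigenvalue T
  have hroot := Module.End.isRoot_of_hasEigenvalue hc
  have hint : IsIntegral k T := Algebra.IsIntegral.isIntegral T
  have hne := minpoly.ne_zero hint
  obtain ⟨q, hq, hqd⟩ := Polynomial.exists_eq_pow_rootMultiplicity_mul_and_not_dvd
    (minpoly k T) hne c
  have hpos := (Polynomial.rootMultiplicity_pos hne).2 hroot
  obtain ⟨f, hf⟩ : ∃ f, Polynomial.rootMultiplicity c (minpoly k T) = f + 1 :=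
    ⟨_, (Nat.succ_pred_eq_of_pos hpos).symm⟩
  rw [hf] at hq
  rw [Polynomial.dvd_iff_isRoot] at hqd
  set N := T - algebraMap k (Module.End k V) c with hNdef
  have hN : ∀ x y, b (N x) y = b x (N y) := seg_adj_sub b T hT c
  have hNa : Polynomial.aeval T (Polynomial.X - Polynomial.C c) = N := by simp [hNdef]
  -- the operator
  set g : Polynomial k := (Polynomial.X - Polynomial.C c) ^ f * q with hg
  have hgm : minpoly k T = (Polynomial.X - Polynomial.C c) * g := by
    rw [hq, hg]; ring
  have hg0 : g ≠ 0 := by rintro h; rw [h, mul_zero] at hgm; exact hne hgm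
  have hgT : Polynomial.aeval T g ≠ 0 := by
    intro h
    have h1 := Polynomial.degree_le_of_dvd (minpoly.dvd k T h) hg0
    rw [hgm, Polynomial.degree_mul, Polynomial.degree_X_sub_C,
      Polynomial.degree_eq_natDegree hg0] at h1
    norm_cast at h1
    omega
  have hNg : N * Polynomial.aeval T g = 0 := by
    rw [← hNa, ← map_mul, ← hgm, minpoly.aeval]
  have hgN : Polynomial.aeval T g * N = 0 := by
    rw [← hNa, ← map_mul, mul_comm, ← hgm, minpoly.aeval]
  obtain ⟨z, hz⟩ : ∃ z, b (Polynomial.aeval T g z) z ≠ 0 := by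
    by_contra! hcon
    apply hgT
    ext x
    apply hnd
    intro y
    have h1 := hcon (x + y)
    simp only [map_add, LinearMap.add_apply, hcon, zero_add, add_zero] at h1
    rw [seg_adj_aeval b T hT g y x, hs y] at h1
    have : 2 * b (Polynomial.aeval T g x) y = 0 := by linear_combination h1
    simpa [h2] using this
  have hgf : Polynomial.aeval T g = N ^ f * Polynomial.aeval T q := by
    rw [hg, map_mul, map_pow, hNa]
  obtain ⟨x, hx, h1, h0⟩ := seg_normalize h2 b N hN f (Polynomial.aeval T q z) (by
      rw [pow_succ', ← Module.End.mul_apply, mul_assoc, ← hgf, hNg]; rfl) (by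
      rw [← Module.End.mul_apply, ← hgf, ← seg_adj_aeval b T hT, ← Module.End.mul_apply,
        ← map_mul]
      obtain ⟨s, hs'⟩ := Polynomial.X_sub_C_dvd_sub_C_eval (a := c) (p := q)
      have : q * g = Polynomial.C (q.eval c) * g + s * ((Polynomial.X - Polynomial.C c) * g) := by
        linear_combination g * hs'
      rw [this, ← hgm]
      simp only [map_add, map_mul, minpoly.aeval, mul_zero, add_zero, Polynomial.aeval_C,
        Module.End.mul_apply, Module.algebraMap_end_apply, map_smul, LinearMap.smul_apply,
        smul_eq_mul]
      exact mul_ne_zero hqd hz) f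
  refine ⟨c, f, x, hx, fun j => ?_⟩
  split_ifs with hj
  · rw [hj, h1]
  · rcases lt_or_gt_of_ne hj with hj | hj
    · exact h0 j hj (by omega)
    · obtain ⟨d, rfl⟩ := Nat.exists_eq_add_of_lt hj
      rw [show f + d + 1 = d + (f + 1) by ring, pow_add, Module.End.mul_apply, hx]
      simp

theorem seg_decomp [IsAlgClosed k] (h2 : (2 : k) ≠ 0) (d : ℕ) :
    ∀ (V : Type u) [AddCommGroup V] [Module k V] [FiniteDimensional k V]
    (b : V →ₗ[k] V →ₗ[k] k) (_ : ∀ x y, b x y = b y x)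
    (_ : ∀ x, (∀ y, b x y = 0) → x = 0) (T : Module.End k V)
    (_ : ∀ x y, b (T x) y = b x (T y)) (_ : Module.finrank k V = d),
    ∃ (m : ℕ) (v : Fin m → k) (f : Fin m → ℕ) (x : Fin m → V),
      ∑ p, (f p + 1) = d ∧
      (∀ p, ((T - algebraMap k (Module.End k V) (v p)) ^ (f p + 1)) (x p) = 0) ∧
      (∀ p j, b (((T - algebraMap k (Module.End k V) (v p)) ^ j) (x p)) (x p)
        = if j = f p then 1 else 0) ∧
      (∀ p q, p ≠ q → ∀ i j, b (((T - algebraMap k (Module.End k V) (v p)) ^ i) (x p))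
        (((T - algebraMap k (Module.End k V) (v q)) ^ j) (x q)) = 0) := by
  induction d using Nat.strong_induction_on with
  | _ d ih =>
  intro V _ _ _ b hs hnd T hT hd
  rcases Nat.eq_zero_or_pos d with rfl | hdpos
  · exact ⟨0, Fin.elim0, Fin.elim0, Fin.elim0, by simp, fun p => p.elim0, fun p => p.elim0,
      fun p => p.elim0⟩
  have : Nontrivial V := Module.nontrivial_of_finrank_pos (R := k) (by omega)
  obtain ⟨c, f, x, hx0, hx⟩ := seg_exists_gen h2 b hs hnd T hT
  set N := T - algebraMap k (Module.End k V) c with hNdef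
  have hN : ∀ x y, b (N x) y = b x (N y) := seg_adj_sub b T hT c
  let φ : V →ₗ[k] (Fin (f + 1) → k) := LinearMap.pi fun a => b ((N ^ (a : ℕ)) x)
  have hφ : ∀ y a, φ y a = b ((N ^ (a : ℕ)) x) y := fun y a => rfl
  have hφs : Function.Surjective φ := by
    intro t
    refine ⟨∑ a : Fin (f + 1), t a • (N ^ (f - a)) x, ?_⟩
    ext a
    rw [hφ, map_sum, Finset.sum_eq_single a]
    · rw [map_smul, ← seg_adj_pow b N hN, ← Module.End.mul_apply, ← pow_add, hx,
        if_pos (by omega)]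
      simp
    · intro a' _ ha
      have : (a' : ℕ) ≠ a := fun h => ha (Fin.ext h)
      rw [map_smul, ← seg_adj_pow b N hN, ← Module.End.mul_apply, ← pow_add, hx,
        if_neg (by omega)]
      simp
    · simp
  have hU : ∀ u ∈ LinearMap.ker φ, ∀ a, b ((N ^ a) x) u = 0 := by
    intro u hu a
    by_cases ha : a < f + 1
    · exact congrFun (LinearMap.mem_ker.1 hu) ⟨a, ha⟩
    · obtain ⟨d, rfl⟩ := Nat.exists_eq_add_of_le (not_lt.1 ha)
      rw [add_comm, pow_add, Module.End.mul_apply, hx0]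
      simp
  have hUT : ∀ u ∈ LinearMap.ker φ, T u ∈ LinearMap.ker φ := by
    intro u hu
    have h1 : N u ∈ LinearMap.ker φ := by
      rw [LinearMap.mem_ker]
      ext a
      rw [hφ, ← hN, ← Module.End.mul_apply, ← pow_succ', hU u hu]
      rfl
    have h2 : T u = N u + c • u := by simp [hNdef, Module.algebraMap_end_apply]
    rw [h2]
    exact add_mem h1 (Submodule.smul_mem _ _ hu)
  have hrank := LinearMap.finrank_range_add_finrank_ker φ
  rw [LinearMap.range_eq_top.2 hφs, finrank_top, Module.finrank_fin_fun, hd] at hrank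
  let U := LinearMap.ker φ
  let T' : Module.End k U := T.restrict hUT
  have hT' : ∀ (v : k) (j : ℕ) (u : U),
      ((((T' - algebraMap k (Module.End k U) v) ^ j) u : U) : V)
      = ((T - algebraMap k (Module.End k V) v) ^ j) u := by
    intro v j
    induction j with
    | zero => intro u; simp
    | succ j ih =>
      intro u
      rw [pow_succ, pow_succ, Module.End.mul_apply, Module.End.mul_apply, ih]
      congr 1
  obtain ⟨m, v, g, y, h1, h2', h3, h4⟩ := ih (Module.finrank k U) (by change Module.finrank k (LinearMap.ker φ) < d; omega) U
    (b.compl₁₂ U.subtype U.subtype)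
    (fun x y => hs _ _) (by
      intro u hu
      ext
      apply hnd
      intro y
      obtain ⟨t, ht⟩ : ∃ t : Fin (f + 1) → k, y - ∑ a : Fin (f + 1), t a • (N ^ (a : ℕ)) x ∈ U := by
        refine ⟨fun a => b ((N ^ (f - (a : ℕ))) x) y, ?_⟩
        rw [LinearMap.mem_ker]
        ext a
        rw [hφ, map_sub, map_sum, Finset.sum_eq_single (Fin.rev a)]
        · have hr : (Fin.rev a : ℕ) = f - a := by rw [Fin.val_rev]; omega
          rw [map_smul, ← seg_adj_pow b N hN, ← Module.End.mul_apply, ← pow_add, hx, hr,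
            if_pos (by omega)]
          simp only [hr]
          rw [show f - (f - (a : ℕ)) = a by omega]
          simp
        · intro a' _ ha
          have : (a' : ℕ) + a ≠ f := fun h => ha (Fin.ext (by rw [Fin.val_rev]; omega))
          rw [map_smul, ← seg_adj_pow b N hN, ← Module.End.mul_apply, ← pow_add, hx,
            if_neg (by omega)]
          simp
        · simp
      have h1 := hu ⟨_, ht⟩
      have h2 : b u (∑ a : Fin (f + 1), t a • (N ^ (a : ℕ)) x) = 0 := by
        rw [map_sum]
        refine Finset.sum_eq_zero fun a _ => ?_
        rw [map_smul, hs, hU u u.2, smul_zero]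
      change b u (y - _) = 0 at h1
      rwa [map_sub, h2, sub_zero] at h1) T' (fun x y => hT _ _) rfl
  simp only [LinearMap.compl₁₂_apply, Submodule.subtype_apply, hT'] at h3 h4
  have h0 : ∀ p i j, b ((N ^ i) x) (((T - algebraMap k (Module.End k V) (v p)) ^ j) (y p)) = 0 := by
    intro p i j
    rw [← hT']
    exact hU _ (Subtype.property _) _
  refine ⟨m + 1, Fin.cons c v, Fin.cons f g, Fin.cons x (fun p => (y p : V)), ?_, ?_, ?_, ?_⟩
  · rw [Fin.sum_univ_succ]
    simp only [Fin.cons_zero, Fin.cons_succ, h1]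
    exact hrank
  · intro p
    refine Fin.cases ?_ (fun p => ?_) p
    · simpa using hx0
    · simp only [Fin.cons_succ]
      rw [← hT', h2']; rfl
  · intro p
    refine Fin.cases ?_ (fun p => ?_) p
    · simpa using hx
    · simpa using h3 p
  · intro p q
    refine Fin.cases ?_ (fun p => ?_) p
    · refine Fin.cases ?_ (fun q => ?_) q
      · intro h; exact absurd rfl h
      · intro _ i j
        simpa using h0 q i j
    · refine Fin.cases ?_ (fun q => ?_) q
      · intro _ i j
        rw [hs]
        simpa using h0 p j i
      · intro h i j
        simpa using h4 p q (fun h' => h (by rw [h'])) i j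
end

theorem seg_reorg {k : Type*} (m : ℕ) (hm : 0 < m) (v : Fin m → k) (e : Fin m → ℕ) :
    ∃ (r : ℕ) (w : Fin (r + 1) → k) (h : Fin (r + 1) → ℕ)
      (σ : (Σ i : Fin (r + 1), Fin (h i)) ≃ Fin m),
      Function.Injective w ∧ (∀ i, 1 ≤ h i) ∧ (∀ p, v (σ p) = w p.1) ∧
      ∀ i, ∀ j j' : Fin (h i), j ≤ j' → e (σ ⟨i, j'⟩) ≤ e (σ ⟨i, j⟩) := by
  classical
  have : Nonempty (Fin m) := ⟨⟨0, hm⟩⟩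
  obtain ⟨r, hr⟩ : ∃ r, Fintype.card (Set.range v) = r + 1 :=
    ⟨_, (Nat.succ_pred_eq_of_pos Fintype.card_pos).symm⟩
  let E : Fin (r + 1) ≃ Set.range v := (Fintype.equivFinOfCardEq hr).symm
  let F : Fin (r + 1) → Type := fun i => {p : Fin m // Set.rangeFactorization v p = E i}
  let h : Fin (r + 1) → ℕ := fun i => Fintype.card (F i)
  let g : (i : Fin (r + 1)) → Fin (h i) ≃ F i := fun i => (Fintype.equivFin (F i)).symm
  let s : (i : Fin (r + 1)) → Equiv.Perm (Fin (h i)) := fun i =>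
    Tuple.sort (fun j => OrderDual.toDual (e (g i j).1))
  let σ : (Σ i : Fin (r + 1), Fin (h i)) ≃ Fin m :=
    (Equiv.sigmaCongrRight fun i => (s i).trans (g i)).trans
      ((Equiv.sigmaCongrLeft (β := fun y => {p : Fin m // Set.rangeFactorization v p = y}) E).trans
        (Equiv.sigmaFiberEquiv _))
  have hσ : ∀ i j, σ ⟨i, j⟩ = (g i (s i j)).1 := fun i j => rfl
  refine ⟨r, fun i => (E i).1, h, σ, ?_, ?_, ?_, ?_⟩
  · exact Subtype.val_injective.comp E.injective
  · intro i
    obtain ⟨p, hp⟩ := (E i).2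
    exact Fintype.card_pos_iff.2 ⟨⟨p, Subtype.ext hp⟩⟩
  · rintro ⟨i, j⟩
    rw [hσ]
    exact congrArg Subtype.val (g i (s i j)).2
  · intro i j j' hj
    rw [hσ, hσ]
    exact Tuple.monotone_sort (fun j => OrderDual.toDual (e (g i j).1)) hj

theorem seg_matrix {k : Type u} [Field k] [IsAlgClosed k] (h2 : (2 : k) ≠ 0) (d : ℕ)
    (M0 M1 : Matrix (Fin d) (Fin d) k) (h0 : M0.IsSymm) (h1 : M1.IsSymm) (hdet : IsUnit M1.det) :
    ∃ (m : ℕ) (v : Fin m → k) (f : Fin m → ℕ) (y : Fin m → ℕ → Fin d → k),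
      ∑ p, (f p + 1) = d ∧
      (∀ p q, p ≠ q → ∀ i j, y p i ⬝ᵥ M1 *ᵥ y q j = 0) ∧
      (∀ p q, p ≠ q → ∀ i j, y p i ⬝ᵥ M0 *ᵥ y q j = 0) ∧
      (∀ p i j, i < f p + 1 → j < f p + 1 →
        y p i ⬝ᵥ M1 *ᵥ y p j = if i + j = f p then 1 else 0) ∧
      (∀ p i j, i < f p + 1 → j < f p + 1 →
        y p i ⬝ᵥ M0 *ᵥ y p j = v p * (if i + j = f p then 1 else 0)
          + if i + j = f p + 1 then 1 else 0) := by
  let b : (Fin d → k) →ₗ[k] (Fin d → k) →ₗ[k] k := Matrix.toLinearMap₂' k M1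
  have hb : ∀ x y, b x y = x ⬝ᵥ M1 *ᵥ y := fun x y => Matrix.toLinearMap₂'_apply' M1 x y
  let T : Module.End k (Fin d → k) := Matrix.toLin' (M1⁻¹ * M0)
  have hsy : ∀ (M : Matrix (Fin d) (Fin d) k), M.IsSymm → ∀ x y, x ⬝ᵥ M *ᵥ y = y ⬝ᵥ M *ᵥ x := by
    intro M hM x y
    rw [Matrix.dotProduct_mulVec, ← Matrix.mulVec_transpose, hM.eq, dotProduct_comm]
  have hs : ∀ x y, b x y = b y x := by
    intro x y
    rw [hb, hb, hsy M1 h1]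
  have hbT' : ∀ x y, b x (T y) = x ⬝ᵥ M0 *ᵥ y := by
    intro x y
    rw [hb, Matrix.toLin'_apply, Matrix.mulVec_mulVec, ← mul_assoc, Matrix.mul_nonsing_inv _ hdet,
      one_mul]
  have hbT : ∀ x y, b (T x) y = x ⬝ᵥ M0 *ᵥ y := by
    intro x y
    rw [hs, hbT', hsy M0 h0]
  have hnd : ∀ x, (∀ y, b x y = 0) → x = 0 := by
    intro x hx
    have h3 : M1 *ᵥ x = 0 := by
      apply dotProduct_eq_zero
      intro w
      rw [dotProduct_comm, ← hb, hs, hx]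
    exact Matrix.eq_zero_of_mulVec_eq_zero hdet.ne_zero h3
  have hT : ∀ x y, b (T x) y = b x (T y) := fun x y => by rw [hbT, hbT']
  obtain ⟨m, v, f, x, e1, e2, e3, e4⟩ := seg_decomp h2 d (Fin d → k) b hs hnd T hT (by simp)
  have hTN : ∀ c z, T z = (T - algebraMap k (Module.End k (Fin d → k)) c) z + c • z := by
    intro c z; simp [Module.algebraMap_end_apply]
  refine ⟨m, v, f, fun p i => ((T - algebraMap k (Module.End k (Fin d → k)) (v p)) ^ (f p - i)) (x p), e1,
    ?_, ?_, ?_, ?_⟩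
  · intro p q hpq i j
    rw [← hb, e4 p q hpq]
  · intro p q hpq i j
    rw [← hbT, hTN (v p), ← Module.End.mul_apply, ← pow_succ', map_add, map_smul,
      LinearMap.add_apply, LinearMap.smul_apply, e4 p q hpq, e4 p q hpq]
    simp
  · intro p i j hi hj
    rw [← hb, ← seg_adj_pow b _ (seg_adj_sub b T hT _), ← Module.End.mul_apply, ← pow_add, e3]
    congr 1
    apply propext; omega
  · intro p i j hi hj
    rw [← hbT, hTN (v p), ← Module.End.mul_apply, ← pow_succ', map_add, map_smul,
      LinearMap.add_apply, LinearMap.smul_apply, ← seg_adj_pow b _ (seg_adj_sub b T hT _),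
      ← seg_adj_pow b _ (seg_adj_sub b T hT _), ← Module.End.mul_apply, ← Module.End.mul_apply,
      ← pow_add, ← pow_add, e3, e3, add_comm, smul_eq_mul]
    congr 2
    · congr 1
      apply propext; omega
    · apply propext; omega

theorem seg_exists_Q {k : Type*} [Field k] [Infinite k] (n : ℕ)
    (A B : Matrix (Fin (n + 1)) (Fin (n + 1)) k)
    (hdet : ((MvPolynomial.X 0 : MvPolynomial (Fin 2) k) •
        A.map (MvPolynomial.C : k → MvPolynomial (Fin 2) k)
      + (MvPolynomial.X 1 : MvPolynomial (Fin 2) k) •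
        B.map (MvPolynomial.C : k → MvPolynomial (Fin 2) k)).det ≠ 0) :
    ∃ Q : Matrix (Fin 2) (Fin 2) k, IsUnit Q.det ∧ IsUnit (Q 0 1 • A + Q 1 1 • B).det := by
  obtain ⟨s, hs⟩ : ∃ s : Fin 2 → k, (s 0 • A + s 1 • B).det ≠ 0 := by
    by_contra! hcon
    apply hdet
    apply MvPolynomial.funext
    intro s
    rw [map_zero, RingHom.map_det, ← hcon s]
    congr 1
    ext i j
    simp
  by_cases h1 : s 1 = 0
  · have h0 : s 0 ≠ 0 := by
      intro h0
      rw [h0, h1] at hs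
      simp at hs
    refine ⟨!![0, s 0; 1, s 1], ?_, by simpa using hs⟩
    simp [Matrix.det_fin_two, h0]
  · refine ⟨!![1, s 0; 0, s 1], ?_, by simpa using hs⟩
    simp [Matrix.det_fin_two, h1]

theorem seg_delta_sq (k : Type*) [Field k] (e : ℕ) : DeltaM k e * DeltaM k e = 1 := by
  ext a b
  rw [Matrix.mul_apply, Finset.sum_eq_single (Fin.rev a)]
  · have : (a : ℕ) + (Fin.rev a : ℕ) = e - 1 := by rw [Fin.val_rev]; omega
    simp only [DeltaM, Matrix.of_apply, this, if_true, one_mul, Matrix.one_apply]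
    congr 1
    rw [Fin.ext_iff]
    apply propext; omega
  · intro c _ hc
    have : (a : ℕ) + c ≠ e - 1 := fun h => hc (Fin.ext (by rw [Fin.val_rev]; omega))
    simp [DeltaM, this]
  · simp

theorem segre_normal_form
    (k : Type*) [Field k] [IsAlgClosed k] (hchar : ringChar k ≠ 2)
    (n : ℕ) (hn : 1 ≤ n)
    (A B : Matrix (Fin (n + 1)) (Fin (n + 1)) k)
    (hA : A.IsSymm) (hB : B.IsSymm)
    (hli : LinearIndependent k ![A, B])
    (hdet : ((MvPolynomial.X 0 : MvPolynomial (Fin 2) k) •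
        A.map (MvPolynomial.C : k → MvPolynomial (Fin 2) k)
      + (MvPolynomial.X 1 : MvPolynomial (Fin 2) k) •
        B.map (MvPolynomial.C : k → MvPolynomial (Fin 2) k)).det ≠ 0) :
    ∃ (r : ℕ) (u v : Fin (r + 1) → k) (h : Fin (r + 1) → ℕ)
      (e : (i : Fin (r + 1)) → Fin (h i) → ℕ),
      (∀ i, (u i, v i) ≠ (0, 0)) ∧
      (∀ i j, i ≠ j → ∀ c : k, c ≠ 0 → (u j, v j) ≠ (c * u i, c * v i)) ∧
      (∀ i, 1 ≤ h i) ∧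
      (∀ i, ∀ j j' : Fin (h i), j ≤ j' → e i j' ≤ e i j) ∧
      (∀ i, ∀ j, 1 ≤ e i j) ∧
      (∑ i, ∑ j, e i j = n + 1) ∧
      ∃ (idx : (Σ p : (Σ i : Fin (r + 1), Fin (h i)), Fin (e p.1 p.2)) ≃ Fin (n + 1))
        (P : Matrix (Fin (n + 1)) (Fin (n + 1)) k)
        (Q : Matrix (Fin 2) (Fin 2) k),
        IsUnit P.det ∧ IsUnit Q.det ∧
        Q 0 0 • (Pᵀ * A * P) + Q 1 0 • (Pᵀ * B * P)
          = Matrix.reindex idx idx (SegreBlock0 k r v h e) ∧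
        Q 0 1 • (Pᵀ * A * P) + Q 1 1 • (Pᵀ * B * P)
          = Matrix.reindex idx idx (SegreBlock1 k r u h e) := by
  classical
  have h2 : (2 : k) ≠ 0 := Ring.two_ne_zero hchar
  have : Infinite k := IsAlgClosed.instInfinite
  obtain ⟨Q, hQ, hM1⟩ := seg_exists_Q n A B hdet
  obtain ⟨m, v, f, y, e1, e2, e3, e4, e5⟩ := seg_matrix h2 (n + 1) (Q 0 0 • A + Q 1 0 • B)
    (Q 0 1 • A + Q 1 1 • B) ((hA.smul _).add (hB.smul _)) ((hA.smul _).add (hB.smul _)) hM1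
  have hm : 0 < m := by
    rcases Nat.eq_zero_or_pos m with rfl | h
    · simp at e1
    · exact h
  obtain ⟨r, w, h, σ, hw, hh, hv, hanti⟩ := seg_reorg m hm v f
  let e : (i : Fin (r + 1)) → Fin (h i) → ℕ := fun i j => f (σ ⟨i, j⟩) + 1
  have hsum : ∑ i, ∑ j, e i j = n + 1 := by
    rw [← e1, ← Equiv.sum_comp σ, Fintype.sum_sigma]
  have hcard : Fintype.card (Σ p : (Σ i : Fin (r + 1), Fin (h i)), Fin (e p.1 p.2))
      = Fintype.card (Fin (n + 1)) := by
    rw [Fintype.card_sigma, Fintype.sum_sigma, Fintype.card_fin, ← hsum]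
    simp
  let idx := Fintype.equivOfCardEq hcard
  let col : (Σ p : (Σ i : Fin (r + 1), Fin (h i)), Fin (e p.1 p.2)) → Fin (n + 1) → k :=
    fun s => y (σ s.1) s.2
  let P : Matrix (Fin (n + 1)) (Fin (n + 1)) k := Matrix.of fun i j => col (idx.symm j) i
  have hP : ∀ (M : Matrix (Fin (n + 1)) (Fin (n + 1)) k) j j',
      (Pᵀ * M * P) j j' = col (idx.symm j) ⬝ᵥ M *ᵥ col (idx.symm j') := by
    intro M j j'
    rw [mul_assoc, Matrix.mul_apply]
    rfl
  have hG0 : Pᵀ * (Q 0 0 • A + Q 1 0 • B) * P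
      = Matrix.reindex idx idx (SegreBlock0 k r w h e) := by
    ext j j'
    rw [hP, Matrix.reindex_apply, Matrix.submatrix_apply]
    generalize idx.symm j = s
    generalize idx.symm j' = t
    obtain ⟨p, a⟩ := s
    obtain ⟨q, c⟩ := t
    by_cases hpq : p = q
    · subst hpq
      rw [SegreBlock0, Matrix.blockDiagonal'_apply_eq]
      refine (e5 (σ p) a c a.2 c.2).trans ?_
      rw [hv]
      simp [DeltaM, LambdaM, e]
    · rw [SegreBlock0, Matrix.blockDiagonal'_apply_ne _ _ _ hpq]
      exact e3 _ _ (fun h => hpq (σ.injective h)) _ _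
  have hG1 : Pᵀ * (Q 0 1 • A + Q 1 1 • B) * P
      = Matrix.reindex idx idx (SegreBlock1 k r (fun _ => -1) h e) := by
    ext j j'
    rw [hP, Matrix.reindex_apply, Matrix.submatrix_apply]
    generalize idx.symm j = s
    generalize idx.symm j' = t
    obtain ⟨p, a⟩ := s
    obtain ⟨q, c⟩ := t
    by_cases hpq : p = q
    · subst hpq
      rw [SegreBlock1, Matrix.blockDiagonal'_apply_eq]
      refine (e4 (σ p) a c a.2 c.2).trans ?_
      simp [DeltaM, e]
    · rw [SegreBlock1, Matrix.blockDiagonal'_apply_ne _ _ _ hpq]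
      exact e2 _ _ (fun h => hpq (σ.injective h)) _ _
  have hsq : SegreBlock1 k r (fun _ => -1) h e * SegreBlock1 k r (fun _ => -1) h e = 1 := by
    rw [SegreBlock1, ← Matrix.blockDiagonal'_mul]
    simp only [neg_neg, one_smul, seg_delta_sq]
    exact Matrix.blockDiagonal'_one
  refine ⟨r, fun _ => -1, w, h, e, ?_, ?_, hh, ?_, ?_, hsum, idx, P, Q, ?_, hQ, ?_, ?_⟩
  · intro i hi
    simp at hi
  · intro i j hij c _ heq
    simp only [Prod.mk.injEq] at heq
    have hc1 : c = 1 := by linear_combination heq.1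
    have h3 := heq.2
    rw [hc1, one_mul] at h3
    exact hij (hw h3.symm)
  · intro i j j' hj
    exact Nat.succ_le_succ (hanti i j j' hj)
  · intro i j
    exact Nat.succ_le_succ (Nat.zero_le _)
  · have hd := congrArg Matrix.det hG1
    rw [Matrix.det_mul, Matrix.det_reindex_self] at hd
    have hu : IsUnit (SegreBlock1 k r (fun _ => -1) h e).det := by
      rw [← Matrix.isUnit_iff_isUnit_det]
      exact IsUnit.of_mul_eq_one _ hsq
    rw [← hd] at hu
    exact isUnit_of_mul_isUnit_right hu
  · rw [← hG0]
    simp [Matrix.mul_add, Matrix.add_mul]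
  · rw [← hG1]
    simp [Matrix.mul_add, Matrix.add_mul]
end

section
/- Let k be a field with a fixed algebraic closure k̄, n ≥ 1, and f(X_0,X_1) ∈ k[X_0,X_1] a nonzero homogeneous polynomial of degree n+1. Let p(X) := f(X,1) ∈ k[X], let s := (n+1) − deg p, let C_f ∈ k^× be the leading coefficient of p, and set L := (k[X]/(p)) × (k[Y]/(Y^s)), a commutative k-algebra of k-dimension n+1, with norm N_{L/k}: L → k given by N_{L/k}(α) = det of multiplication by α on L. Then the following are equivalent: (i) there exist symmetric (n+1)×(n+1) matrices M_0, M_1 over k with det(X_0 M_0 + X_1 M_1) = f and rank(a M_0 + b M_1) ≥ n for all (a,b) ∈ k̄² with (a,b) ≠ (0,0); (ii) there exist u ∈ k^× and α ∈ L^× with C_f = (−1)^{n(n+1)/2}·u²·N_{L/k}(α). -/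
open Matrix Polynomial

/-- The dehomogenization `p(X) = f(X, 1)` of a bivariate polynomial `f`. -/
noncomputable def dehomog {k : Type*} [Field k] (f : MvPolynomial (Fin 2) k) :
    Polynomial k :=
  MvPolynomial.aeval ![Polynomial.X, 1] f

/-- The étale-like algebra `L = k[X]/(p) × k[Y]/(Y^s)` attached to a binary form `f` of
degree `n+1`, where `p = f(X,1)` and `s = (n+1) - deg p`. -/
noncomputable abbrev SegreAlgebra (k : Type*) [Field k] (n : ℕ)
    (f : MvPolynomial (Fin 2) k) : Type _ :=
  AdjoinRoot (dehomog f) ×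
    AdjoinRoot ((Polynomial.X : Polynomial k) ^ (n + 1 - (dehomog f).natDegree))

/-- corank at most one -/
def Cork {K m : Type*} [Field K] [Fintype m] (N : Matrix m m K) : Prop :=
  ∀ x y : m → K, N *ᵥ x = 0 → N *ᵥ y = 0 → ∃ c d : K, (c ≠ 0 ∨ d ≠ 0) ∧ c • x + d • y = 0

theorem finrank_ker_le_one_of_cork {K m : Type*} [Field K] [Fintype m] {N : Matrix m m K}
    (h : Cork N) : Module.finrank K (LinearMap.ker N.mulVecLin) ≤ 1 := by
  by_contra hc
  push Not at hc
  obtain ⟨f, hf⟩ := exists_linearIndependent_of_le_finrank (R := K) (Nat.succ_le_of_lt hc)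
  obtain ⟨c, d, hcd, h0⟩ := h (f 0) (f 1) (f 0).2 (f 1).2
  have hf' := LinearIndependent.pair_iff.1 (show LinearIndependent K ![f 0, f 1] by
    convert hf using 1; ext i; fin_cases i <;> rfl) c d (Subtype.ext (by simpa using h0))
  tauto

theorem cork_of_finrank_ker_le_one {K m : Type*} [Field K] [Fintype m] {N : Matrix m m K}
    (h : Module.finrank K (LinearMap.ker N.mulVecLin) ≤ 1) : Cork N := by
  intro x y hx hy
  by_contra hc
  push Not at hc
  have hx' : x ∈ LinearMap.ker N.mulVecLin := by simpa using hx
  have hy' : y ∈ LinearMap.ker N.mulVecLin := by simpa using hy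
  have hl : LinearIndependent K ![(⟨x, hx'⟩ : LinearMap.ker N.mulVecLin), ⟨y, hy'⟩] := by
    rw [LinearIndependent.pair_iff]
    intro s t hst
    by_contra h2
    refine hc s t (by tauto) ?_
    simpa using congrArg Subtype.val hst
  have := hl.fintype_card_le_finrank
  simp at this
  omega

theorem cork_iff {K : Type*} [Field K] {n : ℕ} (N : Matrix (Fin (n+1)) (Fin (n+1)) K) :
    n ≤ N.rank ↔ Cork N := by
  have h1 := LinearMap.finrank_range_add_finrank_ker N.mulVecLin
  have h2 : N.rank = Module.finrank K (LinearMap.range N.mulVecLin) := rfl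
  rw [← h2] at h1
  simp at h1
  constructor
  · intro h
    exact cork_of_finrank_ker_le_one (by omega)
  · intro h
    have := finrank_ker_le_one_of_cork h
    omega

theorem det_hankel {k : Type*} [Field k] : ∀ (d : ℕ) (J : Matrix (Fin d) (Fin d) k),
    (∀ i j : Fin d, (i : ℕ) + j + 1 < d → J i j = 0) →
    (∀ i j : Fin d, (i : ℕ) + j + 1 = d → J i j = 1) →
    J.det = (-1) ^ (d * (d - 1) / 2)
  | 0, J, _, _ => by simp
  | d + 1, J, h0, h1 => by
    rw [det_succ_row_zero, Finset.sum_eq_single (Fin.last d)]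
    · rw [h1 0 (Fin.last d) (by simp), det_hankel d]
      · simp only [Fin.val_last, mul_one, ← pow_add]
        congr 1
        have := Nat.triangle_succ d
        rw [this]; ring
      · intro i j hij
        simp only [submatrix_apply, Fin.succAbove_last]
        apply h0
        simp; omega
      · intro i j hij
        simp only [submatrix_apply, Fin.succAbove_last]
        apply h1
        simp; omega
    · intro j _ hj
      have : (j : ℕ) < d := by
        have := Fin.val_lt_last hj
        simpa using this
      rw [h0 0 j (by simp; omega)]
      simp
    · simp

section frob
variable {k A : Type*} [Field k] [CommRing A] [Algebra k A] {d : ℕ}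

/-- Gram matrix -/
noncomputable def frobGram (b : Module.Basis (Fin d) k A) (τ : A →ₗ[k] k) : Matrix (Fin d) (Fin d) k :=
  Matrix.of fun i j => τ (b i * b j)

theorem exists_tau (b : Module.Basis (Fin d) k A) (θ : A) (hb : ∀ i, b i = θ ^ (i : ℕ)) :
    ∃ τ : A →ₗ[k] k, (frobGram b τ).det = (-1) ^ (d * (d - 1) / 2) := by
  rcases Nat.eq_zero_or_pos d with h | h
  · subst h
    exact ⟨0, by simp⟩
  refine ⟨b.coord ⟨d - 1, by omega⟩, det_hankel _ _ ?_ ?_⟩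
  · intro i j hij
    have : b i * b j = b ⟨i + j, by omega⟩ := by simp [hb, pow_add]
    rw [frobGram, Matrix.of_apply, this, Module.Basis.coord_apply, Module.Basis.repr_self,
      Finsupp.single_eq_of_ne]
    simp [Fin.ext_iff]; omega
  · intro i j hij
    have : b i * b j = b ⟨i + j, by omega⟩ := by simp [hb, pow_add]
    rw [frobGram, Matrix.of_apply, this, Module.Basis.coord_apply, Module.Basis.repr_self]
    have : (⟨i + j, by omega⟩ : Fin d) = ⟨d - 1, by omega⟩ := by
      simp [Fin.ext_iff]; omega
    rw [this]; simp

/-- multiply a functional -/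
noncomputable def mulFun (τ : A →ₗ[k] k) (α : A) : A →ₗ[k] k := τ ∘ₗ LinearMap.mulLeft k α

theorem gram_mul (b : Module.Basis (Fin d) k A) (τ : A →ₗ[k] k) (α : A) :
    frobGram b (mulFun τ α) = frobGram b τ * Algebra.leftMulMatrix b α := by
  ext i j
  rw [Matrix.mul_apply]
  have h : α * b j = ∑ l, Algebra.leftMulMatrix b α l j • b l := by
    simp_rw [Algebra.leftMulMatrix_eq_repr_mul]
    exact (b.sum_repr _).symm
  have : α * (b i * b j) = b i * (α * b j) := by ring
  simp only [frobGram, mulFun, Matrix.of_apply, LinearMap.comp_apply, LinearMap.mulLeft_apply]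
  rw [this, h, Finset.mul_sum, map_sum]
  refine Finset.sum_congr rfl fun l _ => ?_
  rw [mul_smul_comm, map_smul, smul_eq_mul, mul_comm]

theorem det_gram_mul (b : Module.Basis (Fin d) k A) (τ : A →ₗ[k] k) (α : A) :
    (frobGram b (mulFun τ α)).det = (frobGram b τ).det * Algebra.norm k α := by
  rw [gram_mul, det_mul, Algebra.norm_eq_matrix_det b]

theorem gram_symm (b : Module.Basis (Fin d) k A) (τ : A →ₗ[k] k) : (frobGram b τ).IsSymm := by
  ext i j
  simp [frobGram, mul_comm]

theorem exists_mulFun (b : Module.Basis (Fin d) k A) (τ : A →ₗ[k] k) (h : (frobGram b τ).det ≠ 0)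
    (l : A →ₗ[k] k) : ∃ α, l = mulFun τ α := by
  have : FiniteDimensional k A := b.finiteDimensional_of_finite
  let F : A →ₗ[k] Module.Dual k A := 
    { toFun := mulFun τ
      map_add' := by intro x y; ext z; simp [mulFun, add_mul]
      map_smul' := by intro x y; ext z; simp [mulFun] }
  have hF : Function.Injective F := by
    rw [injective_iff_map_eq_zero]
    intro a ha
    have h1 : frobGram b (mulFun τ a) = 0 := by
      have : mulFun τ a = 0 := ha
      rw [this]; ext; simp [frobGram]
    rw [gram_mul] at h1
    have h2 : Algebra.leftMulMatrix b a = 0 := by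
      have := congrArg (fun M => (frobGram b τ)⁻¹ * M) h1
      simpa [← Matrix.mul_assoc, Matrix.nonsing_inv_mul _ (isUnit_iff_ne_zero.2 h)] using this
    exact Algebra.leftMulMatrix_injective b (by rw [h2, map_zero])
  have hS : Function.Surjective F :=
    (LinearMap.injective_iff_surjective_of_finrank_eq_finrank
      (Subspace.dual_finrank_eq).symm).1 hF
  obtain ⟨α, hα⟩ := hS l
  exact ⟨α, hα.symm⟩

theorem isUnit_of_norm_ne_zero (b : Module.Basis (Fin d) k A) (α : A)
    (h : Algebra.norm k α ≠ 0) : IsUnit α := by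
  have : FiniteDimensional k A := b.finiteDimensional_of_finite
  have h1 : IsUnit (LinearMap.det (LinearMap.mulLeft k α)) := isUnit_iff_ne_zero.2 h
  have h2 := (LinearMap.equivOfIsUnitDet h1).surjective 1
  obtain ⟨x, hx⟩ := h2
  exact IsUnit.of_mul_eq_one x (by rwa [LinearMap.equivOfIsUnitDet_apply] at hx)
end frob

theorem exists_adjoinRoot_basis {k : Type*} [Field k] (p : k[X]) (hp : p ≠ 0) :
    ∃ b : Module.Basis (Fin p.natDegree) k (AdjoinRoot p),
      (∀ i, b i = AdjoinRoot.root p ^ (i : ℕ)) ∧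
      (Algebra.leftMulMatrix b (AdjoinRoot.root p)).charpoly = p * C p.leadingCoeff⁻¹ := by
  let pb := AdjoinRoot.powerBasis hp
  let e : Fin pb.dim ≃ Fin p.natDegree := finCongr (AdjoinRoot.powerBasis_dim hp)
  refine ⟨pb.basis.reindex e, ?_, ?_⟩
  · intro i
    simp [e, pb]
  · have h1 := charpoly_leftMulMatrix pb
    have h2 : pb.gen = AdjoinRoot.root p := AdjoinRoot.powerBasis_gen hp
    rw [h2, AdjoinRoot.minpoly_root hp] at h1
    rw [← h1]
    have : Algebra.leftMulMatrix (pb.basis.reindex e) (AdjoinRoot.root p) =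
      Matrix.reindex e e (Algebra.leftMulMatrix pb.basis (AdjoinRoot.root p)) := by
      ext i j
      simp [Algebra.leftMulMatrix_eq_repr_mul]
    rw [this, Matrix.charpoly_reindex]

theorem companion_entry {k A : Type*} [Field k] [CommRing A] [Algebra k A] {d : ℕ}
    (b : Module.Basis (Fin d) k A) (θ : A) (hb : ∀ i, b i = θ ^ (i : ℕ))
    (i j : Fin d) (h : (j : ℕ) + 1 < d) :
    Algebra.leftMulMatrix b θ i j = if i = ⟨j + 1, h⟩ then 1 else 0 := by
  rw [Algebra.leftMulMatrix_eq_repr_mul]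
  have : θ * b j = b ⟨j + 1, h⟩ := by simp [hb, pow_succ, mul_comm]
  rw [this, Module.Basis.repr_self, Finsupp.single_apply]
  simp only [eq_comm]

/-- the block construction -/
theorem exists_block {k : Type*} [Field k] (p : k[X]) (hp : p ≠ 0) (α : AdjoinRoot p) :
    ∃ G Θ : Matrix (Fin p.natDegree) (Fin p.natDegree) k, G.IsSymm ∧ (G * Θ).IsSymm ∧
      G.det = (-1) ^ (p.natDegree * (p.natDegree - 1) / 2) * Algebra.norm k α ∧
      Θ.charpoly = p * C p.leadingCoeff⁻¹ ∧
      ∀ i j : Fin p.natDegree, ∀ h : (j : ℕ) + 1 < p.natDegree, Θ i j = if i = ⟨j + 1, h⟩ then 1 else 0 := by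
  obtain ⟨b, hb, hc⟩ := exists_adjoinRoot_basis p hp
  obtain ⟨τ, hτ⟩ := exists_tau b _ hb
  refine ⟨frobGram b (mulFun τ α), Algebra.leftMulMatrix b (AdjoinRoot.root p), gram_symm _ _,
    ?_, ?_, hc, companion_entry b _ hb⟩
  · rw [← gram_mul]
    exact gram_symm _ _
  · rw [det_gram_mul, hτ]

theorem cork_pencil {K : Type*} [Field K] {d : ℕ} (G Θ : Matrix (Fin d) (Fin d) K)
    (hG : G.IsSymm) (hGΘ : (G * Θ).IsSymm) (hd : G.det ≠ 0)
    (hΘ : ∀ i j : Fin d, ∀ h : (j : ℕ) + 1 < d, Θ i j = if i = ⟨j + 1, h⟩ then 1 else 0)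
    (a b : K) (hb : b ≠ 0) : Cork (a • G - b • (G * Θ)) := by
  have hinj : ∀ x : Fin d → K, G *ᵥ x = 0 → x = 0 := by
    intro x hx
    by_contra h
    exact hd (Matrix.exists_mulVec_eq_zero_iff.1 ⟨x, h, hx⟩)
  have key : ∀ x : Fin d → K, (a • G - b • (G * Θ)) *ᵥ x = 0 → 
      ∀ j : Fin d, ∀ h : (j : ℕ) + 1 < d, b * (G *ᵥ x) ⟨j + 1, h⟩ = a * (G *ᵥ x) j := by
    intro x hx j h
    have h1 : (G * Θ) = Θᵀ * G := by
      have := hGΘ.eq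
      rw [Matrix.transpose_mul, hG.eq] at this
      exact this.symm
    rw [h1, Matrix.sub_mulVec, Matrix.smul_mulVec, Matrix.smul_mulVec, ← Matrix.mulVec_mulVec] at hx
    have h2 := congrFun hx j
    have h3 : (Θᵀ *ᵥ (G *ᵥ x)) j = (G *ᵥ x) ⟨j + 1, h⟩ := by
      rw [Matrix.mulVec, dotProduct, Finset.sum_eq_single ⟨j + 1, h⟩]
      · simp [hΘ _ j h]
      · intro i _ hi
        simp [hΘ _ j h, hi]
      · simp
    simp only [Pi.sub_apply, Pi.smul_apply, smul_eq_mul, Pi.zero_apply, h3] at h2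
    exact (sub_eq_zero.1 h2).symm
  have key2 : ∀ x : Fin d → K, (a • G - b • (G * Θ)) *ᵥ x = 0 →
      (∀ h : 0 < d, (G *ᵥ x) ⟨0, h⟩ = 0) → x = 0 := by
    intro x hx h0
    apply hinj
    ext ⟨j, hj⟩
    induction j with
    | zero => exact h0 hj
    | succ j ih =>
      have := key x hx ⟨j, by omega⟩ hj
      rw [ih] at this
      simpa [hb] using this
  intro x y hx hy
  by_cases h : ∀ h : 0 < d, (G *ᵥ x) ⟨0, h⟩ = 0
  · exact ⟨1, 0, by simp, by simp [key2 x hx h]⟩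
  · push Not at h
    obtain ⟨h, h'⟩ := h
    refine ⟨(G *ᵥ y) ⟨0, h⟩, -(G *ᵥ x) ⟨0, h⟩, Or.inr (by simpa using h'), key2 _ ?_ ?_⟩
    · rw [Matrix.mulVec_add, Matrix.mulVec_smul, Matrix.mulVec_smul, hx, hy]; simp
    · intro _
      rw [Matrix.mulVec_add, Matrix.mulVec_smul, Matrix.mulVec_smul]
      simp; ring

section dehom


theorem dehomog_eq_sum {k : Type*} [Field k] (f : MvPolynomial (Fin 2) k) :
    dehomog f = ∑ m ∈ f.support, C (f.coeff m) * X ^ (m 0) := by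
  rw [dehomog]
  conv_lhs => rw [f.as_sum]
  rw [map_sum]
  refine Finset.sum_congr rfl fun m _ => ?_
  rw [MvPolynomial.aeval_monomial]
  simp [Finsupp.prod_fintype, Polynomial.algebraMap_eq]

theorem sum_of_mem {k : Type*} [Field k] {f : MvPolynomial (Fin 2) k} {N : ℕ}
    (hf : f.IsHomogeneous N) {m} (hm : m ∈ f.support) : m 0 + m 1 = N := by
  have := hf (MvPolynomial.mem_support_iff.1 hm)
  simpa [Finsupp.weight_apply, Finsupp.sum_fintype] using this

theorem dehomog_natDegree_le {k : Type*} [Field k] (f : MvPolynomial (Fin 2) k) (N : ℕ)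
    (hf : f.IsHomogeneous N) : (dehomog f).natDegree ≤ N := by
  rw [dehomog_eq_sum]
  refine natDegree_sum_le_of_forall_le _ _ fun m hm => ?_
  refine (natDegree_C_mul_X_pow_le _ _).trans ?_
  have := sum_of_mem hf hm
  omega

theorem dehomog_eq_zero {k : Type*} [Field k] (f : MvPolynomial (Fin 2) k) (N : ℕ)
    (hf : f.IsHomogeneous N) (h : dehomog f = 0) : f = 0 := by
  by_contra h0
  obtain ⟨m, hm⟩ := MvPolynomial.support_nonempty.2 h0
  have h1 := congrArg (fun q => coeff q (m 0)) h
  simp only [dehomog_eq_sum, finsetSum_coeff, coeff_C_mul_X_pow, coeff_zero] at h1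
  rw [Finset.sum_eq_single m] at h1
  · simp at h1
    exact MvPolynomial.mem_support_iff.1 hm h1
  · intro m' hm' hne
    rw [if_neg]
    intro h2
    apply hne
    have e1 := sum_of_mem hf hm
    have e2 := sum_of_mem hf hm'
    ext i
    fin_cases i
    · simp [h2]
    · simp; omega
  · tauto

theorem dehomog_inj {k : Type*} [Field k] {f g : MvPolynomial (Fin 2) k} {N : ℕ}
    (hf : f.IsHomogeneous N) (hg : g.IsHomogeneous N) (h : dehomog f = dehomog g) : f = g := by
  rw [← sub_eq_zero]
  apply dehomog_eq_zero _ N (hf.sub hg)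
  rw [dehomog, map_sub, sub_eq_zero]
  exact h

theorem pencil_homog {k : Type*} [Field k] {N : ℕ} (M₀ M₁ : Matrix (Fin N) (Fin N) k) :
    ((MvPolynomial.X 0 : MvPolynomial (Fin 2) k) •
          M₀.map (MvPolynomial.C : k → MvPolynomial (Fin 2) k)
        + (MvPolynomial.X 1 : MvPolynomial (Fin 2) k) •
          M₁.map (MvPolynomial.C : k → MvPolynomial (Fin 2) k)).det.IsHomogeneous N := by
  rw [Matrix.det_apply]
  refine MvPolynomial.IsHomogeneous.sum _ _ _ fun σ _ => ?_
  have : (∏ i, ((MvPolynomial.X 0 : MvPolynomial (Fin 2) k) •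
          M₀.map (MvPolynomial.C : k → MvPolynomial (Fin 2) k)
        + (MvPolynomial.X 1 : MvPolynomial (Fin 2) k) •
          M₁.map (MvPolynomial.C : k → MvPolynomial (Fin 2) k)) (σ i) i).IsHomogeneous N := by
    have := MvPolynomial.IsHomogeneous.prod (Finset.univ : Finset (Fin N)) (fun i => ((MvPolynomial.X 0 : MvPolynomial (Fin 2) k) •
          M₀.map (MvPolynomial.C : k → MvPolynomial (Fin 2) k)
        + (MvPolynomial.X 1 : MvPolynomial (Fin 2) k) •
          M₁.map (MvPolynomial.C : k → MvPolynomial (Fin 2) k)) (σ i) i) (fun _ => 1) (by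
        intro i _
        simp only [Matrix.add_apply, Matrix.smul_apply, Matrix.map_apply, smul_eq_mul]
        exact ((MvPolynomial.isHomogeneous_X _ _).mul (MvPolynomial.isHomogeneous_C _ _)).add
          ((MvPolynomial.isHomogeneous_X _ _).mul (MvPolynomial.isHomogeneous_C _ _)))
    simpa using this
  rcases Int.units_eq_one_or (Equiv.Perm.sign σ) with h | h
  · rw [h]; simpa using this
  · rw [h]; simpa using this.neg

theorem pencil_dehomog {k : Type*} [Field k] {N : ℕ} (M₀ M₁ : Matrix (Fin N) (Fin N) k) :
    dehomog ((MvPolynomial.X 0 : MvPolynomial (Fin 2) k) •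
          M₀.map (MvPolynomial.C : k → MvPolynomial (Fin 2) k)
        + (MvPolynomial.X 1 : MvPolynomial (Fin 2) k) •
          M₁.map (MvPolynomial.C : k → MvPolynomial (Fin 2) k)).det
      = ((X : k[X]) • M₀.map C + M₁.map C).det := by
  rw [dehomog, AlgHom.map_det]
  congr 1
  ext1 i j
  simp [Polynomial.algebraMap_eq]
end dehom

theorem inj_of_det {K m : Type*} [Field K] [Fintype m] [DecidableEq m] {N : Matrix m m K}
    (h : N.det ≠ 0) (x : m → K) (hx : N *ᵥ x = 0) : x = 0 := by
  by_contra h'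
  exact h (Matrix.exists_mulVec_eq_zero_iff.1 ⟨x, h', hx⟩)

theorem Cork.congr {K m : Type*} [Field K] [Fintype m] [DecidableEq m] {N P : Matrix m m K}
    (h : Cork N) (hP : P.det ≠ 0) : Cork (Pᵀ * N * P) := by
  have h1 : ∀ x, (Pᵀ * N * P) *ᵥ x = 0 → N *ᵥ (P *ᵥ x) = 0 := by
    intro x hx
    apply inj_of_det (N := Pᵀ) (by rwa [det_transpose])
    rw [Matrix.mulVec_mulVec, Matrix.mulVec_mulVec]
    exact hx
  intro x y hx hy
  obtain ⟨c, d, hcd, h2⟩ := h _ _ (h1 x hx) (h1 y hy)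
  refine ⟨c, d, hcd, inj_of_det hP _ ?_⟩
  rw [Matrix.mulVec_add, Matrix.mulVec_smul, Matrix.mulVec_smul, h2]

theorem Cork.reindex {K m m' : Type*} [Field K] [Fintype m] [Fintype m'] {N : Matrix m m K}
    (h : Cork N) (e : m ≃ m') : Cork (Matrix.reindex e e N) := by
  have h1 : ∀ x, (Matrix.reindex e e N) *ᵥ x = 0 → N *ᵥ (x ∘ e) = 0 := by
    intro x hx
    rw [Matrix.reindex_apply, Matrix.submatrix_mulVec_equiv] at hx
    ext i
    have := congrFun hx (e i)
    simpa using this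
  intro x y hx hy
  obtain ⟨c, d, hcd, h2⟩ := h _ _ (h1 x hx) (h1 y hy)
  refine ⟨c, d, hcd, ?_⟩
  ext i
  have := congrFun h2 (e.symm i)
  simpa using this

theorem Cork.block_left {K m m' : Type*} [Field K] [Fintype m] [Fintype m'] {A : Matrix m m K}
    {B : Matrix m' m' K} (h : Cork A) (hB : ∀ x, B *ᵥ x = 0 → x = 0) :
    Cork (fromBlocks A 0 0 B) := by
  intro x y hx hy
  rw [Matrix.fromBlocks_mulVec] at hx hy
  obtain ⟨c, d, hcd, h2⟩ := h (x ∘ Sum.inl) (y ∘ Sum.inl)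
    (by ext i; simpa using congrFun hx (Sum.inl i)) (by ext i; simpa using congrFun hy (Sum.inl i))
  have hx2 := hB (x ∘ Sum.inr) (by ext i; simpa using congrFun hx (Sum.inr i))
  have hy2 := hB (y ∘ Sum.inr) (by ext i; simpa using congrFun hy (Sum.inr i))
  refine ⟨c, d, hcd, ?_⟩
  ext (i | i)
  · simpa using congrFun h2 i
  · have e1 := congrFun hx2 i
    have e2 := congrFun hy2 i
    simp at e1 e2
    simp [e1, e2]

theorem Cork.block_right {K m m' : Type*} [Field K] [Fintype m] [Fintype m'] {A : Matrix m m K}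
    {B : Matrix m' m' K} (h : Cork B) (hA : ∀ x, A *ᵥ x = 0 → x = 0) :
    Cork (fromBlocks A 0 0 B) := by
  intro x y hx hy
  rw [Matrix.fromBlocks_mulVec] at hx hy
  obtain ⟨c, d, hcd, h2⟩ := h (x ∘ Sum.inr) (y ∘ Sum.inr)
    (by ext i; simpa using congrFun hx (Sum.inr i)) (by ext i; simpa using congrFun hy (Sum.inr i))
  have hx2 := hA (x ∘ Sum.inl) (by ext i; simpa using congrFun hx (Sum.inl i))
  have hy2 := hA (y ∘ Sum.inl) (by ext i; simpa using congrFun hy (Sum.inl i))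
  refine ⟨c, d, hcd, ?_⟩
  ext (i | i)
  · have e1 := congrFun hx2 i
    have e2 := congrFun hy2 i
    simp at e1 e2
    simp [e1, e2]
  · simpa using congrFun h2 i

theorem det_block_one {k : Type*} [Field k] {m : Type*} [Fintype m] [DecidableEq m]
    (G Θ : Matrix m m k) :
    ((X : k[X]) • G.map C + (-(G * Θ)).map C).det = C G.det * Θ.charpoly := by
  have : (X : k[X]) • G.map C + (-(G * Θ)).map C = C.mapMatrix G * Θ.charmatrix := by
    rw [charmatrix, mul_sub, ← map_mul]
    ext1 i j
    simp [sub_eq_add_neg, -Matrix.map_mul]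
  rw [this, det_mul, Matrix.charpoly, ← RingHom.map_det]

theorem det_block_two {k : Type*} [Field k] {m : Type*} [Fintype m] [DecidableEq m]
    (G Θ : Matrix m m k) :
    ((X : k[X]) • (-(G * Θ)).map C + G.map C).det = C G.det * Θ.charpolyRev := by
  have : (X : k[X]) • (-(G * Θ)).map C + G.map C = C.mapMatrix G * (1 - (X : k[X]) • C.mapMatrix Θ) := by
    rw [mul_sub, mul_smul_comm, ← map_mul]
    ext1 i j
    simp [-Matrix.map_mul]
    ring
  rw [this, det_mul, Matrix.charpolyRev, ← RingHom.map_det]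
  rfl

theorem det_pencil_congr {k : Type*} [Field k] {m : Type*} [Fintype m] [DecidableEq m]
    (A B P : Matrix m m k) :
    ((X : k[X]) • (Pᵀ * A * P).map C + (Pᵀ * B * P).map C).det =
      C (P.det ^ 2) * ((X : k[X]) • A.map C + B.map C).det := by
  have : (X : k[X]) • (Pᵀ * A * P).map C + (Pᵀ * B * P).map C =
    (P.map C)ᵀ * ((X : k[X]) • A.map C + B.map C) * P.map C := by
    simp only [Matrix.map_mul, Matrix.mul_add, Matrix.add_mul, Matrix.transpose_map,
      Matrix.mul_smul, Matrix.smul_mul]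
  rw [this, det_mul, det_mul, det_transpose]
  have : (P.map C).det = C P.det := by rw [RingHom.map_det]; rfl
  rw [this, C_pow]; ring

theorem sgn_mul {k : Type*} [Field k] (d s : ℕ) :
    (-1 : k) ^ (d * (d - 1) / 2) * (-1) ^ (s * (s - 1) / 2) * (-1) ^ (d * s) =
      (-1) ^ ((d + s) * (d + s - 1) / 2) := by
  rw [← pow_add, ← pow_add]
  congr 1
  induction s with
  | zero => simp
  | succ s ih =>
    have h1 := Nat.triangle_succ s
    have h2 := Nat.triangle_succ (d + s)
    rw [← add_assoc, h1, h2, ← ih]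
    ring

theorem construct {k K : Type*} [Field k] [Field K] [Algebra k K] (p : k[X]) (hp : p ≠ 0) (s N : ℕ)
    (hN : p.natDegree + s = N + 1) (α : AdjoinRoot p) (β : AdjoinRoot ((X : k[X]) ^ s)) (u : k)
    (hα : Algebra.norm k α ≠ 0) (hβ : Algebra.norm k β ≠ 0) (hu : u ≠ 0)
    (h : p.leadingCoeff = (-1) ^ ((N + 1) * N / 2) * u ^ 2 *
      (Algebra.norm k α * Algebra.norm k β)) :
    ∃ M₀ M₁ : Matrix (Fin (N + 1)) (Fin (N + 1)) k, M₀.IsSymm ∧ M₁.IsSymm ∧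
      ((X : k[X]) • M₀.map C + M₁.map C).det = p ∧
      ∀ a b : K, (a, b) ≠ (0, 0) →
        Cork (a • M₀.map (algebraMap k K) + b • M₁.map (algebraMap k K)) := by
  have hs : ((X : k[X]) ^ s).natDegree = s := by simp
  have hX : (X : k[X]) ^ s ≠ 0 := by simp
  obtain ⟨G, Θ, hG, hGΘ, hGd, hΘ, hc⟩ := exists_block p hp α
  obtain ⟨G', Θ', hG', hGΘ', hGd', hΘ', hc'⟩ := exists_block _ hX ((-1) ^ p.natDegree * β)
  have hβ' : Algebra.norm k ((-1) ^ p.natDegree * β) =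
      (-1) ^ (p.natDegree * s) * Algebra.norm k β := by
    have : ((-1) ^ p.natDegree : AdjoinRoot ((X : k[X]) ^ s)) =
      algebraMap k _ ((-1) ^ p.natDegree) := by simp
    rw [map_mul, this, Algebra.norm_algebraMap_of_basis (exists_adjoinRoot_basis _ hX).choose]
    simp [pow_mul]
  rw [hβ'] at hGd'
  have hGne : G.det ≠ 0 := by rw [hGd]; simp [hα]
  have hGne' : G'.det ≠ 0 := by rw [hGd']; simp [hβ]
  have hrev : Θ'.charpolyRev = 1 := by
    rw [← Matrix.reverse_charpoly, hΘ']
    simp only [leadingCoeff_X_pow, inv_one, C_1, mul_one]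
    have := Polynomial.reverse_mul_X_pow (1 : k[X]) s
    rw [one_mul] at this
    rw [this, ← C_1, reverse_C]
  have hdet : G.det * G'.det * u ^ 2 = p.leadingCoeff := by
    rw [h, hGd, hGd', hs]
    have := sgn_mul (k := k) p.natDegree s
    rw [hN] at this
    simp only [Nat.add_sub_cancel] at this
    rw [← this]; ring
  let e : Fin p.natDegree ⊕ Fin ((X : k[X]) ^ s).natDegree ≃ Fin (N + 1) :=
    finSumFinEquiv.trans (finCongr (by rw [hs, hN]))
  let H₀ := fromBlocks G 0 0 (-(G' * Θ'))
  let H₁ := fromBlocks (-(G * Θ)) 0 0 G'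
  have hdetH : ((X : k[X]) • H₀.map C + H₁.map C).det = 
      C (G.det * G'.det * p.leadingCoeff⁻¹) * p := by
    have : (X : k[X]) • H₀.map C + H₁.map C = fromBlocks ((X : k[X]) • G.map C + (-(G * Θ)).map C)
      0 0 ((X : k[X]) • (-(G' * Θ')).map C + G'.map C) := by
      simp only [H₀, H₁, fromBlocks_map, fromBlocks_smul, fromBlocks_add]
      simp
    rw [this, det_fromBlocks_zero₂₁, det_block_one, det_block_two, hrev, hΘ]
    simp only [C_mul]; ring
  let P : Matrix (Fin p.natDegree ⊕ Fin ((X : k[X]) ^ s).natDegree)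
    (Fin p.natDegree ⊕ Fin ((X : k[X]) ^ s).natDegree) k := diagonal (Pi.mulSingle (e.symm 0) u)
  have hPd : P.det = u := by
    simp only [P, det_diagonal]
    rw [Finset.prod_pi_mulSingle']
    simp
  have hs0 : H₀.IsSymm := Matrix.IsSymm.fromBlocks hG (by simp) hGΘ'.neg
  have hs1 : H₁.IsSymm := Matrix.IsSymm.fromBlocks hGΘ.neg (by simp) hG'
  have hcong : ∀ H : Matrix (Fin p.natDegree ⊕ Fin ((X : k[X]) ^ s).natDegree)
    (Fin p.natDegree ⊕ Fin ((X : k[X]) ^ s).natDegree) k, H.IsSymm → (Pᵀ * H * P).IsSymm := by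
    intro H hH
    rw [Matrix.IsSymm, transpose_mul, transpose_mul, hH.eq, transpose_transpose, Matrix.mul_assoc]
  refine ⟨reindex e e (Pᵀ * H₀ * P), reindex e e (Pᵀ * H₁ * P), (hcong _ hs0).submatrix _,
    (hcong _ hs1).submatrix _, ?_, ?_⟩
  · have : (X : k[X]) • (reindex e e (Pᵀ * H₀ * P)).map C + (reindex e e (Pᵀ * H₁ * P)).map C =
      reindex e e ((X : k[X]) • (Pᵀ * H₀ * P).map C + (Pᵀ * H₁ * P).map C) := by
      ext1 i j; simp [-Matrix.map_mul]
    rw [this, det_reindex_self, det_pencil_congr, hdetH, hPd, ← mul_assoc, ← C_mul]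
    have : u ^ 2 * (G.det * G'.det * p.leadingCoeff⁻¹) = 1 := by
      have h0 : p.leadingCoeff ≠ 0 := by simpa using hp
      rw [← mul_assoc, mul_comm (u ^ 2), hdet, mul_inv_cancel₀ h0]
    rw [this]; simp
  · intro a b hab
    let φ := algebraMap k K
    have hco : Cork (a • H₀.map φ + b • H₁.map φ) := by
      have : a • H₀.map φ + b • H₁.map φ = fromBlocks (a • G.map φ - b • (G.map φ * Θ.map φ)) 0 0
          (b • G'.map φ - a • (G'.map φ * Θ'.map φ)) := by
        simp only [H₀, H₁, fromBlocks_map, fromBlocks_smul, fromBlocks_add, ← Matrix.map_mul]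
        congr 1
        · ext1 i j; simp [sub_eq_add_neg, -Matrix.map_mul]
        · ext1 i j; simp
        · ext1 i j; simp
        · ext1 i j; simp [sub_eq_add_neg, add_comm, -Matrix.map_mul]
      rw [this]
      have hGn : (G.map φ).det ≠ 0 := by
        have : (G.map φ).det = φ G.det := by rw [RingHom.map_det]; rfl
        rw [this]; simpa using hGne
      have hGn' : (G'.map φ).det ≠ 0 := by
        have : (G'.map φ).det = φ G'.det := by rw [RingHom.map_det]; rfl
        rw [this]; simpa using hGne'
      by_cases hb : b = 0
      · have ha : a ≠ 0 := by rintro rfl; exact hab (by rw [hb])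
        apply Cork.block_right
        · apply cork_pencil _ _ (hG'.map _) _ hGn' _ _ _ ha
          · rw [← Matrix.map_mul]; exact hGΘ'.map _
          · intro i j h
            rw [Matrix.map_apply, hc' i j h]; split_ifs <;> simp
        · intro x hx
          apply inj_of_det hGn
          rw [hb, zero_smul, sub_zero, Matrix.smul_mulVec] at hx
          exact (smul_eq_zero.1 hx).resolve_left ha
      · apply Cork.block_left
        · apply cork_pencil _ _ (hG.map _) _ hGn _ _ _ hb
          · rw [← Matrix.map_mul]; exact hGΘ.map _
          · intro i j h
            rw [Matrix.map_apply, hc i j h]; split_ifs <;> simp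
        · intro x hx
          have hd1 : (1 - (a / b) • Θ'.map φ).det = 1 := by
            have := congrArg (Polynomial.eval₂RingHom φ (a / b)) hrev
            rw [Matrix.charpolyRev, RingHom.map_det, map_one] at this
            rw [← this]
            congr 1
            ext1 i j
            by_cases hij : i = j <;> simp [hij] <;> ring
          have hd2 : b • G'.map φ - a • (G'.map φ * Θ'.map φ) =
              b • (G'.map φ * (1 - (a / b) • Θ'.map φ)) := by
            rw [mul_sub, mul_one, mul_smul_comm, smul_sub, smul_smul, mul_div_cancel₀ _ hb]
          rw [hd2, Matrix.smul_mulVec] at hx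
          have := (smul_eq_zero.1 hx).resolve_left hb
          exact inj_of_det (by rw [det_mul, hd1, mul_one]; exact hGn') _ this
    have hPd' : (P.map φ).det ≠ 0 := by
        have : (P.map φ).det = φ P.det := by rw [RingHom.map_det]; rfl
        rw [this, hPd]; simpa using hu
    have := (hco.congr hPd').reindex e
    convert this using 1
    simp only [Matrix.mul_add, Matrix.add_mul, Matrix.mul_smul, Matrix.smul_mul,
      ← Matrix.transpose_map, ← Matrix.map_mul]
    ext1 i j
    simp [φ, -Matrix.map_mul]

theorem exists_cyclic {k V : Type*} [Field k] [AddCommGroup V] [Module k V]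
    (T : Module.End k V) (μ : k[X]) (hμ0 : μ ≠ 0) (hμ : ∀ q, aeval T q = 0 ↔ μ ∣ q) :
    ∃ v, ∀ q, aeval T q v = 0 → μ ∣ q := by
  classical
  have main : ∀ g : k[X], g ∣ μ → ∃ v, aeval T g v = 0 ∧ ∀ q, aeval T q v = 0 → g ∣ q := by
    intro g
    induction g using UniqueFactorizationMonoid.induction_on_coprime with
    | h0 => intro h; exact absurd (zero_dvd_iff.1 h) hμ0
    | h1 hx => intro _; exact ⟨0, by simp, fun q _ => hx.dvd⟩
    | @hpr π i hπ =>
      intro hd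
      rcases Nat.eq_zero_or_pos i with hi | hi
      · subst hi
        exact ⟨0, by simp, fun q _ => by simp⟩
      obtain ⟨h, hh⟩ := hd
      have h1 : aeval T (π ^ (i - 1) * h) ≠ 0 := by
        rw [Ne, hμ]
        rintro ⟨r, hr⟩
        have h0 : π ^ (i - 1) * h ≠ 0 := by
          intro h0
          apply hμ0
          rw [hh, show i = (i - 1) + 1 by omega, pow_succ]
          linear_combination π * h0
        have e : π ^ i = π ^ (i - 1) * π := by rw [← pow_succ]; congr 1; omega
        have : π ^ (i - 1) * h * (1 - π * r) = 0 := by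
          rw [hh, e] at hr
          linear_combination hr
        have := (mul_eq_zero.1 this).resolve_left h0
        exact hπ.not_isUnit (IsUnit.of_mul_eq_one r (by linear_combination -this))
      obtain ⟨w, hw⟩ : ∃ w, aeval T (π ^ (i - 1) * h) w ≠ 0 := by
        by_contra hc
        push Not at hc
        exact h1 (LinearMap.ext hc)
      refine ⟨aeval T h w, ?_, ?_⟩
      · rw [← Module.End.mul_apply, ← map_mul, ← hh, (hμ μ).2 dvd_rfl]; rfl
      · intro q hq
        by_contra hnd
        have hg : EuclideanDomain.gcd q (π ^ i) ∣ π ^ i := EuclideanDomain.gcd_dvd_right _ _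
        obtain ⟨j, hj, hass⟩ := (dvd_prime_pow hπ i).1 hg
        have hji : j < i := by
          rcases hj.lt_or_eq with h | h
          · exact h
          · subst h
            exact absurd (hass.symm.dvd.trans (EuclideanDomain.gcd_dvd_left _ _)) hnd
        have hdvd : EuclideanDomain.gcd q (π ^ i) ∣ π ^ (i - 1) :=
          hass.dvd.trans (pow_dvd_pow _ (by omega))
        obtain ⟨r, hr⟩ := hdvd
        have hz : aeval T (π ^ i) (aeval T h w) = 0 := by
          rw [← Module.End.mul_apply, ← map_mul, ← hh, (hμ μ).2 dvd_rfl]; rfl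
        apply hw
        rw [map_mul, Module.End.mul_apply, hr, EuclideanDomain.gcd_eq_gcd_ab]
        have : (q * EuclideanDomain.gcdA q (π ^ i) + π ^ i * EuclideanDomain.gcdB q (π ^ i)) * r =
          (EuclideanDomain.gcdA q (π ^ i) * r) * q + (EuclideanDomain.gcdB q (π ^ i) * r) * π ^ i := by
          ring
        rw [this, map_add, map_mul (aeval T) _ q, map_mul (aeval T) _ (π ^ i), LinearMap.add_apply,
          Module.End.mul_apply, Module.End.mul_apply, hq, hz]
        simp
    | @hcp x y hxy hx hy =>
      intro hd
      obtain ⟨v, hv, hv'⟩ := hx (dvd_of_mul_right_dvd hd)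
      obtain ⟨w, hw, hw'⟩ := hy (dvd_of_mul_left_dvd hd)
      have hcop : IsCoprime x y := hxy.isCoprime
      refine ⟨v + w, ?_, ?_⟩
      · rw [map_add]
        nth_rw 1 [mul_comm x y]
        rw [map_mul, map_mul, Module.End.mul_apply, Module.End.mul_apply, hv, hw]
        simp
      · intro q hq
        apply hcop.mul_dvd
        · have : aeval T (y * q) (v + w) = 0 := by rw [map_mul, Module.End.mul_apply, hq, map_zero]
          rw [map_add, mul_comm, map_mul, Module.End.mul_apply, Module.End.mul_apply, hw, map_zero,
            add_zero, ← Module.End.mul_apply, ← map_mul] at this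
          exact hcop.dvd_of_dvd_mul_right (hv' _ this)
        · have : aeval T (x * q) (v + w) = 0 := by rw [map_mul, Module.End.mul_apply, hq, map_zero]
          rw [map_add, mul_comm, map_mul, Module.End.mul_apply, Module.End.mul_apply, hv, map_zero,
            zero_add, ← Module.End.mul_apply, ← map_mul] at this
          exact hcop.symm.dvd_of_dvd_mul_right (hw' _ this)
  obtain ⟨v, _, hv⟩ := main μ dvd_rfl
  exact ⟨v, hv⟩

theorem finrank_ker_mul {K V : Type*} [Field K] [AddCommGroup V] [Module K V]
    [FiniteDimensional K V] (f g : Module.End K V) :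
    Module.finrank K (LinearMap.ker (f * g)) ≤
      Module.finrank K (LinearMap.ker f) + Module.finrank K (LinearMap.ker g) := by
  let h := g.domRestrict (LinearMap.ker (f * g))
  rw [← LinearMap.finrank_range_add_finrank_ker h]
  refine add_le_add (Submodule.finrank_mono ?_) ?_
  · rintro _ ⟨⟨x, hx⟩, rfl⟩
    exact hx
  · let F : LinearMap.ker h →ₗ[K] LinearMap.ker g :=
      LinearMap.codRestrict _ ((Submodule.subtype _) ∘ₗ (Submodule.subtype _)) (by
        rintro ⟨⟨x, hx⟩, hx'⟩
        exact hx')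
    apply LinearMap.finrank_le_finrank_of_injective (f := F)
    intro a b hab
    have := congrArg Subtype.val hab
    exact Subtype.ext (Subtype.ext this)

theorem finrank_le_of_annihil {K V : Type*} [Field K] [IsAlgClosed K] [AddCommGroup V] [Module K V]
    [FiniteDimensional K V] (T : Module.End K V)
    (hT : ∀ a : K, Module.finrank K (LinearMap.ker (T - algebraMap K _ a)) ≤ 1)
    (q : K[X]) (hq : q ≠ 0) (h : aeval T q = 0) : Module.finrank K V ≤ q.natDegree := by
  have h1 : ∀ s : Multiset K,
      Module.finrank K (LinearMap.ker (aeval T (s.map fun a => X - C a).prod)) ≤ s.card := by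
    intro s
    induction s using Multiset.induction_on with
    | empty =>
      rw [Multiset.map_zero, Multiset.prod_zero, map_one, Module.End.one_eq_id, LinearMap.ker_id]
      simp
    | cons a s ih =>
      rw [Multiset.map_cons, Multiset.prod_cons, map_mul, Multiset.card_cons]
      refine (finrank_ker_mul _ _).trans ?_
      have := hT a
      have e : aeval T (X - C a) = T - algebraMap K _ a := by simp
      rw [e]
      omega
  have hs := IsAlgClosed.splits q
  have h2 := hs.eq_prod_roots
  have h3 : aeval T (q.roots.map fun a => X - C a).prod = 0 := by
    rw [h2, map_mul, aeval_C, ← Algebra.smul_def] at h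
    exact (smul_eq_zero.1 h).resolve_left (by simpa using hq)
  have h4 := h1 q.roots
  rw [h3, LinearMap.ker_zero, finrank_top] at h4
  exact h4.trans (card_roots' q)

theorem exists_cyclic_matrix {k K : Type*} [Field k] [Field K] [Algebra k K] [IsAlgClosed K]
    {d : ℕ} (T : Matrix (Fin d) (Fin d) k)
    (hT : ∀ a : K, Cork (T.map (algebraMap k K) - a • (1 : Matrix (Fin d) (Fin d) K))) :
    ∃ v : Fin d → k, ∀ q : k[X], aeval T q *ᵥ v = 0 → q.natDegree < d → q = 0 := by
  have hint : IsIntegral k T := Algebra.IsIntegral.isIntegral T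
  have h0 : minpoly k T ≠ 0 := minpoly.ne_zero hint
  have hdeg : d ≤ (minpoly k T).natDegree := by
    let TK : Module.End K (Fin d → K) := Matrix.toLinAlgEquiv' (T.map (algebraMap k K))
    have h1 := finrank_le_of_annihil TK (by
      intro a
      have := finrank_ker_le_one_of_cork (hT a)
      have e : TK - algebraMap K (Module.End K (Fin d → K)) a =
          (T.map (algebraMap k K) - a • (1 : Matrix (Fin d) (Fin d) K)).mulVecLin := by
        refine LinearMap.ext fun x => ?_
        show (T.map (algebraMap k K)) *ᵥ x - a • x = _
        simp [Matrix.sub_mulVec, Matrix.smul_mulVec]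
      rw [e]; exact this) ((minpoly k T).map (algebraMap k K))
      (by simpa using h0) (by
        have e1 : aeval (T.map (algebraMap k K)) ((minpoly k T).map (algebraMap k K)) = 0 := by
          rw [Polynomial.aeval_map_algebraMap]
          have := Polynomial.aeval_algHom_apply ((Algebra.ofId k K).mapMatrix (m := Fin d)) T
            (minpoly k T)
          rw [minpoly.aeval, map_zero] at this
          exact this
        have := Polynomial.aeval_algHom_apply
          (Matrix.toLinAlgEquiv' : Matrix (Fin d) (Fin d) K ≃ₐ[K] _).toAlgHom
          (T.map (algebraMap k K)) ((minpoly k T).map (algebraMap k K))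
        rw [e1, map_zero] at this
        exact this)
    simpa using h1
  have hev : ∀ q : k[X], aeval (Matrix.toLinAlgEquiv' T) q = Matrix.toLinAlgEquiv' (aeval T q) :=
    fun q => Polynomial.aeval_algHom_apply
          (Matrix.toLinAlgEquiv' : Matrix (Fin d) (Fin d) k ≃ₐ[k] _).toAlgHom T q
  obtain ⟨v, hv⟩ := exists_cyclic (Matrix.toLinAlgEquiv' T) (minpoly k T) h0 (by
    intro q
    rw [hev, minpoly.dvd_iff]
    exact map_eq_zero_iff _ (Matrix.toLinAlgEquiv').injective)
  refine ⟨v, fun q hq hqd => ?_⟩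
  have := hv q (by rw [hev]; simpa using hq)
  exact eq_zero_of_dvd_of_natDegree_lt this (by omega)

theorem base_case {k : Type*} (K : Type*) [Field k] [Field K] [Algebra k K] [IsAlgClosed K]
    (p : k[X]) (hp : p ≠ 0) (M₀ M₁ : Matrix (Fin p.natDegree) (Fin p.natDegree) k)
    (h₀ : M₀.IsSymm) (h₁ : M₁.IsSymm) (c : k) (hc : c ≠ 0)
    (hdet : ((X : k[X]) • M₀.map C + M₁.map C).det = C c * p)
    (hcork : ∀ a b : K, (a, b) ≠ (0, 0) →
        Cork (a • M₀.map (algebraMap k K) + b • M₁.map (algebraMap k K))) :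
    ∃ (u : k) (α : AdjoinRoot p), u ≠ 0 ∧ IsUnit α ∧ 
      c * p.leadingCoeff = (-1) ^ (p.natDegree * (p.natDegree - 1) / 2) * u ^ 2 * 
        Algebra.norm k α := by
  have hlc : p.leadingCoeff ≠ 0 := by simpa using hp
  have hd0 : M₀.det = c * p.leadingCoeff := by
    have := Polynomial.coeff_det_X_add_C_card M₀ M₁
    rw [hdet] at this
    simpa using this.symm
  have hdne : M₀.det ≠ 0 := by rw [hd0]; exact mul_ne_zero hc hlc
  have hu : IsUnit M₀.det := isUnit_iff_ne_zero.2 hdne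
  obtain ⟨T, hT⟩ : ∃ T, M₁ = -(M₀ * T) :=
    ⟨-(M₀⁻¹ * M₁), by rw [Matrix.mul_neg, neg_neg, Matrix.mul_nonsing_inv_cancel_left _ _ hu]⟩
  have hMT : M₀ * T = Tᵀ * M₀ := by
    have h2 : (M₀ * T).IsSymm := by
      have := h₁.neg
      rwa [hT, neg_neg] at this
    have := h2.eq
    rw [Matrix.transpose_mul, h₀.eq] at this
    exact this.symm
  have hpT : aeval T p = 0 := by
    rw [hT, det_block_one] at hdet
    have h1 := congrArg (aeval T) hdet
    rw [map_mul, map_mul, Matrix.aeval_self_charpoly, mul_zero, aeval_C, ← Algebra.smul_def] at h1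
    exact (smul_eq_zero.1 h1.symm).resolve_left hc
  obtain ⟨v, hv⟩ := exists_cyclic_matrix (K := K) T (by
    intro a x y hx hy
    apply hcork a 1 (by simp) x y
    all_goals
      have e : a • M₀.map (algebraMap k K) + (1 : K) • M₁.map (algebraMap k K) =
        -(M₀.map (algebraMap k K) * (T.map (algebraMap k K) - a • 1)) := by
        rw [mul_sub, ← Matrix.map_mul, hT, mul_smul_comm, mul_one, one_smul]
        ext1 i j
        simp [-Matrix.map_mul, sub_eq_add_neg]
      rw [e, Matrix.neg_mulVec, ← Matrix.mulVec_mulVec]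
    · rw [hx]; simp
    · rw [hy]; simp)
  obtain ⟨b, hb, -⟩ := exists_adjoinRoot_basis p hp
  obtain ⟨τ, hτ⟩ := exists_tau b _ hb
  let φ : AdjoinRoot p →ₐ[k] Matrix (Fin p.natDegree) (Fin p.natDegree) k :=
    Ideal.Quotient.liftₐ (Ideal.span {p}) (aeval T) (by
      intro a ha
      obtain ⟨r, rfl⟩ := Ideal.mem_span_singleton.1 ha
      rw [map_mul, hpT, zero_mul])
  have hφ : φ (AdjoinRoot.root p) = T := by
    have : φ (AdjoinRoot.root p) = aeval T (X : k[X]) := rfl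
    rw [this, aeval_X]
  let l : AdjoinRoot p →ₗ[k] k :=
    { toFun := fun a => v ⬝ᵥ (M₀ * φ a) *ᵥ v
      map_add' := by intro x y; simp [mul_add, Matrix.add_mulVec]
      map_smul' := by intro x y; simp [Matrix.smul_mulVec] }
  obtain ⟨α, hα⟩ := exists_mulFun b τ (by rw [hτ]; simp) l
  let P : Matrix (Fin p.natDegree) (Fin p.natDegree) k := Matrix.of fun i j => ((T ^ (j : ℕ)) *ᵥ v) i
  have hcomm : ∀ i : ℕ, (T ^ i)ᵀ * M₀ = M₀ * T ^ i := by
    intro i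
    induction i with
    | zero => simp
    | succ i ih =>
      rw [pow_succ, Matrix.transpose_mul, Matrix.mul_assoc, ih, ← Matrix.mul_assoc, ← hMT,
        Matrix.mul_assoc, ← pow_succ', ← pow_succ]
  have hgram : frobGram b l = Pᵀ * M₀ * P := by
    ext i j
    have e1 : (Pᵀ * M₀ * P) i j = (T ^ (i : ℕ) *ᵥ v) ⬝ᵥ (M₀ *ᵥ (T ^ (j : ℕ) *ᵥ v)) := by
      rw [Matrix.mul_assoc, Matrix.mul_apply, dotProduct]
      refine Finset.sum_congr rfl fun r _ => ?_
      rw [Matrix.mul_apply]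
      rfl
    rw [e1]
    have e2 : l (b i * b j) = v ⬝ᵥ (M₀ * (T ^ (i : ℕ) * T ^ (j : ℕ))) *ᵥ v := by
      show v ⬝ᵥ (M₀ * φ (b i * b j)) *ᵥ v = _
      rw [map_mul, hb, hb, map_pow, map_pow, hφ]
    rw [frobGram, Matrix.of_apply, e2, ← Matrix.mul_assoc, ← hcomm, ← Matrix.mulVec_mulVec,
      ← Matrix.mulVec_mulVec, Matrix.dotProduct_mulVec, Matrix.vecMul_transpose]
  have hP : P.det ≠ 0 := by
    intro hP0
    obtain ⟨x, hx0, hx⟩ := Matrix.exists_mulVec_eq_zero_iff.2 hP0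
    apply hx0
    let q : k[X] := ∑ i : Fin p.natDegree, C (x i) * X ^ (i : ℕ)
    have hq0 : q = 0 := by
      apply hv
      · rw [← hx]
        simp only [q, map_sum, map_mul, aeval_C, map_pow, aeval_X, Matrix.sum_mulVec,
          ← Algebra.smul_def, Matrix.smul_mulVec]
        ext i
        simp [P, Matrix.mulVec, dotProduct, mul_comm]
      · rcases Nat.eq_zero_or_pos p.natDegree with h | h
        · exfalso
          apply hx0
          ext i
          exact absurd i.2 (by omega)
        · have : q.natDegree ≤ p.natDegree - 1 := by
            refine natDegree_sum_le_of_forall_le _ _ fun i _ => ?_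
            exact (natDegree_C_mul_X_pow_le _ _).trans (by omega)
          omega
    ext i
    have := congrArg (fun q => coeff q (i : ℕ)) hq0
    simp only [q, finsetSum_coeff, coeff_C_mul_X_pow, coeff_zero] at this
    rw [Finset.sum_eq_single i] at this
    · simpa using this
    · intro j _ hj
      rw [if_neg]
      intro h
      exact hj (Fin.ext h.symm)
    · simp
  have hfin : P.det ^ 2 * (c * p.leadingCoeff) =
      (-1) ^ (p.natDegree * (p.natDegree - 1) / 2) * Algebra.norm k α := by
    rw [← hτ, ← det_gram_mul, ← hα, hgram, det_mul, det_mul, det_transpose, hd0]; ring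
  refine ⟨P.det⁻¹, α, inv_ne_zero hP, isUnit_of_norm_ne_zero b _ ?_, ?_⟩
  · intro h
    rw [h, mul_zero] at hfin
    exact mul_ne_zero (pow_ne_zero 2 hP) (mul_ne_zero hc hlc) hfin
  · field_simp
    linear_combination hfin

theorem exists_first_col {k : Type*} [Field k] {n : ℕ} (v : Fin (n+1) → k) (hv : v ≠ 0) :
    ∃ Q : Matrix (Fin (n+1)) (Fin (n+1)) k, Q.det ≠ 0 ∧ Q *ᵥ Pi.single 0 1 = v := by
  obtain ⟨i, hi⟩ := Function.ne_iff.1 hv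
  refine ⟨((1 : Matrix (Fin (n+1)) (Fin (n+1)) k).updateCol i v).submatrix id (Equiv.swap 0 i), ?_, ?_⟩
  · rw [Matrix.det_permute']
    refine mul_ne_zero ?_ ?_
    · rcases Int.units_eq_one_or (Equiv.Perm.sign (Equiv.swap 0 i)) with h | h <;> rw [h] <;> simp
    · rw [← Matrix.cramer_apply, Matrix.cramer_one]
      exact hi
  · ext r
    simp [Matrix.submatrix_apply]

theorem exists_dual {k : Type*} [Field k] {n : ℕ} (φ : Fin (n+2) → k) (hφ : φ ≠ 0) (h0 : φ 0 = 0) :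
    ∃ Q : Matrix (Fin (n+2)) (Fin (n+2)) k, Q.det ≠ 0 ∧ Q *ᵥ Pi.single 0 1 = Pi.single 0 1 ∧
      Qᵀ *ᵥ φ = Pi.single 1 1 := by
  obtain ⟨j, hj⟩ := Function.ne_iff.1 hφ
  have hj0 : j ≠ 0 := by rintro rfl; exact hj h0
  set W := (1 : Matrix (Fin (n+2)) (Fin (n+2)) k).updateRow j φ with hW
  have hWd : W.det ≠ 0 := by
    rw [hW, ← Matrix.det_transpose, ← Matrix.updateCol_transpose, Matrix.transpose_one,
      ← Matrix.cramer_apply, Matrix.cramer_one]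
    exact hj
  have hu : IsUnit W.det := isUnit_iff_ne_zero.2 hWd
  have hW0 : W *ᵥ Pi.single 0 1 = Pi.single 0 1 := by
    ext r
    by_cases hr : r = j
    · subst hr
      simp [hW, h0, hj0]
    · simp [hW, hr, Matrix.one_apply, Pi.single_apply]
  have hWj : Wᵀ *ᵥ Pi.single j 1 = φ := by
    ext r
    simp [hW]
  refine ⟨W⁻¹.submatrix id (Equiv.swap 1 j), ?_, ?_, ?_⟩
  · rw [Matrix.det_permute']
    refine mul_ne_zero ?_ ?_
    · rcases Int.units_eq_one_or (Equiv.Perm.sign (Equiv.swap 1 j)) with h | h <;> rw [h] <;> simp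
    · rw [Matrix.det_nonsing_inv, Ring.inverse_eq_inv']
      exact inv_ne_zero hWd
  · rw [Matrix.submatrix_mulVec_equiv]
    have : (Pi.single 0 1 : Fin (n+2) → k) ∘ (Equiv.swap 1 j).symm = Pi.single 0 1 := by
      ext r
      simp only [Function.comp, Pi.single_apply, Equiv.symm_swap]
      congr 1
      rw [Equiv.swap_apply_eq_iff, Equiv.swap_apply_of_ne_of_ne (by simp) hj0.symm]
    rw [this]
    nth_rw 1 [← hW0]
    rw [Matrix.mulVec_mulVec, Matrix.nonsing_inv_mul _ hu, Matrix.one_mulVec]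
    rfl
  · rw [Matrix.transpose_submatrix]
    have h1 : W⁻¹ᵀ *ᵥ φ = Pi.single j 1 := by
      rw [← hWj, Matrix.mulVec_mulVec, ← Matrix.transpose_mul, Matrix.mul_nonsing_inv _ hu,
        Matrix.transpose_one, Matrix.one_mulVec]
    have h2 := Matrix.submatrix_mulVec_equiv W⁻¹ᵀ φ (Equiv.swap 1 j) (Equiv.refl _)
    have h3 : φ ∘ (Equiv.refl (Fin (n+2))).symm = φ := rfl
    rw [h3, h1] at h2
    refine h2.trans ?_
    ext r
    simp only [Function.comp, Pi.single_apply]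
    congr 1
    rw [Equiv.swap_apply_eq_iff, Equiv.swap_apply_right]

structure Good {k : Type*} (K : Type*) [Field k] [Field K] [Algebra k K] (p : k[X]) {m : ℕ} (c : k)
    (M₀ M₁ : Matrix (Fin m) (Fin m) k) : Prop where
  s0 : M₀.IsSymm
  s1 : M₁.IsSymm
  hc : c ≠ 0
  hdet : ((X : k[X]) • M₀.map C + M₁.map C).det = C c * p
  hcork : ∀ a b : K, (a, b) ≠ (0, 0) →
        Cork (a • M₀.map (algebraMap k K) + b • M₁.map (algebraMap k K))

theorem Good.congr {k K : Type*} [Field k] [Field K] [Algebra k K] {p : k[X]} {m : ℕ} {c : k}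
    {M₀ M₁ : Matrix (Fin m) (Fin m) k} (h : Good K p c M₀ M₁) {P : Matrix (Fin m) (Fin m) k}
    (hP : P.det ≠ 0) : Good K p (P.det ^ 2 * c) (Pᵀ * M₀ * P) (Pᵀ * M₁ * P) where
  s0 := by
    show (Pᵀ * M₀ * P)ᵀ = _
    rw [Matrix.transpose_mul, Matrix.transpose_mul, h.s0.eq, Matrix.transpose_transpose,
      Matrix.mul_assoc]
  s1 := by
    show (Pᵀ * M₁ * P)ᵀ = _
    rw [Matrix.transpose_mul, Matrix.transpose_mul, h.s1.eq, Matrix.transpose_transpose,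
      Matrix.mul_assoc]
  hc := mul_ne_zero (pow_ne_zero 2 hP) h.hc
  hdet := by
    rw [det_pencil_congr, h.hdet, C_mul, mul_assoc]
  hcork := by
    intro a b hab
    have h1 := (h.hcork a b hab).congr (P := P.map (algebraMap k K)) (by
      have : (P.map (algebraMap k K)).det = algebraMap k K P.det := by
        rw [RingHom.map_det]; rfl
      rw [this]
      simpa using hP)
    convert h1 using 1
    rw [Matrix.map_mul, Matrix.map_mul, Matrix.map_mul, Matrix.map_mul, Matrix.transpose_map,
      Matrix.mul_add, Matrix.add_mul, Matrix.mul_smul, Matrix.smul_mul, Matrix.mul_smul,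
      Matrix.smul_mul]

theorem Good.corner {k K : Type*} [Field k] [Field K] [Algebra k K] {p : k[X]} {m : ℕ} {c : k}
    {M₀ M₁ : Matrix (Fin (m+2)) (Fin (m+2)) k} (h : Good K p c M₀ M₁) (hp : p.natDegree ≤ m)
    (h0 : ∀ i, M₀ i 0 = 0) : M₁ 0 0 = 0 := by
  have h0' : ∀ i, M₀ 0 i = 0 := fun i => by rw [h.s0.apply]; exact h0 i
  have hA : (M₀.submatrix Fin.succ Fin.succ).det ≠ 0 := by
    intro hA
    obtain ⟨x, hx0, hx⟩ := Matrix.exists_mulVec_eq_zero_iff.2 hA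
    have hx2 : M₀ *ᵥ (Fin.cons 0 x : Fin (m+2) → k) = 0 := by
      ext i
      refine Fin.cases ?_ (fun i => ?_) i
      · simp [Matrix.mulVec, dotProduct, h0']
      · have := congrFun hx i
        simpa [Matrix.mulVec, dotProduct, Fin.sum_univ_succ] using this
    have hx1 : M₀ *ᵥ (Pi.single 0 1 : Fin (m+2) → k) = 0 := by
      ext i
      simp [h0]
    have hmap : ∀ y : Fin (m+2) → k, M₀ *ᵥ y = 0 →
      ((1:K) • M₀.map (algebraMap k K) + (0:K) • M₁.map (algebraMap k K)) *ᵥ (algebraMap k K ∘ y) = 0 := by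
      intro y hy
      ext i
      have := RingHom.map_mulVec (algebraMap k K) M₀ y i
      rw [hy] at this
      simpa using this.symm
    obtain ⟨c, d, hcd, he⟩ := h.hcork 1 0 (by simp) _ _ (hmap _ hx1) (hmap _ hx2)
    have e0 : c = 0 := by simpa using congrFun he 0
    have hd : d ≠ 0 := by tauto
    apply hx0
    ext i
    simpa [hd] using congrFun he i.succ
  have hco : ((X : k[X]) • M₀.map C + M₁.map C).det.coeff (m+1) = 0 := by
    apply coeff_eq_zero_of_natDegree_lt
    rw [h.hdet, natDegree_C_mul h.hc]; omega
  rw [Matrix.det_succ_row_zero, finsetSum_coeff, Finset.sum_eq_single 0] at hco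
  · have e : ((X : k[X]) • M₀.map C + M₁.map C).submatrix Fin.succ (Fin.succAbove 0) =
      (X : k[X]) • (M₀.submatrix Fin.succ Fin.succ).map C + (M₁.submatrix Fin.succ Fin.succ).map C := by
      ext i j; simp
    have e2 : ((X : k[X]) • M₀.map C + M₁.map C) 0 0 = C (M₁ 0 0) := by simp [h0]
    rw [e, e2] at hco
    have e3 := Polynomial.coeff_det_X_add_C_card (M₀.submatrix Fin.succ Fin.succ) (M₁.submatrix Fin.succ Fin.succ)
    rw [Fintype.card_fin] at e3
    simp only [Fin.val_zero, pow_zero, one_mul, coeff_C_mul, e3] at hco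
    exact (mul_eq_zero.1 hco).resolve_right hA
  · intro j _ hj
    have e : ((X : k[X]) • M₀.map C + M₁.map C).submatrix Fin.succ (Fin.succAbove j) =
      (X : k[X]) • (M₀.submatrix Fin.succ j.succAbove).map C + (M₁.submatrix Fin.succ j.succAbove).map C := by
      ext i j; simp
    have e2 : ((X : k[X]) • M₀.map C + M₁.map C) 0 j = C (M₁ 0 j) := by simp [h0']
    have e3 := Polynomial.coeff_det_X_add_C_card (M₀.submatrix Fin.succ j.succAbove) (M₁.submatrix Fin.succ j.succAbove)
    have e5 : (M₀.submatrix Fin.succ j.succAbove).det = 0 :=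
      Matrix.det_eq_zero_of_column_eq_zero 0 (by
        intro i
        simp [Fin.succAbove_ne_zero_zero hj, h0])
    rw [Fintype.card_fin, e5] at e3
    rw [e, e2]
    have e4 : ((-1 : k[X]) ^ (j : ℕ)) = C ((-1) ^ (j : ℕ)) := by simp
    rw [e4, mul_assoc, coeff_C_mul, coeff_C_mul, e3]
    simp
  · simp

theorem Good.strip {k K : Type*} [Field k] [Field K] [Algebra k K] {p : k[X]} {m : ℕ} {c : k}
    {M₀ M₁ : Matrix (Fin (m+2)) (Fin (m+2)) k} (h : Good K p c M₀ M₁)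
    (h0 : ∀ i, M₀ i 0 = 0) (h1 : ∀ i, M₁ i 0 = (Pi.single 1 1 : Fin (m+2) → k) i) :
    Good K p (-c) (M₀.submatrix (Fin.succ ∘ Fin.succ) (Fin.succ ∘ Fin.succ))
      (M₁.submatrix (Fin.succ ∘ Fin.succ) (Fin.succ ∘ Fin.succ)) where
  s0 := h.s0.submatrix _
  s1 := h.s1.submatrix _
  hc := neg_ne_zero.2 h.hc
  hdet := by
    have h0' : ∀ i, M₀ 0 i = 0 := fun i => by rw [h.s0.apply]; exact h0 i
    have h1' : ∀ i, M₁ 0 i = (Pi.single 1 1 : Fin (m+2) → k) i := fun i => by rw [h.s1.apply]; exact h1 i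
    have hd := h.hdet
    rw [Matrix.det_succ_row_zero, Finset.sum_eq_single 1, Matrix.det_succ_column_zero,
      Finset.sum_eq_single 0] at hd
    · have e : ((((X : k[X]) • M₀.map C + M₁.map C).submatrix Fin.succ (Fin.succAbove 1)).submatrix
          (Fin.succAbove 0) Fin.succ) = (X : k[X]) • (M₀.submatrix (Fin.succ ∘ Fin.succ) (Fin.succ ∘ Fin.succ)).map C
          + (M₁.submatrix (Fin.succ ∘ Fin.succ) (Fin.succ ∘ Fin.succ)).map C := by
        ext1 i j
        have : Fin.succAbove (1 : Fin (m+2)) j.succ = j.succ.succ := by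
          rw [← Fin.succ_zero_eq_one, Fin.succ_succAbove_succ]; simp
        simp [this]
      rw [e] at hd
      have e1 : (((X : k[X]) • M₀.map C + M₁.map C).submatrix Fin.succ (Fin.succAbove 1)) 0 0 = 1 := by
        simp [h0, h1]
      have e2 : ((X : k[X]) • M₀.map C + M₁.map C) 0 1 = 1 := by
        simp [h0', h1']
      rw [e1, e2] at hd
      simp only [Fin.val_one, Fin.val_zero, pow_one, pow_zero, mul_one, one_mul] at hd
      rw [C_neg]
      linear_combination -hd
    · intro i _ hi
      have : i.succ ≠ 1 := by
        rw [← Fin.succ_zero_eq_one]; exact fun h => hi (Fin.succ_injective _ h)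
      simp [h0, h1, this]
    · simp
    · intro i _ hi
      simp [h0', h1', hi]
    · simp
  hcork := by
    intro a b hab x y hx hy
    have h0' : ∀ i, M₀ 0 i = 0 := fun i => by rw [h.s0.apply]; exact h0 i
    have h1' : ∀ i, M₁ 0 i = (Pi.single 1 1 : Fin (m+2) → k) i := fun i => by rw [h.s1.apply]; exact h1 i
    set N := a • M₀.map (algebraMap k K) + b • M₁.map (algebraMap k K) with hN
    have e : a • (M₀.submatrix (Fin.succ ∘ Fin.succ) (Fin.succ ∘ Fin.succ)).map (algebraMap k K) +
      b • (M₁.submatrix (Fin.succ ∘ Fin.succ) (Fin.succ ∘ Fin.succ)).map (algebraMap k K) =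
      N.submatrix (Fin.succ ∘ Fin.succ) (Fin.succ ∘ Fin.succ) := by
      ext i j; simp [hN]
    rw [e] at hx hy
    have hcol0 : N 0 0 = 0 := by simp [hN, h0, h1]
    have hcol1 : N 1 0 = b := by simp [hN, h0, h1]
    have hcol2 : ∀ i : Fin m, N i.succ.succ 0 = 0 := by
      intro i
      have : i.succ.succ ≠ 1 := by
        rw [← Fin.succ_zero_eq_one]; exact fun h => Fin.succ_ne_zero _ (Fin.succ_injective _ h)
      simp [hN, h0, h1, this]
    have hrow2 : ∀ i : Fin m, N 0 i.succ.succ = 0 := by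
      intro i
      have : i.succ.succ ≠ 1 := by
        rw [← Fin.succ_zero_eq_one]; exact fun h => Fin.succ_ne_zero _ (Fin.succ_injective _ h)
      simp [hN, h0', h1', this]
    let r : (Fin m → K) → K := fun z => ∑ i, N 1 i.succ.succ * z i
    have key : ∀ (z0 : K) (z : Fin m → K), N.submatrix (Fin.succ ∘ Fin.succ) (Fin.succ ∘ Fin.succ) *ᵥ z = 0 →
        b * z0 + r z = 0 → N *ᵥ (Fin.cons z0 (Fin.cons 0 z : Fin (m+1) → K) : Fin (m+2) → K) = 0 := by
      intro z0 z hz hr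
      ext i
      refine Fin.cases ?_ (fun i => Fin.cases ?_ (fun i => ?_) i) i
      · simp [Matrix.mulVec, dotProduct, Fin.sum_univ_succ, hcol0, hrow2]
      · simpa [Matrix.mulVec, dotProduct, Fin.sum_univ_succ, hcol1] using hr
      · have := congrFun hz i
        simpa [Matrix.mulVec, dotProduct, Fin.sum_univ_succ, hcol2] using this
    have hC := h.hcork a b hab
    rw [← hN] at hC
    by_cases hb : b = 0
    · obtain ⟨c, d, hcd, hr⟩ : ∃ c d : K, (c ≠ 0 ∨ d ≠ 0) ∧ c * r x + d * r y = 0 := by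
        by_cases hrx : r x = 0
        · exact ⟨1, 0, by simp, by simp [hrx]⟩
        · exact ⟨r y, - r x, by right; simpa using hrx, by ring⟩
      refine ⟨c, d, hcd, ?_⟩
      have hrl : r (c • x + d • y) = 0 := by
        rw [← hr]
        simp only [r, Finset.mul_sum, ← Finset.sum_add_distrib, Pi.add_apply, Pi.smul_apply, smul_eq_mul]
        exact Finset.sum_congr rfl fun i _ => by ring
      have k1 := key 0 (c • x + d • y) (by
        rw [Matrix.mulVec_add, Matrix.mulVec_smul, Matrix.mulVec_smul, hx, hy]; simp) (by
        rw [hrl]; simp)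
      have k2 := key 1 0 (by simp) (by simp [r, hb])
      obtain ⟨c', d', hcd', he⟩ := hC _ _ k2 k1
      have e0 : c' = 0 := by simpa using congrFun he 0
      have hd : d' ≠ 0 := by tauto
      ext i
      have := congrFun he i.succ.succ
      simpa [hd, e0, -smul_add] using this
    · obtain ⟨c', d', hcd', he⟩ := hC _ _ (key (-(r x) / b) x hx (by field_simp; ring))
        (key (-(r y) / b) y hy (by field_simp; ring))
      refine ⟨c', d', hcd', ?_⟩
      ext i
      simpa using congrFun he i.succ.succ

theorem strip_thm {k : Type*} (K : Type*) [Field k] [Field K] [Algebra k K] [IsAlgClosed K]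
    (p : k[X]) (hp : p ≠ 0) (t : ℕ) : ∀ (m : ℕ) (c : k) (M₀ M₁ : Matrix (Fin m) (Fin m) k),
    Good K p c M₀ M₁ → p.natDegree + 2 * t = m → ∃ (u : k) (α : AdjoinRoot p), u ≠ 0 ∧ IsUnit α ∧
      c * p.leadingCoeff = (-1) ^ (m * (m - 1) / 2) * u ^ 2 * Algebra.norm k α := by
  induction t with
  | zero =>
    intro m c M₀ M₁ h hm
    obtain rfl : p.natDegree = m := by omega
    exact base_case K p hp M₀ M₁ h.s0 h.s1 c h.hc h.hdet h.hcork
  | succ t ih =>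
    intro m' c M₀ M₁ h hm
    obtain ⟨m, rfl⟩ : ∃ m, m' = m + 2 := ⟨m' - 2, by omega⟩
    have hd0 : M₀.det = 0 := by
      have := Polynomial.coeff_det_X_add_C_card M₀ M₁
      rw [h.hdet, coeff_eq_zero_of_natDegree_lt] at this
      · exact this.symm
      · rw [natDegree_C_mul h.hc, Fintype.card_fin]; omega
    obtain ⟨v, hv0, hv⟩ := Matrix.exists_mulVec_eq_zero_iff.2 hd0
    obtain ⟨Q, hQ, hQv⟩ := exists_first_col v hv0
    have h1 := h.congr hQ
    have hN0 : ∀ i, (Qᵀ * M₀ * Q) i 0 = 0 := by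
      have : (Qᵀ * M₀ * Q) *ᵥ Pi.single 0 1 = 0 := by
        rw [← Matrix.mulVec_mulVec, hQv, ← Matrix.mulVec_mulVec, hv, Matrix.mulVec_zero]
      intro i
      simpa using congrFun this i
    generalize Qᵀ * M₀ * Q = N₀ at h1 hN0
    generalize Qᵀ * M₁ * Q = N₁ at h1
    have hcor := h1.corner (by omega) hN0
    obtain ⟨R, hR, hR0, hR1⟩ := exists_dual (fun i => N₁ i 0) (by
      intro hz
      have := h1.hdet
      rw [Matrix.det_eq_zero_of_column_eq_zero 0 (by
        intro i
        simp [hN0, congrFun hz i])] at this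
      have h3 := h1.hc
      exact mul_ne_zero (by simpa using h3) hp this.symm) hcor
    have h2 := h1.congr hR
    have h3 := h2.strip (by
      have : (Rᵀ * N₀ * R) *ᵥ Pi.single 0 1 = 0 := by
        rw [← Matrix.mulVec_mulVec, hR0, ← Matrix.mulVec_mulVec]
        have : N₀ *ᵥ Pi.single 0 1 = 0 := by ext i; simp [hN0]
        rw [this, Matrix.mulVec_zero]
      intro i
      simpa using congrFun this i) (by
      have : (Rᵀ * N₁ * R) *ᵥ Pi.single 0 1 = Pi.single 1 1 := by
        rw [← Matrix.mulVec_mulVec, hR0, ← Matrix.mulVec_mulVec]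
        have : N₁ *ᵥ Pi.single 0 1 = fun i => N₁ i 0 := by ext i; simp
        rw [this, hR1]
      intro i
      rw [← this]
      simp)
    obtain ⟨u, α, hu, hα, he⟩ := ih m _ _ _ h3 (by omega)
    refine ⟨u / (R.det * Q.det), α, div_ne_zero hu (mul_ne_zero hR hQ), hα, ?_⟩
    have hs : (-1 : k) ^ ((m + 2) * (m + 2 - 1) / 2) = - (-1) ^ (m * (m - 1) / 2) := by
      have e : (m + 2) * (m + 2 - 1) / 2 = m * (m - 1) / 2 + (2 * m + 1) := by
        rcases m with _ | m
        · rfl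
        · have : (m + 1 + 2) * (m + 1 + 2 - 1) = (m + 1) * (m + 1 - 1) + 2 * (2 * (m + 1) + 1) := by
            simp only [Nat.add_sub_cancel, show m + 1 + 2 - 1 = m + 2 by omega]; ring
          rw [this]; omega
      rw [e, pow_add, pow_succ, pow_mul]; simp
    rw [hs]
    field_simp
    linear_combination -he

theorem alg_norm_pair {k A B : Type*} [Field k] [CommRing A] [CommRing B] [Algebra k A] [Algebra k B]
    [Module.Finite k A] [Module.Finite k B] (a : A) (b : B) :
    Algebra.norm k (a, b) = Algebra.norm k a * Algebra.norm k b := by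
  rw [Algebra.norm_apply, Algebra.norm_apply, Algebra.norm_apply, ← LinearMap.det_prodMap]
  congr 1

theorem finite_adjoinRoot {k : Type*} [Field k] (p : k[X]) (hp : p ≠ 0) :
    Module.Finite k (AdjoinRoot p) := by
  obtain ⟨b, -⟩ := exists_adjoinRoot_basis p hp
  exact Module.Finite.of_basis b

theorem exists_regular_symmetric_pair_iff_norm_condition
    (k : Type*) [Field k] (n : ℕ) (hn : 1 ≤ n)
    (f : MvPolynomial (Fin 2) k) (hf0 : f ≠ 0) (hfh : f.IsHomogeneous (n + 1)) :
    (∃ M₀ M₁ : Matrix (Fin (n + 1)) (Fin (n + 1)) k,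
      M₀.IsSymm ∧ M₁.IsSymm ∧
      ((MvPolynomial.X 0 : MvPolynomial (Fin 2) k) •
          M₀.map (MvPolynomial.C : k → MvPolynomial (Fin 2) k)
        + (MvPolynomial.X 1 : MvPolynomial (Fin 2) k) •
          M₁.map (MvPolynomial.C : k → MvPolynomial (Fin 2) k)).det = f ∧
      ∀ a b : AlgebraicClosure k, (a, b) ≠ (0, 0) →
        n ≤ (a • M₀.map (algebraMap k (AlgebraicClosure k))
          + b • M₁.map (algebraMap k (AlgebraicClosure k))).rank) ↔
    (∃ (u : kˣ) (α : (SegreAlgebra k n f)ˣ),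
      (dehomog f).leadingCoeff =
        (-1 : k) ^ (n * (n + 1) / 2) * (u : k) ^ 2 *
          Algebra.norm k (α : SegreAlgebra k n f)) := by
  have hp : dehomog f ≠ 0 := fun h => hf0 (dehomog_eq_zero f (n + 1) hfh h)
  have hd : (dehomog f).natDegree ≤ n + 1 := dehomog_natDegree_le f (n + 1) hfh
  have hX : (X : k[X]) ^ (n + 1 - (dehomog f).natDegree) ≠ 0 := pow_ne_zero _ X_ne_zero
  have fin1 := finite_adjoinRoot _ hp
  have fin2 := finite_adjoinRoot _ hX
  constructor
  · rintro ⟨M₀, M₁, h0, h1, hdet, hrank⟩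
    have hpd : ((X : k[X]) • M₀.map C + M₁.map C).det = dehomog f := by
      rw [← pencil_dehomog, hdet]
    have hlc : (dehomog f).leadingCoeff ≠ 0 := leadingCoeff_ne_zero.2 hp
    rcases Nat.even_or_odd' (n + 1 - (dehomog f).natDegree) with ⟨t, ht | ht⟩
    · obtain ⟨u, α, hu, hα, he⟩ := strip_thm (AlgebraicClosure k) (dehomog f) hp t (n + 1) 1 M₀ M₁
        ⟨h0, h1, one_ne_zero, by rw [hpd]; simp, fun a b hab => (cork_iff _).1 (hrank a b hab)⟩
        (by omega)
      refine ⟨Units.mk0 u hu, MulEquiv.prodUnits.symm (hα.unit, 1), ?_⟩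
      have e : ((MulEquiv.prodUnits.symm (hα.unit, 1) : (SegreAlgebra k n f)ˣ) : SegreAlgebra k n f)
        = (α, 1) := rfl
      rw [e, alg_norm_pair, map_one, mul_one, ← one_mul (dehomog f).leadingCoeff, he,
        Nat.add_sub_cancel, mul_comm n (n + 1)]
      rfl
    · set c : k := (-1 : k) ^ (n * (n + 1) / 2) * (dehomog f).leadingCoeff with hc
      have hc0 : c ≠ 0 := mul_ne_zero (pow_ne_zero _ (by simp)) hlc
      have hcu : IsUnit (algebraMap k (AdjoinRoot ((X : k[X]) ^ (n + 1 - (dehomog f).natDegree))) c) :=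
        (isUnit_iff_ne_zero.2 hc0).map _
      refine ⟨Units.mk0 ((c ^ t)⁻¹) (inv_ne_zero (pow_ne_zero _ hc0)),
        MulEquiv.prodUnits.symm (1, hcu.unit), ?_⟩
      have e : ((MulEquiv.prodUnits.symm (1, hcu.unit) : (SegreAlgebra k n f)ˣ) : SegreAlgebra k n f)
        = (1, algebraMap k _ c) := rfl
      obtain ⟨b, -⟩ := exists_adjoinRoot_basis _ hX
      rw [e, alg_norm_pair, map_one, one_mul, Algebra.norm_algebraMap_of_basis b, Fintype.card_fin,
        natDegree_X_pow, ht, Units.val_mk0]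
      have h2 : ((c ^ t)⁻¹) ^ 2 * c ^ (2 * t + 1) = c := by
        field_simp
        ring
      rw [mul_assoc, h2, hc, ← mul_assoc, ← mul_pow]
      simp
  · rintro ⟨u, ⟨⟨α, β⟩, ⟨α', β'⟩, hαβ, hβα⟩, he⟩
    have e1 : α * α' = 1 := congrArg Prod.fst hαβ
    have e2 : β * β' = 1 := congrArg Prod.snd hαβ
    have hα : Algebra.norm k α ≠ 0 := ((IsUnit.of_mul_eq_one _ e1).map (Algebra.norm k)).ne_zero
    have hβ : Algebra.norm k β ≠ 0 := ((IsUnit.of_mul_eq_one _ e2).map (Algebra.norm k)).ne_zero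
    have he' : (dehomog f).leadingCoeff = (-1 : k) ^ (n * (n + 1) / 2) * (u : k) ^ 2 *
          (Algebra.norm k α * Algebra.norm k β) := by
      rw [← alg_norm_pair]; exact he
    rw [mul_comm n (n + 1)] at he'
    obtain ⟨M₀, M₁, h0, h1, hdet, hc⟩ := construct (K := AlgebraicClosure k) (dehomog f) hp
      (n + 1 - (dehomog f).natDegree) n (by omega) α β u hα hβ u.ne_zero he'
    refine ⟨M₀, M₁, h0, h1, ?_, fun a b hab => (cork_iff _).2 (hc a b hab)⟩
    exact dehomog_inj (pencil_homog M₀ M₁) hfh (by rw [pencil_dehomog, hdet])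
end
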